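/- arXiv:1103.1796 — 4 statements merged into one kernel-verified Lean document; each statement's English description precedes it below -/
import Mathlib

section
/- Let r > 0 and a, b ≥ 0. Let w : B_r → ℝ be a C² function satisfying the pointwise inequalities Δw ≥ −a − b·w² and w ≥ 0 on B_r, and suppose b·∫_{B_r} w < π/16. Then w(0) ≤ a·r²/8 + (8/(π·r²))·∫_{B_r} w. -/
open MeasureTheory Metric Complex Set
open scoped ENNReal Real Topology

noncomputable section

/-- The partial derivative in the `s`-direction (real direction) of `f : ℂ → F`. -/
def pds {F : Type*} [NormedAddCommGroup F] [NormedSpace ℝ F] (f : ℂ → F) (z : ℂ) : F :=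
  fderiv ℝ f z 1

/-- The partial derivative in the `t`-direction (imaginary direction) of `f : ℂ → F`. -/
def pdt {F : Type*} [NormedAddCommGroup F] [NormedSpace ℝ F] (f : ℂ → F) (z : ℂ) : F :=
  fderiv ℝ f z Complex.I

/-- The standard Laplacian `Δ = ∂_s² + ∂_t²` on `ℝ² ≅ ℂ`. -/
def lap {F : Type*} [NormedAddCommGroup F] [NormedSpace ℝ F] (f : ℂ → F) (z : ℂ) : F :=
  pds (fun w => pds f w) z + pdt (fun w => pdt f w) z

lemma hasDerivAt_intervalIntegral_of_continuous {F F' : ℝ → ℝ → ℝ} {a b : ℝ}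
    (hF : Continuous (Function.uncurry F)) (hF' : Continuous (Function.uncurry F'))
    (h : ∀ x t, HasDerivAt (fun y => F y t) (F' x t) x) (x : ℝ) :
    HasDerivAt (fun y => ∫ t in a..b, F y t) (∫ t in a..b, F' x t) x := by
  obtain ⟨C, hC⟩ := ((isCompact_closedBall x 1).prod
    (isCompact_uIcc (a := a) (b := b))).exists_bound_of_continuousOn hF'.continuousOn
  have hc : ∀ y, Continuous (F y) := fun y => hF.comp (by fun_prop : Continuous fun t => (y, t))
  have hc' : ∀ y, Continuous (F' y) := fun y => hF'.comp (by fun_prop : Continuous fun t => (y, t))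
  refine (intervalIntegral.hasDerivAt_integral_of_dominated_loc_of_deriv_le
    (s := closedBall x 1) (bound := fun _ => C) (closedBall_mem_nhds x one_pos)
    (.of_forall fun y => (hc y).aestronglyMeasurable) ((hc x).intervalIntegrable a b)
    (hc' x).aestronglyMeasurable ?_ intervalIntegrable_const ?_).2
  · exact .of_forall fun t ht y hy => hC (y, t) ⟨hy, uIoc_subset_uIcc ht⟩
  · exact .of_forall fun t _ y _ => h y t

lemma lap_eq_of_orthonormal {w : ℂ → ℝ} (hw : ContDiff ℝ 2 w) (z : ℂ) (θ : ℝ) :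
    lap w z = fderiv ℝ (fderiv ℝ w) z (circleMap 0 1 θ) (circleMap 0 1 θ)
      + fderiv ℝ (fderiv ℝ w) z (circleMap 0 1 θ * I) (circleMap 0 1 θ * I) := by
  have hd : DifferentiableAt ℝ (fderiv ℝ w) z :=
    ((hw.fderiv_right (m := 1) (by norm_num)).differentiable (by norm_num)) z
  have key : ∀ v : ℂ, fderiv ℝ (fun y => fderiv ℝ w y v) z v = fderiv ℝ (fderiv ℝ w) z v v := by
    intro v
    rw [fderiv_clm_apply hd (differentiableAt_const v)]
    simp
  have h1 : circleMap 0 1 θ = Real.cos θ • (1 : ℂ) + Real.sin θ • I := by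
    simp [circleMap, Complex.exp_mul_I]
  have h2 : circleMap 0 1 θ * I = -Real.sin θ • (1 : ℂ) + Real.cos θ • I := by
    rw [h1]
    simp only [Complex.real_smul]
    push_cast
    linear_combination (Complex.sin θ) * I_mul_I
  simp only [lap, pds, pdt]
  rw [key, key, h2, h1]
  simp only [map_add, map_smul, add_apply, smul_apply,
    smul_eq_mul]
  linear_combination -(fderiv ℝ (fderiv ℝ w) z 1 1 + fderiv ℝ (fderiv ℝ w) z I I) *
    (Real.cos_sq_add_sin_sq θ)

/-- Mean value inequality on circles for functions whose Laplacian is at least `-c`. -/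
lemma circle_mean_value {w : ℂ → ℝ} (hw : ContDiff ℝ 2 w) {z₀ : ℂ} {ρ c : ℝ}
    (hlap : ∀ z ∈ ball z₀ ρ, -c ≤ lap w z) {s : ℝ} (hs : s ∈ Ico 0 ρ) :
    2 * π * w z₀ - π * c * s ^ 2 / 2 ≤ ∫ θ in (-π)..π, w (circleMap z₀ s θ) := by
  have hw1 : ContDiff ℝ 1 (fderiv ℝ w) := hw.fderiv_right (by norm_num)
  have hD : ∀ z, HasFDerivAt w (fderiv ℝ w z) z := fun z =>
    (hw.differentiable (by norm_num) z).hasFDerivAt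
  have hD2 : ∀ z, HasFDerivAt (fderiv ℝ w) (fderiv ℝ (fderiv ℝ w) z) z := fun z =>
    (hw1.differentiable (by norm_num) z).hasFDerivAt
  have hc0 : Continuous w := hw.continuous
  have hc1 : Continuous (fderiv ℝ w) := hw1.continuous
  have hc2 : Continuous (fderiv ℝ (fderiv ℝ w)) := hw1.continuous_fderiv (by norm_num)
  have hm : Continuous fun p : ℝ × ℝ => circleMap z₀ p.1 p.2 := by
    fun_prop [circleMap]
  have he : Continuous fun θ : ℝ => circleMap 0 1 θ := continuous_circleMap 0 1
  have hrad : ∀ (x θ : ℝ), HasDerivAt (fun y => circleMap z₀ y θ) (circleMap 0 1 θ) x := by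
    intro x θ
    have := ((hasDerivAt_id x).ofReal_comp.mul_const (Complex.exp (θ * I))).const_add z₀
    simpa [circleMap] using this
  have hang : ∀ (x θ : ℝ), HasDerivAt (circleMap z₀ x) (x • (circleMap 0 1 θ * I)) θ := by
    intro x θ
    convert hasDerivAt_circleMap z₀ x θ using 1
    simp [circleMap]; ring
  have hφ : ∀ x, HasDerivAt (fun y => ∫ θ in (-π)..π, w (circleMap z₀ y θ))
      (∫ θ in (-π)..π, fderiv ℝ w (circleMap z₀ x θ) (circleMap 0 1 θ)) x := by
    refine hasDerivAt_intervalIntegral_of_continuous (F := fun y θ => w (circleMap z₀ y θ))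
      (F' := fun x θ => fderiv ℝ w (circleMap z₀ x θ) (circleMap 0 1 θ)) (hc0.comp hm)
      ((hc1.comp hm).clm_apply (he.comp continuous_snd)) fun x θ => ?_
    exact (hD _).comp_hasDerivAt x (hrad x θ)
  have hφ' : ∀ x, HasDerivAt
      (fun y => ∫ θ in (-π)..π, fderiv ℝ w (circleMap z₀ y θ) (circleMap 0 1 θ))
      (∫ θ in (-π)..π, fderiv ℝ (fderiv ℝ w) (circleMap z₀ x θ) (circleMap 0 1 θ)
        (circleMap 0 1 θ)) x := by
    refine hasDerivAt_intervalIntegral_of_continuous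
      (F := fun x θ => fderiv ℝ w (circleMap z₀ x θ) (circleMap 0 1 θ))
      (F' := fun x θ => fderiv ℝ (fderiv ℝ w) (circleMap z₀ x θ) (circleMap 0 1 θ)
        (circleMap 0 1 θ))
      ((hc1.comp hm).clm_apply (he.comp continuous_snd))
      (((hc2.comp hm).clm_apply (he.comp continuous_snd)).clm_apply (he.comp continuous_snd))
      fun x θ => ?_
    have := ((hD2 _).comp_hasDerivAt x (hrad x θ)).clm_apply
      (hasDerivAt_const x (circleMap 0 1 θ))
    simpa using this
  have hi1 : ∀ x, Continuous fun θ => fderiv ℝ w (circleMap z₀ x θ) (circleMap 0 1 θ) := fun x =>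
    (hc1.comp (continuous_circleMap z₀ x)).clm_apply he
  have hi2 : ∀ x, Continuous fun θ => fderiv ℝ (fderiv ℝ w) (circleMap z₀ x θ) (circleMap 0 1 θ)
      (circleMap 0 1 θ) := fun x =>
    ((hc2.comp (continuous_circleMap z₀ x)).clm_apply he).clm_apply he
  have hi3 : ∀ x, Continuous fun θ => fderiv ℝ (fderiv ℝ w) (circleMap z₀ x θ)
      (circleMap 0 1 θ * I) (circleMap 0 1 θ * I) := fun x =>
    ((hc2.comp (continuous_circleMap z₀ x)).clm_apply (he.mul_const I)).clm_apply
      (he.mul_const I)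
  have hper : ∀ x, ∫ θ in (-π)..π, (x * fderiv ℝ (fderiv ℝ w) (circleMap z₀ x θ)
      (circleMap 0 1 θ * I) (circleMap 0 1 θ * I)
      - fderiv ℝ w (circleMap z₀ x θ) (circleMap 0 1 θ)) = 0 := by
    intro x
    have hd : ∀ θ : ℝ, HasDerivAt
        (fun θ => fderiv ℝ w (circleMap z₀ x θ) (circleMap 0 1 θ * I))
        (x * fderiv ℝ (fderiv ℝ w) (circleMap z₀ x θ)
          (circleMap 0 1 θ * I) (circleMap 0 1 θ * I)
          - fderiv ℝ w (circleMap z₀ x θ) (circleMap 0 1 θ)) θ := by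
      intro θ
      have := ((hD2 _).comp_hasDerivAt θ (hang x θ)).clm_apply
        ((hasDerivAt_circleMap 0 1 θ).mul_const I)
      refine this.congr_deriv ?_
      rw [map_smul]
      simp [mul_assoc, sub_eq_add_neg]
    rw [intervalIntegral.integral_eq_sub_of_hasDerivAt (fun θ _ => hd θ)
      ((((hi3 x).const_mul x).sub (hi1 x)).intervalIntegrable _ _)]
    have h1 : circleMap z₀ x π = circleMap z₀ x (-π) := by
      rw [← periodic_circleMap z₀ x (-π)]; congr 1; ring
    have h2 : circleMap 0 1 π = circleMap 0 1 (-π) := by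
      rw [← periodic_circleMap 0 1 (-π)]; congr 1; ring
    rw [h1, h2, sub_self]
  -- the flux through the circle of radius `x`
  have hψ : ∀ x, HasDerivAt (fun y => y * (∫ θ in (-π)..π,
      fderiv ℝ w (circleMap z₀ y θ) (circleMap 0 1 θ)) + π * c * y ^ 2)
      (x * (∫ θ in (-π)..π, lap w (circleMap z₀ x θ)) + 2 * π * c * x) x := by
    intro x
    convert! ((hasDerivAt_id x).mul (hφ' x)).add ((hasDerivAt_pow 2 x).const_mul (π * c)) using 1
    have hp := hper x
    rw [intervalIntegral.integral_sub (((hi3 x).const_mul x).intervalIntegrable _ _)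
      ((hi1 x).intervalIntegrable _ _), intervalIntegral.integral_const_mul] at hp
    have hl : ∫ θ in (-π)..π, lap w (circleMap z₀ x θ)
        = (∫ θ in (-π)..π, fderiv ℝ (fderiv ℝ w) (circleMap z₀ x θ) (circleMap 0 1 θ)
            (circleMap 0 1 θ)) + ∫ θ in (-π)..π, fderiv ℝ (fderiv ℝ w) (circleMap z₀ x θ)
            (circleMap 0 1 θ * I) (circleMap 0 1 θ * I) := by
      rw [← intervalIntegral.integral_add ((hi2 x).intervalIntegrable _ _)
        ((hi3 x).intervalIntegrable _ _)]
      exact intervalIntegral.integral_congr fun θ _ => lap_eq_of_orthonormal hw _ θ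
    rw [hl]
    rw [id]
    linear_combination hp
  have hlapint : ∀ x ∈ Ico 0 ρ, -(2 * π * c) ≤ ∫ θ in (-π)..π, lap w (circleMap z₀ x θ) := by
    intro x hx
    have : ∫ θ in (-π)..π, -c ≤ ∫ θ in (-π)..π, lap w (circleMap z₀ x θ) := by
      refine intervalIntegral.integral_mono_on (by linarith [Real.pi_pos]) intervalIntegrable_const ?_
        fun θ _ => hlap _ ?_
      · have : (fun θ => lap w (circleMap z₀ x θ)) = _ :=
          funext fun θ => lap_eq_of_orthonormal hw (circleMap z₀ x θ) θ
        rw [this]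
        exact ((hi2 x).add (hi3 x)).intervalIntegrable _ _
      · simp [circleMap, abs_of_nonneg hx.1, hx.2]
    rw [intervalIntegral.integral_const, smul_eq_mul] at this
    linarith
  have hflux : ∀ x ∈ Ico 0 ρ, 0 ≤ x * (∫ θ in (-π)..π,
      fderiv ℝ w (circleMap z₀ x θ) (circleMap 0 1 θ)) + π * c * x ^ 2 := by
    intro x hx
    have hmono := monotoneOn_of_deriv_nonneg (convex_Icc 0 x)
      (fun y _ => (hψ y).continuousAt.continuousWithinAt)
      (fun y _ => (hψ y).differentiableAt.differentiableWithinAt) (fun y hy => by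
        rw [interior_Icc] at hy
        rw [(hψ y).deriv]
        nlinarith [mul_nonneg hy.1.le
          (sub_nonneg.2 (hlapint y ⟨hy.1.le, hy.2.trans hx.2⟩))])
    simpa using hmono (left_mem_Icc.2 hx.1) (right_mem_Icc.2 hx.1) hx.1
  have hφ2 : ∀ x, HasDerivAt (fun y => (∫ θ in (-π)..π, w (circleMap z₀ y θ))
      + π * c / 2 * y ^ 2) _ x := fun x =>
    (hφ x).add ((hasDerivAt_pow 2 x).const_mul (π * c / 2))
  have hmono := monotoneOn_of_deriv_nonneg (convex_Icc 0 s)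
    (fun y _ => (hφ2 y).continuousAt.continuousWithinAt)
    (fun y _ => (hφ2 y).differentiableAt.differentiableWithinAt) (fun y hy => by
      rw [interior_Icc] at hy
      rw [(hφ2 y).deriv]
      have := hflux y ⟨hy.1.le, hy.2.trans hs.2⟩
      refine nonneg_of_mul_nonneg_right (a := y) ?_ hy.1
      simp only [Nat.cast_ofNat, Nat.add_one_sub_one, pow_one]
      linarith)
  have := hmono (left_mem_Icc.2 hs.1) (right_mem_Icc.2 hs.1) hs.1
  simp at this
  linarith

/-- The integral over a disc in polar coordinates around its centre. -/
lemma integral_ball_eq_polar {w : ℂ → ℝ} (hw : Continuous w) (z₀ : ℂ) (ρ : ℝ) :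
    ∫ z in ball z₀ ρ, w z
      = ∫ s in Ioo 0 ρ, s * ∫ θ in (-π)..π, w (circleMap z₀ s θ) := by
  have hc : Continuous fun p : ℝ × ℝ => p.1 * w (circleMap z₀ p.1 p.2) := by
    fun_prop [circleMap]
  have hint : IntegrableOn (fun p : ℝ × ℝ => p.1 * w (circleMap z₀ p.1 p.2))
      (Ioo 0 ρ ×ˢ Ioo (-π) π) :=
    (hc.continuousOn.integrableOn_compact (isCompact_Icc.prod isCompact_Icc)).mono_set
      (prod_mono Ioo_subset_Icc_self Ioo_subset_Icc_self)
  have htrans : ∫ z in ball z₀ ρ, w z = ∫ z, (ball 0 ρ).indicator (fun z => w (z₀ + z)) z := by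
    rw [← integral_indicator measurableSet_ball,
      ← integral_add_left_eq_self ((ball z₀ ρ).indicator w) z₀]
    congr 1 with z
    simp [indicator]
  have hpol : ∀ p ∈ polarCoord.target,
      p.1 • (ball 0 ρ).indicator (fun z => w (z₀ + z)) (Complex.polarCoord.symm p)
      = (Ioo 0 ρ ×ˢ Ioo (-π) π).indicator (fun p => p.1 * w (circleMap z₀ p.1 p.2)) p := by
    rintro ⟨s, θ⟩ hp
    simp only [polarCoord_target, mem_prod, mem_Ioi] at hp
    have he : Complex.polarCoord.symm (s, θ) = s * Complex.exp (θ * I) := by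
      rw [Complex.polarCoord_symm_apply, Complex.exp_mul_I]
      simp
    simp [indicator, he, circleMap, abs_of_pos hp.1, hp.1, hp.2.1, hp.2.2]
  have hsub : Ioo 0 ρ ×ˢ Ioo (-π) π ⊆ polarCoord.target := by
    rw [polarCoord_target]
    exact prod_mono Ioo_subset_Ioi_self subset_rfl
  rw [htrans, ← Complex.integral_comp_polarCoord_symm,
    setIntegral_congr_fun polarCoord.open_target.measurableSet hpol,
    setIntegral_indicator (measurableSet_Ioo.prod measurableSet_Ioo),
    inter_eq_right.2 hsub, Measure.volume_eq_prod, setIntegral_prod _ hint]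
  refine setIntegral_congr_fun measurableSet_Ioo fun s _ => ?_
  simp only
  rw [integral_const_mul, intervalIntegral.integral_of_le (by linarith [Real.pi_pos]),
    integral_Ioc_eq_integral_Ioo]

lemma disc_mean_value_of_contDiff {w : ℂ → ℝ} (hw : ContDiff ℝ 2 w) {z₀ : ℂ} {ρ c : ℝ}
    (hρ : 0 ≤ ρ) (hlap : ∀ z ∈ ball z₀ ρ, -c ≤ lap w z) :
    π * ρ ^ 2 * w z₀ - π * c * ρ ^ 4 / 8 ≤ ∫ z in ball z₀ ρ, w z := by
  have hw0 := hw.continuous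
  rw [integral_ball_eq_polar hw0, ← integral_Ioc_eq_integral_Ioo,
    ← intervalIntegral.integral_of_le hρ]
  have hcont : Continuous fun s => ∫ θ in (-π)..π, w (circleMap z₀ s θ) :=
    intervalIntegral.continuous_parametric_intervalIntegral_of_continuous' (by
      fun_prop [circleMap, Function.uncurry]) _ _
  have hle : ∫ s in (0 : ℝ)..ρ, (2 * π * w z₀ * s - π * c / 2 * s ^ 3) ≤
      ∫ s in (0 : ℝ)..ρ, s * ∫ θ in (-π)..π, w (circleMap z₀ s θ) := by
    refine intervalIntegral.integral_mono_on_of_le_Ioo hρ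
      (Continuous.intervalIntegrable (by fun_prop) _ _)
      ((continuous_id.mul hcont).intervalIntegrable _ _) fun s hs => ?_
    nlinarith [mul_le_mul_of_nonneg_left
      (circle_mean_value hw hlap ⟨hs.1.le, hs.2⟩) hs.1.le]
  rw [intervalIntegral.integral_sub (Continuous.intervalIntegrable (by fun_prop) _ _)
    (Continuous.intervalIntegrable (by fun_prop) _ _), intervalIntegral.integral_const_mul,
    intervalIntegral.integral_const_mul, integral_id, integral_pow] at hle
  norm_num at hle
  linarith

lemma Filter.EventuallyEq.lap_eq {F : Type*} [NormedAddCommGroup F] [NormedSpace ℝ F]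
    {f g : ℂ → F} {z : ℂ} (h : f =ᶠ[𝓝 z] g) : lap f z = lap g z := by
  have h1 : pds f =ᶠ[𝓝 z] pds g := (h.fderiv (𝕜 := ℝ)).mono fun y hy => by simp [pds, hy]
  have h2 : pdt f =ᶠ[𝓝 z] pdt g := (h.fderiv (𝕜 := ℝ)).mono fun y hy => by simp [pdt, hy]
  change fderiv ℝ (pds f) z 1 + fderiv ℝ (pdt f) z I
    = fderiv ℝ (pds g) z 1 + fderiv ℝ (pdt g) z I
  rw [h1.fderiv_eq, h2.fderiv_eq]

/-- Mean value inequality on discs for functions whose Laplacian is at least `-c`. -/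
lemma disc_mean_value {w : ℂ → ℝ} {z₁ z₀ : ℂ} {r ρ c : ℝ} (hw : ContDiffOn ℝ 2 w (ball z₁ r))
    (hρ : 0 < ρ) (hr : dist z₀ z₁ + ρ < r) (hlap : ∀ z ∈ ball z₀ ρ, -c ≤ lap w z) :
    π * ρ ^ 2 * w z₀ - π * c * ρ ^ 4 / 8 ≤ ∫ z in ball z₀ ρ, w z := by
  obtain ⟨R, hρR, hR⟩ := exists_between (lt_sub_iff_add_lt'.2 hr)
  let χ : ContDiffBump z₀ := ⟨ρ, R, hρ, hρR⟩
  have hsub : closedBall z₀ R ⊆ ball z₁ r := closedBall_subset_ball' (by linarith)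
  have hW : ContDiff ℝ 2 fun z => χ z * w z := by
    rw [contDiff_iff_contDiffAt]
    intro z
    by_cases hz : z ∈ ball z₁ r
    · exact χ.contDiff.contDiffAt.mul (hw.contDiffAt (isOpen_ball.mem_nhds hz))
    · have : z ∉ tsupport χ := fun h => hz (hsub (χ.tsupport_eq ▸ h))
      refine (contDiffAt_const (c := (0 : ℝ))).congr_of_eventuallyEq ?_
      filter_upwards [notMem_tsupport_iff_eventuallyEq.1 this] with y hy
      simp [hy]
  have heq : ∀ z ∈ ball z₀ ρ, χ z * w z = w z := fun z hz => by
    rw [χ.one_of_mem_closedBall (ball_subset_closedBall hz), one_mul]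
  have := disc_mean_value_of_contDiff hW hρ.le fun z hz => by
    rw [Filter.EventuallyEq.lap_eq (g := w)]
    · exact hlap z hz
    · filter_upwards [isOpen_ball.mem_nhds hz] with y hy using heq y hy
  rwa [setIntegral_congr_fun measurableSet_ball heq, heq z₀ (mem_ball_self hρ)] at this

/-- The Heinz trick on a slightly smaller disc: apply the mean value inequality at a maximum point
of `(R - ‖z‖)² w z`. -/
lemma heinz_trick_of_lt {r R a b : ℝ} (hR : 0 < R) (hRr : R < r) (ha : 0 ≤ a) (hb : 0 ≤ b)
    {w : ℂ → ℝ} (hw : ContDiffOn ℝ 2 w (ball 0 r))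
    (hineq : ∀ z ∈ ball (0 : ℂ) r, -a - b * (w z) ^ 2 ≤ lap w z)
    (hpos : ∀ z ∈ ball (0 : ℂ) r, 0 ≤ w z) (hint : IntegrableOn w (ball 0 r))
    (hsmall : b * (∫ z in ball (0 : ℂ) r, w z) ≤ π / 16) :
    w 0 ≤ a * R ^ 2 / 8 + 8 / (π * R ^ 2) * ∫ z in ball (0 : ℂ) r, w z := by
  set S := ∫ z in ball (0 : ℂ) r, w z
  have hS0 : 0 ≤ S := setIntegral_nonneg measurableSet_ball hpos
  have hπ := Real.pi_pos
  have hcont : ContinuousOn (fun z => (R - ‖z‖) ^ 2 * w z) (closedBall 0 R) :=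
    ContinuousOn.mul (by fun_prop)
      (hw.continuousOn.mono (closedBall_subset_ball hRr))
  obtain ⟨z₀, hz₀, hmax⟩ := (isCompact_closedBall (0 : ℂ) R).exists_isMaxOn
    ⟨0, mem_closedBall_self hR.le⟩ hcont
  have hz₀' : ‖z₀‖ ≤ R := by simpa using hz₀
  have h0 : R ^ 2 * w 0 ≤ (R - ‖z₀‖) ^ 2 * w z₀ := by
    simpa using hmax (mem_closedBall_self hR.le)
  have hc0 : 0 ≤ w z₀ := hpos z₀ (closedBall_subset_ball hRr hz₀)
  obtain ⟨δ, hδ⟩ : ∃ δ, δ = (R - ‖z₀‖) / 2 := ⟨_, rfl⟩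
  have hδR : R - ‖z₀‖ = 2 * δ := by linarith
  have hδle : δ ≤ R / 2 := by linarith [norm_nonneg z₀]
  rw [hδR] at h0
  suffices h : δ ^ 2 * w z₀ ≤ a * δ ^ 4 / 2 ∨
      δ ^ 2 * w z₀ ≤ a * δ ^ 4 / 4 + 2 * S / π by
    have hδ0 : 0 ≤ δ := by linarith
    have hδ4 : δ ^ 4 ≤ R ^ 4 / 16 := by
      calc δ ^ 4 ≤ (R / 2) ^ 4 := by gcongr
        _ = R ^ 4 / 16 := by ring
    have hδ4' := mul_le_mul_of_nonneg_left hδ4 ha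
    have hSπ : 0 ≤ S / π := by positivity
    have haR : 0 ≤ a * R ^ 4 := by positivity
    have key : R ^ 2 * w 0 ≤ R ^ 2 * (a * R ^ 2 / 8 + 8 / (π * R ^ 2) * S) := by
      have : R ^ 2 * (a * R ^ 2 / 8 + 8 / (π * R ^ 2) * S) = a * R ^ 4 / 8 + 8 * (S / π) := by
        field_simp
      rw [this]
      rcases h with h | h
      · linarith
      · rw [mul_div_assoc 2 S] at h
        linarith
    exact le_of_mul_le_mul_left key (by positivity)
  rcases (show 0 ≤ δ by linarith).eq_or_lt with h | hδpos
  · left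
    simp [← h]
  -- the mean value inequality on discs of radius at most `δ`
  have hmv : ∀ ρ, 0 < ρ → ρ ≤ δ →
      π * ρ ^ 2 * w z₀ - π * (a + 16 * b * w z₀ ^ 2) * ρ ^ 4 / 8 ≤ S := by
    intro ρ hρ hρδ
    have hball : ∀ z ∈ ball z₀ ρ, ‖z‖ ≤ R - δ := fun z hz => by
      have : ‖z‖ ≤ ‖z - z₀‖ + ‖z₀‖ := by simpa using norm_add_le (z - z₀) z₀
      have := mem_ball_iff_norm.1 hz
      linarith
    have hsub : ball z₀ ρ ⊆ ball 0 r := fun z hz => by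
      simpa using (hball z hz).trans_lt (by linarith)
    refine (disc_mean_value hw hρ (by rw [dist_zero_right]; linarith) fun z hz => ?_).trans
      (setIntegral_mono_set hint ((ae_restrict_mem measurableSet_ball).mono hpos)
        hsub.eventuallyLE)
    have hz := hball z ‹_›
    have hwz := hpos z (hsub ‹_›)
    have hm : (R - ‖z‖) ^ 2 * w z ≤ (R - ‖z₀‖) ^ 2 * w z₀ :=
      hmax (by simpa using hz.trans (by linarith))
    rw [hδR] at hm
    have h4 : w z ≤ 4 * w z₀ := by
      have : δ ^ 2 * w z ≤ (R - ‖z‖) ^ 2 * w z := by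
        gcongr
        linarith
      refine le_of_mul_le_mul_left (a := δ ^ 2) ?_ (by positivity)
      linarith
    have hsq : w z ^ 2 ≤ (4 * w z₀) ^ 2 := by gcongr
    have := hineq z (hsub ‹_›)
    linarith [mul_le_mul_of_nonneg_left hsq hb]
  by_cases hcase : 4 * b * w z₀ * δ ^ 2 ≤ 1
  · right
    have h1 := hmv δ hδpos le_rfl
    have h2 : 4 * b * w z₀ * δ ^ 2 * (δ ^ 2 * w z₀) ≤ 1 * (δ ^ 2 * w z₀) := by gcongr
    have h3 : π * (δ ^ 2 * w z₀) ≤ π * (a * δ ^ 4 / 4) + 2 * S := by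
      linarith [mul_le_mul_of_nonneg_left h2 hπ.le]
    refine le_of_mul_le_mul_left (a := π) (h3.trans_eq ?_) hπ
    field_simp
  · left
    push Not at hcase
    have hbc : 0 < 4 * b * w z₀ := by
      by_contra! h
      linarith [mul_nonpos_of_nonpos_of_nonneg h (sq_nonneg δ)]
    obtain ⟨ρ, hρ, hρ2⟩ : ∃ ρ, 0 < ρ ∧ 4 * b * w z₀ * ρ ^ 2 = 1 := by
      refine ⟨√(1 / (4 * b * w z₀)), by positivity, ?_⟩
      rw [Real.sq_sqrt (by positivity), mul_one_div_cancel hbc.ne']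
    have hρδ2 : ρ ^ 2 ≤ δ ^ 2 := by
      refine le_of_mul_le_mul_left (a := 4 * b * w z₀) ?_ hbc
      linarith
    have h1 := hmv ρ hρ (abs_le_of_sq_le_sq' hρδ2 hδpos.le).2
    have h2 : w z₀ ≤ a * ρ ^ 2 / 2 := by
      have e1 : π * (a + 16 * b * w z₀ ^ 2) * ρ ^ 4 / 8
          = π * ρ ^ 2 * (a * ρ ^ 2 / 8 + w z₀ / 2) := by
        linear_combination π * ρ ^ 2 * w z₀ / 2 * hρ2
      have e2 : S = π * ρ ^ 2 * (4 * w z₀ * (b * S) / π) := by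
        field_simp
        linear_combination -S * hρ2
      have e3 : 4 * w z₀ * (b * S) / π ≤ w z₀ / 4 := by
        rw [div_le_iff₀ hπ]
        linarith [mul_le_mul_of_nonneg_left hsmall hc0]
      rw [e1, e2, ← mul_sub] at h1
      have := le_of_mul_le_mul_left h1 (by positivity)
      linarith
    calc δ ^ 2 * w z₀ ≤ δ ^ 2 * (a * δ ^ 2 / 2) := by gcongr; exact h2.trans (by gcongr)
      _ = a * δ ^ 4 / 2 := by ring

/-- **The Heinz Trick** (Lemma on mean value inequalities):
if `w : B_r → ℝ` is `C²`, `Δw ≥ -a - b w²`, `w ≥ 0` on `B_r`, and `b ∫_{B_r} w < π/16`,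
then `w(0) ≤ a r²/8 + (8/(π r²)) ∫_{B_r} w`. -/
theorem heinz_trick (r a b : ℝ) (hr : 0 < r) (ha : 0 ≤ a) (hb : 0 ≤ b)
    (w : ℂ → ℝ) (hw : ContDiffOn ℝ 2 w (ball (0 : ℂ) r))
    (hineq : ∀ z ∈ ball (0 : ℂ) r, -a - b * (w z) ^ 2 ≤ lap w z)
    (hpos : ∀ z ∈ ball (0 : ℂ) r, 0 ≤ w z)
    (hsmall : ENNReal.ofReal b * (∫⁻ z in ball (0 : ℂ) r, ENNReal.ofReal (w z))
      < ENNReal.ofReal (Real.pi / 16)) :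
    ENNReal.ofReal (w 0) ≤ ENNReal.ofReal (a * r ^ 2 / 8)
      + ENNReal.ofReal (8 / (Real.pi * r ^ 2)) * ∫⁻ z in ball (0 : ℂ) r, ENNReal.ofReal (w z) := by

  by_cases htop : ∫⁻ z in ball (0 : ℂ) r, ENNReal.ofReal (w z) = ∞
  · have : ENNReal.ofReal (8 / (π * r ^ 2)) ≠ 0 := by
      rw [ne_eq, ENNReal.ofReal_eq_zero, not_le]
      positivity
    simp [htop, ENNReal.mul_top this]
  have hae : 0 ≤ᵐ[volume.restrict (ball (0 : ℂ) r)] w :=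
    (ae_restrict_mem measurableSet_ball).mono hpos
  have hmeas : AEStronglyMeasurable w (volume.restrict (ball (0 : ℂ) r)) :=
    hw.continuousOn.aestronglyMeasurable measurableSet_ball
  have hint : IntegrableOn w (ball 0 r) :=
    (lintegral_ofReal_ne_top_iff_integrable hmeas hae).1 htop
  have hS0 : 0 ≤ ∫ z in ball (0 : ℂ) r, w z := setIntegral_nonneg measurableSet_ball hpos
  rw [← ofReal_integral_eq_lintegral_ofReal hint hae] at hsmall ⊢
  rw [← ENNReal.ofReal_mul hb] at hsmall
  have hsmall' := (ENNReal.ofReal_lt_ofReal_iff (by positivity)).1 hsmall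
  rw [← ENNReal.ofReal_mul (by positivity), ← ENNReal.ofReal_add (by positivity) (by positivity)]
  refine ENNReal.ofReal_le_ofReal ?_
  have hlim : ContinuousAt
      (fun R => a * R ^ 2 / 8 + 8 / (π * R ^ 2) * ∫ z in ball (0 : ℂ) r, w z) r := by
    have : π * r ^ 2 ≠ 0 := by positivity
    fun_prop (disch := assumption)
  refine ge_of_tendsto (hlim.mono_left (nhdsWithin_le_nhds (s := Iio r))) ?_
  filter_upwards [Ioo_mem_nhdsLT hr] with R hR
  exact heinz_trick_of_lt hR.1 hR.2 ha hb hw hineq hpos hint hsmall'.le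
end
end

section
/- Let U' ⊆ U ⊆ ℂ be bounded open sets with closure(U') ⊆ U and let 1 < p < ∞. For every constant c₀ > 0 there exists a constant c > 0 such that the following holds: for every Lipschitz map J : U → ℝ^{2n×2n} with J(z)² = −Id for all z ∈ U and ‖J‖_{W^{1,∞}(U)} ≤ c₀, and every C¹ map u : U → ℝ^{2n}, one has (∫_{U'} (|u|^p + |du|^p))^{1/p} ≤ c·[ (∫_U |∂_s u + J·∂_t u|^p)^{1/p} + (∫_U |u|^p)^{1/p} ], where both sides are interpreted in [0,∞]. -/
open MeasureTheory Metric Complex Set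
open scoped ENNReal Real Topology

noncomputable section

abbrev EV (n : ℕ) := EuclideanSpace ℝ (Fin (2 * n))

/-- The total mass of the unnormalised Gaussian on `ℂ`. -/
def gaussMass : ℝ := ∫ y : ℂ, Real.exp (-‖y‖ ^ 2 / 2)

/-- The standard Gaussian density on `ℂ`. -/
def gaussKer (y : ℂ) : ℝ := gaussMass⁻¹ * Real.exp (-‖y‖ ^ 2 / 2)

/-- A smooth compactly supported function on `ℂ`. -/
structure IsTest {E : Type*} [NormedAddCommGroup E] [NormedSpace ℝ E] (f : ℂ → E) : Prop where
  smooth : ContDiff ℝ (⊤ : ℕ∞) f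
  cpt : HasCompactSupport f

/-- The derivative of `f` in the direction `v`. -/
def dirDeriv {E : Type*} [NormedAddCommGroup E] [NormedSpace ℝ E] (v : ℂ) (f : ℂ → E) (z : ℂ) : E :=
  fderiv ℝ f z v

/-- The Laplacian of `f`. -/
def lapl {E : Type*} [NormedAddCommGroup E] [NormedSpace ℝ E] (f : ℂ → E) (z : ℂ) : E :=
  dirDeriv 1 (dirDeriv 1 f) z + dirDeriv I (dirDeriv I f) z

/-- The heat flow of `f` at time `r ^ 2 / 2`. -/
def heatFlow {E : Type*} [NormedAddCommGroup E] [NormedSpace ℝ E] (f : ℂ → E) (r : ℝ) (x : ℂ) : E :=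
  ∫ y : ℂ, gaussKer y • f (x + r • y)

lemma integrable_exp_neg_mul_norm_sq {b : ℝ} (hb : 0 < b) :
    Integrable (fun y : ℂ => Real.exp (-b * ‖y‖ ^ 2)) := by
  have h := (GaussianFourier.integrable_cexp_neg_mul_sq_norm_add (V := ℂ) (b := (b : ℂ))
    (by simpa using hb) 0 0).norm
  refine h.congr (Filter.Eventually.of_forall fun y => ?_)
  simp only [Complex.norm_exp]
  congr 1
  simp [← Complex.ofReal_pow]

lemma integrable_exp_neg_norm_sq_div_two :
    Integrable (fun y : ℂ => Real.exp (-‖y‖ ^ 2 / 2)) := by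
  refine (integrable_exp_neg_mul_norm_sq (b := 1 / 2) (by norm_num)).congr
    (Filter.Eventually.of_forall fun y => ?_)
  simp only
  congr 1
  ring

lemma gaussMass_pos : 0 < gaussMass := by
  unfold gaussMass
  rw [integral_pos_iff_support_of_nonneg (fun y => (Real.exp_pos _).le)
    integrable_exp_neg_norm_sq_div_two]
  have : Function.support (fun y : ℂ => Real.exp (-‖y‖ ^ 2 / 2)) = univ := by
    ext y; simp [(Real.exp_pos _).ne']
  rw [this]
  simp

lemma gaussKer_nonneg (y : ℂ) : 0 ≤ gaussKer y :=
  mul_nonneg (inv_nonneg.2 gaussMass_pos.le) (Real.exp_pos _).le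

lemma gaussKer_le (y : ℂ) : gaussKer y ≤ gaussMass⁻¹ := by
  unfold gaussKer
  have : Real.exp (-‖y‖ ^ 2 / 2) ≤ 1 := Real.exp_le_one_iff.2 (by nlinarith [sq_nonneg ‖y‖])
  exact mul_le_of_le_one_right (inv_nonneg.2 gaussMass_pos.le) this

lemma continuous_gaussKer : Continuous gaussKer := by unfold gaussKer; fun_prop

lemma integral_gaussKer : ∫ y, gaussKer y = 1 := by
  unfold gaussKer
  rw [integral_const_mul]
  exact inv_mul_cancel₀ gaussMass_pos.ne'

lemma integrable_gaussKer_mul_pow {R : ℝ} (hR : 0 ≤ R) (k : ℕ) :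
    Integrable (fun y : ℂ => gaussKer y * (1 + R * ‖y‖) ^ k) := by
  have h := (integrable_exp_neg_mul_norm_sq (b := 1 / 4) (by norm_num)).const_mul
    (gaussMass⁻¹ * Real.exp ((k * R) ^ 2))
  refine h.mono' (continuous_gaussKer.mul (by fun_prop)).aestronglyMeasurable
    (Filter.Eventually.of_forall fun y => ?_)
  have hy : 0 ≤ 1 + R * ‖y‖ := by positivity
  rw [Real.norm_of_nonneg (mul_nonneg (gaussKer_nonneg y) (pow_nonneg hy k))]
  have h1 : (1 + R * ‖y‖) ^ k ≤ Real.exp (k * (R * ‖y‖)) := by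
    rw [Real.exp_nat_mul]
    gcongr
    linarith [Real.add_one_le_exp (R * ‖y‖)]
  have h2 : Real.exp (-‖y‖ ^ 2 / 2) * Real.exp (k * (R * ‖y‖)) ≤
      Real.exp ((k * R) ^ 2) * Real.exp (-(1 / 4) * ‖y‖ ^ 2) := by
    rw [← Real.exp_add, ← Real.exp_add]
    refine Real.exp_le_exp.2 ?_
    nlinarith [sq_nonneg (k * R - ‖y‖ / 2)]
  calc gaussKer y * (1 + R * ‖y‖) ^ k
      ≤ gaussKer y * Real.exp (k * (R * ‖y‖)) := by gcongr; exact gaussKer_nonneg y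
    _ = gaussMass⁻¹ * (Real.exp (-‖y‖ ^ 2 / 2) * Real.exp (k * (R * ‖y‖))) := by
        unfold gaussKer; ring
    _ ≤ gaussMass⁻¹ * (Real.exp ((k * R) ^ 2) * Real.exp (-(1 / 4) * ‖y‖ ^ 2)) := by
        gcongr; exact (inv_pos.2 gaussMass_pos).le
    _ = _ := by ring

lemma integrable_gaussKer : Integrable gaussKer := by
  simpa using integrable_gaussKer_mul_pow le_rfl 0

lemma integrable_gaussKer_mul_norm : Integrable (fun y : ℂ => gaussKer y * ‖y‖) := by
  refine (integrable_gaussKer_mul_pow zero_le_one 1).mono'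
    (continuous_gaussKer.mul continuous_norm).aestronglyMeasurable
    (Filter.Eventually.of_forall fun y => ?_)
  rw [Real.norm_of_nonneg (mul_nonneg (gaussKer_nonneg y) (norm_nonneg y))]
  gcongr
  · exact gaussKer_nonneg y
  · simp

lemma hasFDerivAt_gaussKer (y : ℂ) :
    HasFDerivAt gaussKer (-(gaussKer y • innerSL ℝ y)) y := by
  have h := ((((hasStrictFDerivAt_norm_sq y).hasFDerivAt.neg).mul_const (1 / 2 : ℝ)).exp).const_mul
    gaussMass⁻¹
  have h1 : gaussKer = fun z => gaussMass⁻¹ * Real.exp ((-fun x : ℂ => ‖x‖ ^ 2) z * (1 / 2)) := by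
    ext z; simp [gaussKer, div_eq_mul_inv]
  rw [← h1] at h
  refine h.congr_fderiv ?_
  ext v
  simp [gaussKer]
  ring_nf

section IsTest

variable {E F : Type*} [NormedAddCommGroup E] [NormedSpace ℝ E] [NormedAddCommGroup F]
  [NormedSpace ℝ F]

lemma IsTest.fderiv {f : ℂ → E} (hf : IsTest f) : IsTest (fderiv ℝ f) :=
  ⟨hf.smooth.fderiv_right (by simp), hf.cpt.fderiv ℝ⟩

lemma IsTest.clm_comp {f : ℂ → E} (hf : IsTest f) (L : E →L[ℝ] F) : IsTest (fun z => L (f z)) :=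
  ⟨L.contDiff.comp hf.smooth, hf.cpt.comp_left (map_zero L)⟩

lemma IsTest.dirDeriv {f : ℂ → E} (hf : IsTest f) (v : ℂ) : IsTest (dirDeriv v f) :=
  hf.fderiv.clm_comp (ContinuousLinearMap.apply ℝ E v)

lemma IsTest.add {f g : ℂ → E} (hf : IsTest f) (hg : IsTest g) : IsTest (fun z => f z + g z) :=
  ⟨hf.smooth.add hg.smooth, hf.cpt.add hg.cpt⟩

lemma IsTest.lapl {f : ℂ → E} (hf : IsTest f) : IsTest (lapl f) :=
  ((hf.dirDeriv 1).dirDeriv 1).add ((hf.dirDeriv I).dirDeriv I)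

lemma IsTest.prodMk {f : ℂ → E} {g : ℂ → F} (hf : IsTest f) (hg : IsTest g) :
    IsTest (fun z => (f z, g z)) := by
  refine ⟨hf.smooth.prodMk hg.smooth, ?_⟩
  refine HasCompactSupport.intro (hf.cpt.isCompact.union hg.cpt.isCompact) fun x hx => ?_
  rw [mem_union, not_or] at hx
  rw [image_eq_zero_of_notMem_tsupport hx.1, image_eq_zero_of_notMem_tsupport hx.2]
  rfl

lemma IsTest.continuous {f : ℂ → E} (hf : IsTest f) : Continuous f := hf.smooth.continuous

lemma IsTest.differentiable {f : ℂ → E} (hf : IsTest f) : Differentiable ℝ f :=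
  hf.smooth.differentiable (by simp)

lemma IsTest.hasFDerivAt {f : ℂ → E} (hf : IsTest f) (x : ℂ) :
    HasFDerivAt f (_root_.fderiv ℝ f x) x :=
  (hf.differentiable x).hasFDerivAt

lemma IsTest.exists_bound {f : ℂ → E} (hf : IsTest f) : ∃ C, 0 ≤ C ∧ ∀ x, ‖f x‖ ≤ C := by
  obtain ⟨C, hC⟩ := hf.continuous.bounded_above_of_compact_support hf.cpt
  exact ⟨C, (norm_nonneg _).trans (hC 0), hC⟩

lemma IsTest.integrable {f : ℂ → E} (hf : IsTest f) : Integrable f :=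
  hf.continuous.integrable_of_hasCompactSupport hf.cpt

lemma IsTest.exists_decay {f : ℂ → E} (hf : IsTest f) :
    ∃ C, 0 ≤ C ∧ ∀ x, ‖f x‖ ≤ C * ((1 + ‖x‖) ^ 4)⁻¹ := by
  obtain ⟨C, hC⟩ := (hf.continuous.norm.mul (f := fun x => ‖f x‖)
    (g := fun x : ℂ => (1 + ‖x‖) ^ 4) (by fun_prop)).bounded_above_of_compact_support
      (hf.cpt.norm.mul_right)
  refine ⟨C, (norm_nonneg _).trans (hC 0), fun x => ?_⟩
  have h := hC x
  have hx : (0 : ℝ) < (1 + ‖x‖) ^ 4 := by positivity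
  rw [← div_eq_mul_inv, le_div_iff₀ hx]
  simpa [abs_of_nonneg (show (0:ℝ) ≤ 1 + ‖x‖ by positivity)] using h

lemma integrable_one_add_norm_pow_inv : Integrable (fun x : ℂ => ((1 + ‖x‖) ^ 4)⁻¹) := by
  have h := integrable_one_add_norm (E := ℂ) (μ := volume) (r := 4)
    (by rw [Complex.finrank_real_complex]; norm_num)
  refine h.congr (Filter.Eventually.of_forall fun x => ?_)
  simp only
  rw [Real.rpow_neg (by positivity)]
  norm_cast

end IsTest

section heat

variable {E F : Type*} [NormedAddCommGroup E] [NormedSpace ℝ E] [NormedAddCommGroup F]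
  [NormedSpace ℝ F]

lemma IsTest.integrable_gaussKer_smul {f : ℂ → E} (hf : IsTest f) (r : ℝ) (x : ℂ) :
    Integrable (fun y : ℂ => gaussKer y • f (x + r • y)) := by
  obtain ⟨C, -, hC⟩ := hf.exists_bound
  refine (integrable_gaussKer.mul_const C).mono'
    (continuous_gaussKer.smul (hf.continuous.comp (by fun_prop))).aestronglyMeasurable
    (Filter.Eventually.of_forall fun y => ?_)
  rw [norm_smul, Real.norm_of_nonneg (gaussKer_nonneg y)]
  exact mul_le_mul_of_nonneg_left (hC _) (gaussKer_nonneg y)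

lemma heatFlow_zero [CompleteSpace E] (f : ℂ → E) (x : ℂ) : heatFlow f 0 x = f x := by
  simp [heatFlow, integral_smul_const, integral_gaussKer]

lemma heatFlow_clm [CompleteSpace E] [CompleteSpace F] {f : ℂ → E} (hf : IsTest f)
    (L : E →L[ℝ] F) (r : ℝ) (x : ℂ) :
    heatFlow (fun z => L (f z)) r x = L (heatFlow f r x) := by
  unfold heatFlow
  rw [← L.integral_comp_comm (hf.integrable_gaussKer_smul r x)]
  simp

lemma heatFlow_add {f g : ℂ → E} (hf : IsTest f) (hg : IsTest g) (r : ℝ) (x : ℂ) :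
    heatFlow (fun z => f z + g z) r x = heatFlow f r x + heatFlow g r x := by
  unfold heatFlow
  rw [← integral_add (hf.integrable_gaussKer_smul r x) (hg.integrable_gaussKer_smul r x)]
  simp

lemma norm_heatFlow_le {f : ℂ → E} {C : ℝ} (hC : ∀ x, ‖f x‖ ≤ C) (r : ℝ) (x : ℂ) :
    ‖heatFlow f r x‖ ≤ C := by
  have := norm_integral_le_of_norm_le (f := fun y : ℂ => gaussKer y • f (x + r • y))
    (integrable_gaussKer.mul_const C)
    (Filter.Eventually.of_forall fun y => by
      rw [norm_smul, Real.norm_of_nonneg (gaussKer_nonneg y)]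
      exact mul_le_mul_of_nonneg_left (hC _) (gaussKer_nonneg y))
  rwa [integral_mul_const, integral_gaussKer, one_mul] at this

lemma hasFDerivAt_heatFlow {f : ℂ → E} (hf : IsTest f) (r : ℝ) (x : ℂ) :
    HasFDerivAt (heatFlow f r) (heatFlow (fderiv ℝ f) r x) x := by
  obtain ⟨C, -, hC⟩ := hf.fderiv.exists_bound
  refine hasFDerivAt_integral_of_dominated_of_fderiv_le (s := univ)
    (F := fun x y => gaussKer y • f (x + r • y))
    (F' := fun x y => gaussKer y • fderiv ℝ f (x + r • y)) (bound := fun y => gaussKer y * C)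
    Filter.univ_mem
    (Filter.Eventually.of_forall fun x => (hf.integrable_gaussKer_smul r x).aestronglyMeasurable)
    (hf.integrable_gaussKer_smul r x)
    (hf.fderiv.integrable_gaussKer_smul r x).aestronglyMeasurable
    (Filter.Eventually.of_forall fun y z _ => ?_) (integrable_gaussKer.mul_const C)
    (Filter.Eventually.of_forall fun y z _ => ?_)
  · rw [norm_smul, Real.norm_of_nonneg (gaussKer_nonneg y)]
    exact mul_le_mul_of_nonneg_left (hC _) (gaussKer_nonneg y)
  · have h := (hf.hasFDerivAt (z + r • y)).comp z ((hasFDerivAt_id z).add_const (r • y))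
    exact h.const_smul (gaussKer y)

lemma hasFDerivAt_heatFlow_dirDeriv [CompleteSpace E] {f : ℂ → E} (hf : IsTest f) (r : ℝ)
    (x v : ℂ) : fderiv ℝ (heatFlow f r) x v = heatFlow (dirDeriv v f) r x := by
  rw [(hasFDerivAt_heatFlow hf r x).fderiv]
  exact (heatFlow_clm hf.fderiv (ContinuousLinearMap.apply ℝ E v) r x).symm

lemma hasLineDerivAt_heatFlow [CompleteSpace E] {f : ℂ → E} (hf : IsTest f) (r : ℝ) (x v : ℂ) :
    HasLineDerivAt ℝ (heatFlow f r) (heatFlow (dirDeriv v f) r x) x v := by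
  rw [← hasFDerivAt_heatFlow_dirDeriv hf]
  exact (hasFDerivAt_heatFlow hf r x).differentiableAt.hasFDerivAt.hasLineDerivAt v

lemma continuous_heatFlow {f : ℂ → E} (hf : IsTest f) (r : ℝ) : Continuous (heatFlow f r) :=
  continuous_iff_continuousAt.2 fun x => (hasFDerivAt_heatFlow hf r x).continuousAt

lemma integral_inner_mul_gaussKer {f : ℂ → E} (hf : IsTest f) (r : ℝ) (x v : ℂ) :
    ∫ y, (inner ℝ y v * gaussKer y) • f (x + r • y) =
      r • ∫ y, gaussKer y • dirDeriv v f (x + r • y) := by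
  obtain ⟨C, -, hC⟩ := hf.exists_bound
  have key := integral_bilinear_hasLineDerivAt_right_eq_neg_left_of_integrable
    (μ := (volume : Measure ℂ))
    (f := gaussKer) (f' := fun y => -(inner ℝ y v * gaussKer y))
    (g := fun y => f (x + r • y)) (g' := fun y => r • dirDeriv v f (x + r • y)) (v := v)
    (B := ContinuousLinearMap.lsmul ℝ ℝ) ?_ ?_ ?_ ?_ ?_
  · simp only [ContinuousLinearMap.lsmul_apply, neg_smul, integral_neg, neg_neg] at key
    rw [← key, ← integral_smul]
    congr 1
    ext y
    rw [smul_comm]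
  · simp only [ContinuousLinearMap.lsmul_apply]
    have hi := (integrable_gaussKer_mul_norm.mul_const (‖v‖ * C))
    refine hi.mono' ?_ (Filter.Eventually.of_forall fun y => ?_)
    · refine Continuous.aestronglyMeasurable ?_
      have := hf.continuous
      have := continuous_gaussKer
      fun_prop
    · rw [norm_smul, norm_neg, norm_mul, Real.norm_of_nonneg (gaussKer_nonneg y)]
      have h1 := norm_inner_le_norm (𝕜 := ℝ) y v
      calc ‖inner ℝ y v‖ * gaussKer y * ‖f (x + r • y)‖ ≤ ‖y‖ * ‖v‖ * gaussKer y * C := by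
            gcongr
            · exact mul_nonneg (by positivity) (gaussKer_nonneg y)
            · exact gaussKer_nonneg y
            · exact hC _
        _ = _ := by ring
  · simp only [ContinuousLinearMap.lsmul_apply]
    refine (((hf.dirDeriv v).integrable_gaussKer_smul r x).smul r).congr
      (Filter.Eventually.of_forall fun y => ?_)
    simp only [Pi.smul_apply]
    rw [smul_comm]
  · exact hf.integrable_gaussKer_smul r x
  · intro y _
    have h := (hasFDerivAt_gaussKer y).hasLineDerivAt v
    convert h using 1
    simp [mul_comm]
  · intro y _
    have h1 : HasFDerivAt (fun y : ℂ => x + r • y) (r • ContinuousLinearMap.id ℝ ℂ) y :=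
      ((hasFDerivAt_id y).const_smul r).const_add x
    have h := ((hf.hasFDerivAt (x + r • y)).comp y h1).hasLineDerivAt v
    have e : (fderiv ℝ f (x + r • y) ∘SL (r • ContinuousLinearMap.id ℝ ℂ)) v =
        r • dirDeriv v f (x + r • y) := by
      rw [ContinuousLinearMap.comp_apply, _root_.smul_apply, map_smul]
      rfl
    rw [e] at h
    exact h

lemma hasDerivAt_heatFlow {f : ℂ → E} (hf : IsTest f) (r : ℝ) (x : ℂ) :
    HasDerivAt (fun r => heatFlow f r x) (r • heatFlow (lapl f) r x) r := by
  obtain ⟨C, hC0, hC⟩ := hf.fderiv.exists_bound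
  have h := (hasDerivAt_integral_of_dominated_loc_of_deriv_le (μ := (volume : Measure ℂ)) (s := univ)
    (F := fun r y => gaussKer y • f (x + r • y)) (x₀ := r)
    (F' := fun r y => gaussKer y • fderiv ℝ f (x + r • y) y)
    (bound := fun y => gaussKer y * ‖y‖ * C)
    Filter.univ_mem
    (Filter.Eventually.of_forall fun r => (hf.integrable_gaussKer_smul r x).aestronglyMeasurable)
    (hf.integrable_gaussKer_smul r x) ?_
    (Filter.Eventually.of_forall fun y z _ => ?_) (integrable_gaussKer_mul_norm.mul_const C)
    (Filter.Eventually.of_forall fun y z _ => ?_)).2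
  · have h2 : ∫ y, gaussKer y • fderiv ℝ f (x + r • y) y = r • heatFlow (lapl f) r x := by
      have e1 := integral_inner_mul_gaussKer (hf.dirDeriv 1) r x 1
      have e2 := integral_inner_mul_gaussKer (hf.dirDeriv I) r x I
      have e3 : heatFlow (lapl f) r x = heatFlow (dirDeriv 1 (dirDeriv 1 f)) r x +
          heatFlow (dirDeriv I (dirDeriv I f)) r x :=
        heatFlow_add ((hf.dirDeriv 1).dirDeriv 1) ((hf.dirDeriv I).dirDeriv I) r x
      rw [e3, smul_add]
      unfold heatFlow
      have hint : ∀ v : ℂ, Integrable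
          (fun y => (inner ℝ y v * gaussKer y) • dirDeriv v f (x + r • y)) := by
        intro v
        obtain ⟨C, -, hC⟩ := (hf.dirDeriv v).exists_bound
        have hi := (integrable_gaussKer_mul_norm.mul_const (‖v‖ * C))
        refine hi.mono' ?_ (Filter.Eventually.of_forall fun y => ?_)
        · refine Continuous.aestronglyMeasurable ?_
          have := (hf.dirDeriv v).continuous
          have := continuous_gaussKer
          fun_prop
        · rw [norm_smul, norm_mul, Real.norm_of_nonneg (gaussKer_nonneg y)]
          have h1 := norm_inner_le_norm (𝕜 := ℝ) y v
          calc ‖inner ℝ y v‖ * gaussKer y * ‖dirDeriv v f (x + r • y)‖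
              ≤ ‖y‖ * ‖v‖ * gaussKer y * C := by
                gcongr
                · exact mul_nonneg (by positivity) (gaussKer_nonneg y)
                · exact gaussKer_nonneg y
                · exact hC _
            _ = _ := by ring
      rw [← e1, ← e2, ← integral_add (hint 1) (hint I)]
      congr 1
      ext y
      have hy : y = y.re • (1 : ℂ) + y.im • I := by
        simp [Complex.re_add_im]
      have : fderiv ℝ f (x + r • y) y =
          y.re • fderiv ℝ f (x + r • y) 1 + y.im • fderiv ℝ f (x + r • y) I := by
        conv_lhs => rw [hy, map_add, map_smul, map_smul]
        rw [← hy]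
      rw [this, smul_add, smul_smul, smul_smul, mul_comm (gaussKer y), mul_comm (gaussKer y)]
      simp [dirDeriv, Complex.inner]
    rw [← h2]
    exact h
  · refine Continuous.aestronglyMeasurable ?_
    have := hf.fderiv.continuous
    have := continuous_gaussKer
    exact continuous_gaussKer.smul ((hf.fderiv.continuous.comp (by fun_prop)).clm_apply
      continuous_id)
  · rw [norm_smul, Real.norm_of_nonneg (gaussKer_nonneg y)]
    calc gaussKer y * ‖fderiv ℝ f (x + z • y) y‖ ≤ gaussKer y * (C * ‖y‖) := by
          refine mul_le_mul_of_nonneg_left ?_ (gaussKer_nonneg y)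
          exact (ContinuousLinearMap.le_opNorm _ _).trans (by gcongr; exact hC _)
      _ = _ := by ring
  · have h1 : HasDerivAt (fun z : ℝ => x + z • y) y z := by
      simpa using ((hasDerivAt_id z).smul_const y).const_add x
    exact ((hf.hasFDerivAt (x + z • y)).comp_hasDerivAt z h1).const_smul (gaussKer y)

lemma IsTest.exists_heatFlow_decay {f : ℂ → E} (hf : IsTest f) (R : ℝ) (hR : 0 ≤ R) :
    ∃ C, 0 ≤ C ∧ ∀ r, |r| ≤ R → ∀ x, ‖heatFlow f r x‖ ≤ C * ((1 + ‖x‖) ^ 4)⁻¹ := by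
  obtain ⟨C, hC0, hC⟩ := hf.exists_decay
  refine ⟨C * ∫ y, gaussKer y * (1 + R * ‖y‖) ^ 4, mul_nonneg hC0
    (integral_nonneg fun y => mul_nonneg (gaussKer_nonneg y) (by positivity)), fun r hr x => ?_⟩
  have h := norm_integral_le_of_norm_le (f := fun y : ℂ => gaussKer y • f (x + r • y))
    ((integrable_gaussKer_mul_pow hR 4).mul_const (C * ((1 + ‖x‖) ^ 4)⁻¹))
    (Filter.Eventually.of_forall fun y => by
      rw [norm_smul, Real.norm_of_nonneg (gaussKer_nonneg y), mul_assoc]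
      refine mul_le_mul_of_nonneg_left ?_ (gaussKer_nonneg y)
      refine (hC _).trans ?_
      have h1 : 1 + ‖x‖ ≤ (1 + ‖x + r • y‖) * (1 + R * ‖y‖) := by
        have h2 : ‖x‖ ≤ ‖x + r • y‖ + R * ‖y‖ := by
          calc ‖x‖ = ‖(x + r • y) - r • y‖ := by simp
            _ ≤ ‖x + r • y‖ + ‖r • y‖ := norm_sub_le _ _
            _ ≤ _ := by
              rw [norm_smul]; gcongr; exact hr
        have h3 : 0 ≤ ‖x + r • y‖ * (R * ‖y‖) := by positivity
        linarith
      have h4 : (1 + ‖x‖) ^ 4 ≤ (1 + ‖x + r • y‖) ^ 4 * (1 + R * ‖y‖) ^ 4 := by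
        rw [← mul_pow]; gcongr
      have h5 : (0 : ℝ) < (1 + ‖x‖) ^ 4 := by positivity
      have h6 : (0 : ℝ) < (1 + ‖x + r • y‖) ^ 4 := by positivity
      have h7 : ((1 + ‖x + r • y‖) ^ 4)⁻¹ ≤ (1 + R * ‖y‖) ^ 4 * ((1 + ‖x‖) ^ 4)⁻¹ := by
        rw [← div_eq_mul_inv, le_div_iff₀ h5, inv_mul_le_iff₀ h6]
        exact h4
      calc C * ((1 + ‖x + r • y‖) ^ 4)⁻¹ ≤ C * ((1 + R * ‖y‖) ^ 4 * ((1 + ‖x‖) ^ 4)⁻¹) := by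
            gcongr
        _ = _ := by ring)
  rw [integral_mul_const] at h
  calc ‖heatFlow f r x‖ ≤ _ := h
    _ = _ := by ring

lemma IsTest.integrable_heatFlow {f : ℂ → E} (hf : IsTest f) (r : ℝ) :
    Integrable (heatFlow f r) := by
  obtain ⟨C, hC0, hC⟩ := hf.exists_heatFlow_decay |r| (abs_nonneg r)
  exact (integrable_one_add_norm_pow_inv.const_mul C).mono'
    (continuous_heatFlow hf r).aestronglyMeasurable
    (Filter.Eventually.of_forall fun x => hC r le_rfl x)

lemma IsTest.norm_heatFlow_le_integral {f : ℂ → E} {r : ℝ} (hr : 0 < r) (hf : IsTest f)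
    (x : ℂ) : ‖heatFlow f r x‖ ≤ (gaussMass⁻¹ * ∫ y, ‖f y‖) * (r ^ 2)⁻¹ := by
  have hcomp : Integrable (fun y : ℂ => ‖f (x + r • y)‖) :=
    ((hf.integrable.norm.comp_add_left x).comp_smul hr.ne')
  have h := norm_integral_le_of_norm_le (f := fun y : ℂ => gaussKer y • f (x + r • y))
    (hcomp.const_mul gaussMass⁻¹)
    (Filter.Eventually.of_forall fun y => by
      rw [norm_smul, Real.norm_of_nonneg (gaussKer_nonneg y)]
      exact mul_le_mul_of_nonneg_right (gaussKer_le y) (norm_nonneg _))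
  rw [integral_const_mul, Measure.integral_comp_smul volume (fun y => ‖f (x + y)‖) r,
    integral_add_left_eq_self (fun y => ‖f y‖) x, Complex.finrank_real_complex,
    abs_of_nonneg (by positivity), smul_eq_mul] at h
  calc ‖heatFlow f r x‖ ≤ _ := h
    _ = _ := by ring

lemma IsTest.integral_norm_heatFlow_le {f : ℂ → E} (hf : IsTest f) (r : ℝ) :
    ∫ x, ‖heatFlow f r x‖ ≤ ∫ x, ‖f x‖ := by
  rw [integral_norm_eq_lintegral_enorm (hf.integrable_heatFlow r).aestronglyMeasurable,
    integral_norm_eq_lintegral_enorm hf.integrable.aestronglyMeasurable]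
  refine ENNReal.toReal_mono hf.integrable.2.ne ?_
  calc ∫⁻ x, ‖heatFlow f r x‖ₑ
      ≤ ∫⁻ x, ∫⁻ y, ‖gaussKer y‖ₑ * ‖f (x + r • y)‖ₑ := by
        refine lintegral_mono fun x => ?_
        refine (enorm_integral_le_lintegral_enorm _).trans (le_of_eq ?_)
        simp [enorm_smul]
    _ = ∫⁻ y, ∫⁻ x, ‖gaussKer y‖ₑ * ‖f (x + r • y)‖ₑ := by
        refine lintegral_lintegral_swap (Continuous.measurable ?_).aemeasurable
        have h1 := continuous_gaussKer
        have h2 := hf.continuous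
        have h3 : Continuous (fun p : ℂ × ℂ => gaussKer p.2 • f (p.1 + r • p.2)) := by fun_prop
        simpa only [Function.uncurry_def, enorm_smul] using h3.enorm
    _ = ∫⁻ y, ‖gaussKer y‖ₑ * ∫⁻ x, ‖f x‖ₑ := by
        refine lintegral_congr fun y => ?_
        rw [lintegral_const_mul' _ _ (by simp), lintegral_add_right_eq_self (fun x => ‖f x‖ₑ)]
    _ = ∫⁻ x, ‖f x‖ₑ := by
        rw [lintegral_mul_const' _ _ hf.integrable.2.ne]
        have : ∫⁻ y, ‖gaussKer y‖ₑ = 1 := by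
          rw [← ofReal_integral_norm_eq_lintegral_enorm integrable_gaussKer]
          simp [abs_of_nonneg (gaussKer_nonneg _), integral_gaussKer]
        rw [this, one_mul]

end heat

section flow

variable {E : Type*} [NormedAddCommGroup E] [NormedSpace ℝ E] [FiniteDimensional ℝ E]

lemma exists_bound_comp_of_norm_le {G : Type*} [NormedAddCommGroup G] {φ : E → G}
    (hφ : Continuous φ) (M : ℝ) : ∃ A, 0 ≤ A ∧ ∀ e : E, ‖e‖ ≤ M → ‖φ e‖ ≤ A := by
  have : ProperSpace E := FiniteDimensional.proper ℝ E
  obtain ⟨A, hA⟩ := (isCompact_closedBall (0 : E) M).exists_bound_of_continuousOn hφ.continuousOn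
  refine ⟨max A 0, le_max_right _ _, fun e he => (hA e ?_).trans (le_max_left _ _)⟩
  simpa using he

variable {Ψ : E → ℝ} {Ψ' : E → E →L[ℝ] ℝ} {Ψ'' : E → E →L[ℝ] E →L[ℝ] ℝ} {w : ℂ → E}

lemma integrable_clm_heatFlow {φ : E → E →L[ℝ] ℝ} (hφ : Continuous φ) (hw : IsTest w)
    {w' : ℂ → E} (hw' : IsTest w') (r : ℝ) :
    Integrable (fun x => φ (heatFlow w r x) (heatFlow w' r x)) := by
  obtain ⟨M, -, hM⟩ := hw.exists_bound
  obtain ⟨A, hA0, hA⟩ := exists_bound_comp_of_norm_le hφ M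
  refine ((hw'.integrable_heatFlow r).norm.const_mul A).mono'
    ((hφ.comp (continuous_heatFlow hw r)).clm_apply
      (continuous_heatFlow hw' r)).aestronglyMeasurable
    (Filter.Eventually.of_forall fun x => ?_)
  exact (ContinuousLinearMap.le_opNorm _ _).trans
    (mul_le_mul_of_nonneg_right (hA _ (norm_heatFlow_le hM r x)) (norm_nonneg _))

lemma integrable_clm_clm_heatFlow (h2 : Continuous Ψ'') (hw : IsTest w) (v : ℂ) (r : ℝ) :
    Integrable (fun x => Ψ'' (heatFlow w r x) (heatFlow (dirDeriv v w) r x)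
      (heatFlow (dirDeriv v w) r x)) := by
  obtain ⟨M, -, hM⟩ := hw.exists_bound
  obtain ⟨M', hM0, hM'⟩ := (hw.dirDeriv v).exists_bound
  obtain ⟨A, hA0, hA⟩ := exists_bound_comp_of_norm_le (G := E →L[ℝ] E →L[ℝ] ℝ) h2 M
  have hw' := hw.dirDeriv v
  refine ((hw'.integrable_heatFlow r).norm.const_mul (A * M')).mono'
    (((h2.comp (continuous_heatFlow hw r)).clm_apply
      (continuous_heatFlow hw' r)).clm_apply (continuous_heatFlow hw' r)).aestronglyMeasurable
    (Filter.Eventually.of_forall fun x => ?_)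
  refine (ContinuousLinearMap.le_opNorm₂ _ _ _).trans ?_
  gcongr
  · exact hA _ (norm_heatFlow_le hM r x)
  · exact norm_heatFlow_le hM' r x

lemma integral_clm_heatFlow_dirDeriv (h1 : ∀ e, HasFDerivAt Ψ' (Ψ'' e) e) (h2 : Continuous Ψ'')
    (hw : IsTest w) (v : ℂ) (r : ℝ) :
    ∫ x, Ψ' (heatFlow w r x) (heatFlow (dirDeriv v (dirDeriv v w)) r x) =
      -∫ x, Ψ'' (heatFlow w r x) (heatFlow (dirDeriv v w) r x) (heatFlow (dirDeriv v w) r x) := by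
  have : CompleteSpace E := FiniteDimensional.complete ℝ E
  have hc : Continuous Ψ' := continuous_iff_continuousAt.2 fun e => (h1 e).continuousAt
  refine integral_bilinear_hasLineDerivAt_right_eq_neg_left_of_integrable
    (μ := (volume : Measure ℂ)) (v := v) (B := ContinuousLinearMap.id ℝ (E →L[ℝ] ℝ))
    (f := fun x => Ψ' (heatFlow w r x))
    (f' := fun x => Ψ'' (heatFlow w r x) (heatFlow (dirDeriv v w) r x))
    (g := heatFlow (dirDeriv v w) r) ?_ ?_ ?_ ?_ ?_
  · exact integrable_clm_clm_heatFlow h2 hw v r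
  · exact integrable_clm_heatFlow hc hw ((hw.dirDeriv v).dirDeriv v) r
  · exact integrable_clm_heatFlow hc hw (hw.dirDeriv v) r
  · intro x _
    have h := ((h1 (heatFlow w r x)).comp x (hasFDerivAt_heatFlow hw r x)).hasLineDerivAt v
    have e : (Ψ'' (heatFlow w r x) ∘SL heatFlow (fderiv ℝ w) r x) v =
        Ψ'' (heatFlow w r x) (heatFlow (dirDeriv v w) r x) := by
      rw [ContinuousLinearMap.comp_apply, ← (hasFDerivAt_heatFlow hw r x).fderiv,
        hasFDerivAt_heatFlow_dirDeriv hw]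
    rw [e] at h
    exact h
  · intro x _
    exact hasLineDerivAt_heatFlow (hw.dirDeriv v) r x v

/-- Evolution of a nonlinear functional along the heat flow. -/
lemma hasDerivAt_integral_comp_heatFlow (h0 : ∀ e, HasFDerivAt Ψ (Ψ' e) e)
    (h1 : ∀ e, HasFDerivAt Ψ' (Ψ'' e) e) (h2 : Continuous Ψ'') (hΨ : Ψ 0 = 0)
    (hw : IsTest w) (r : ℝ) :
    Integrable (fun x => Ψ (heatFlow w r x)) ∧
    HasDerivAt (fun r => ∫ x, Ψ (heatFlow w r x))
      (-(r * ((∫ x, Ψ'' (heatFlow w r x) (heatFlow (dirDeriv 1 w) r x)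
          (heatFlow (dirDeriv 1 w) r x)) +
        ∫ x, Ψ'' (heatFlow w r x) (heatFlow (dirDeriv I w) r x)
          (heatFlow (dirDeriv I w) r x)))) r := by
  have : CompleteSpace E := FiniteDimensional.complete ℝ E
  have hc : Continuous Ψ' := continuous_iff_continuousAt.2 fun e => (h1 e).continuousAt
  have hc0 : Continuous Ψ := continuous_iff_continuousAt.2 fun e => (h0 e).continuousAt
  obtain ⟨M, hM0, hM⟩ := hw.exists_bound
  obtain ⟨A, hA0, hA⟩ := exists_bound_comp_of_norm_le hc M
  have hint : ∀ r, Integrable (fun x => Ψ (heatFlow w r x)) := by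
    intro r
    refine ((hw.integrable_heatFlow r).norm.const_mul A).mono'
      (hc0.comp (continuous_heatFlow hw r)).aestronglyMeasurable
      (Filter.Eventually.of_forall fun x => ?_)
    have := (convex_closedBall (0 : E) M).norm_image_sub_le_of_norm_hasFDerivWithin_le
      (f := Ψ) (f' := Ψ') (C := A) (x := 0) (y := heatFlow w r x)
      (fun e _ => (h0 e).hasFDerivWithinAt) (fun e he => hA e (by simpa using he))
      (by simpa using hM0) (by simpa using norm_heatFlow_le hM r x)
    simpa [hΨ] using this
  refine ⟨hint r, ?_⟩
  obtain ⟨C, hC0, hC⟩ := hw.lapl.exists_heatFlow_decay (|r| + 1) (by positivity)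
  have h := (hasDerivAt_integral_of_dominated_loc_of_deriv_le (μ := (volume : Measure ℂ))
    (s := ball r 1)
    (F := fun r x => Ψ (heatFlow w r x)) (x₀ := r)
    (F' := fun r x => Ψ' (heatFlow w r x) (r • heatFlow (lapl w) r x))
    (bound := fun x => A * ((|r| + 1) * (C * ((1 + ‖x‖) ^ 4)⁻¹)))
    (ball_mem_nhds r one_pos)
    (Filter.Eventually.of_forall fun r => (hint r).aestronglyMeasurable) (hint r)
    ((hc.comp (continuous_heatFlow hw r)).clm_apply
      ((continuous_heatFlow hw.lapl r).const_smul r)).aestronglyMeasurable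
    (Filter.Eventually.of_forall fun x s hs => ?_)
    (((integrable_one_add_norm_pow_inv.const_mul C).const_mul (|r| + 1)).const_mul A)
    (Filter.Eventually.of_forall fun x s hs => ?_)).2
  · refine h.congr_deriv ?_
    have e : ∀ x, Ψ' (heatFlow w r x) (r • heatFlow (lapl w) r x) =
        r * (Ψ' (heatFlow w r x) (heatFlow (dirDeriv 1 (dirDeriv 1 w)) r x) +
          Ψ' (heatFlow w r x) (heatFlow (dirDeriv I (dirDeriv I w)) r x)) := by
      intro x
      have e3 : heatFlow (lapl w) r x = heatFlow (dirDeriv 1 (dirDeriv 1 w)) r x +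
          heatFlow (dirDeriv I (dirDeriv I w)) r x :=
        heatFlow_add ((hw.dirDeriv 1).dirDeriv 1) ((hw.dirDeriv I).dirDeriv I) r x
      rw [e3, map_smul, map_add, smul_eq_mul]
    simp_rw [e]
    rw [integral_const_mul, integral_add
      (integrable_clm_heatFlow hc hw ((hw.dirDeriv 1).dirDeriv 1) r)
      (integrable_clm_heatFlow hc hw ((hw.dirDeriv I).dirDeriv I) r),
      integral_clm_heatFlow_dirDeriv h1 h2 hw, integral_clm_heatFlow_dirDeriv h1 h2 hw]
    ring
  · have hs' : |s| ≤ |r| + 1 := by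
      rw [mem_ball, Real.dist_eq] at hs
      have := abs_sub_abs_le_abs_sub s r
      linarith
    refine (ContinuousLinearMap.le_opNorm _ _).trans ?_
    rw [norm_smul]
    gcongr
    · exact hA _ (norm_heatFlow_le hM s x)
    · exact hs'
    · exact hC s hs' x
  · exact (h0 _).comp_hasDerivAt s (hasDerivAt_heatFlow hw s x)

end flow

lemma integrable_heatFlow_mul {a b : ℂ → ℂ} (ha : IsTest a) (hb : IsTest b) (r : ℝ) :
    Integrable (fun x => heatFlow a r x * heatFlow b r x) := by
  obtain ⟨M, hM0, hM⟩ := ha.exists_bound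
  refine ((hb.integrable_heatFlow r).norm.const_mul M).mono'
    ((continuous_heatFlow ha r).mul (continuous_heatFlow hb r)).aestronglyMeasurable
    (Filter.Eventually.of_forall fun x => ?_)
  rw [norm_mul]
  gcongr
  exact norm_heatFlow_le hM r x

lemma integral_heatFlow_mul_dirDeriv {a b : ℂ → ℂ} (ha : IsTest a) (hb : IsTest b) (r : ℝ)
    (v : ℂ) : ∫ x, heatFlow a r x * heatFlow (dirDeriv v b) r x =
      -∫ x, heatFlow (dirDeriv v a) r x * heatFlow b r x :=
  integral_bilinear_hasLineDerivAt_right_eq_neg_left_of_integrable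
    (μ := (volume : Measure ℂ)) (v := v) (B := ContinuousLinearMap.mul ℝ ℂ)
    (f := heatFlow a r) (g := heatFlow b r)
    (integrable_heatFlow_mul (ha.dirDeriv v) hb r) (integrable_heatFlow_mul ha (hb.dirDeriv v) r)
    (integrable_heatFlow_mul ha hb r) (fun x _ => hasLineDerivAt_heatFlow ha r x v)
    (fun x _ => hasLineDerivAt_heatFlow hb r x v)

section commute

variable {E : Type*} [NormedAddCommGroup E] [NormedSpace ℝ E]

lemma dirDeriv_add {f g : ℂ → E} (hf : IsTest f) (hg : IsTest g) (v : ℂ) :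
    dirDeriv v (fun z => f z + g z) = fun z => dirDeriv v f z + dirDeriv v g z := by
  ext z
  exact congrArg (fun L : ℂ →L[ℝ] E => L v) ((hf.hasFDerivAt z).add (hg.hasFDerivAt z)).fderiv

lemma dirDeriv_const_mul {f : ℂ → ℂ} (hf : IsTest f) (c v : ℂ) :
    dirDeriv v (fun z => c * f z) = fun z => c * dirDeriv v f z := by
  ext z
  exact congrArg (fun L : ℂ →L[ℝ] ℂ => L v) ((hf.hasFDerivAt z).const_mul c).fderiv

lemma IsTest.const_mul {f : ℂ → ℂ} (hf : IsTest f) (c : ℂ) : IsTest (fun z => c * f z) :=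
  hf.clm_comp (ContinuousLinearMap.mul ℝ ℂ c)

lemma dirDeriv_comm {f : ℂ → E} (hf : IsTest f) (v w : ℂ) :
    dirDeriv v (dirDeriv w f) = dirDeriv w (dirDeriv v f) := by
  have key : ∀ v w z, dirDeriv v (dirDeriv w f) z = fderiv ℝ (fderiv ℝ f) z v w := by
    intro v w z
    have h := (hf.fderiv.hasFDerivAt z).clm_apply (hasFDerivAt_const w z)
    have h' : HasFDerivAt (dirDeriv w f) _ z := h
    unfold dirDeriv at h' ⊢
    rw [h'.fderiv]
    simp
  ext z
  rw [key, key]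
  have h : IsSymmSndFDerivAt ℝ f z :=
    hf.smooth.contDiffAt.isSymmSndFDerivAt (by simp; exact WithTop.coe_le_coe.2 (le_top (a := (2 : ℕ∞))))
  exact h v w

end commute

lemma heatFlow_const_mul {f : ℂ → ℂ} (hf : IsTest f) (c : ℂ) (r : ℝ) (x : ℂ) :
    heatFlow (fun z => c * f z) r x = c * heatFlow f r x :=
  heatFlow_clm hf (ContinuousLinearMap.mul ℝ ℂ c) r x

/-- The Cauchy–Riemann operator `∂ₛ + i ∂ₜ`. -/
def crOp (f : ℂ → ℂ) (z : ℂ) : ℂ := dirDeriv 1 f z + I * dirDeriv I f z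

lemma IsTest.crOp {f : ℂ → ℂ} (hf : IsTest f) : IsTest (crOp f) :=
  (hf.dirDeriv 1).add ((hf.dirDeriv I).const_mul I)

lemma heatFlow_laplacian_dirDeriv {f : ℂ → ℂ} (hf : IsTest f) (r : ℝ) (x : ℂ) :
    heatFlow (dirDeriv 1 (dirDeriv 1 (dirDeriv I f))) r x +
      heatFlow (dirDeriv I (dirDeriv I (dirDeriv I f))) r x =
    heatFlow (dirDeriv I (dirDeriv 1 (crOp f))) r x -
      I * heatFlow (dirDeriv I (dirDeriv I (crOp f))) r x := by
  have h1 := hf.dirDeriv 1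
  have h2 := hf.dirDeriv I
  have e : ∀ v, dirDeriv v (crOp f) =
      fun z => dirDeriv v (dirDeriv 1 f) z + I * dirDeriv v (dirDeriv I f) z := by
    intro v
    unfold crOp
    rw [dirDeriv_add h1 (h2.const_mul I), dirDeriv_const_mul h2]
  have e' : ∀ v, heatFlow (dirDeriv I (dirDeriv v (crOp f))) r x =
      heatFlow (dirDeriv I (dirDeriv v (dirDeriv 1 f))) r x +
        I * heatFlow (dirDeriv I (dirDeriv v (dirDeriv I f))) r x := by
    intro v
    rw [e, dirDeriv_add (h1.dirDeriv v) ((h2.dirDeriv v).const_mul I),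
      dirDeriv_const_mul (h2.dirDeriv v),
      heatFlow_add ((h1.dirDeriv v).dirDeriv I) (((h2.dirDeriv v).dirDeriv I).const_mul I),
      heatFlow_const_mul ((h2.dirDeriv v).dirDeriv I)]
  rw [e', e', dirDeriv_comm hf 1 I, dirDeriv_comm h1 1 I, dirDeriv_comm hf I 1]
  linear_combination (heatFlow (dirDeriv I (dirDeriv I (dirDeriv I f))) r x) * I_mul_I

lemma integral_heatFlow_dirDeriv_mul_dirDeriv {f h : ℂ → ℂ} (hf : IsTest f) (hh : IsTest h)
    (r : ℝ) :
    (∫ x, heatFlow (dirDeriv 1 (dirDeriv I f)) r x * heatFlow (dirDeriv 1 h) r x) +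
      ∫ x, heatFlow (dirDeriv I (dirDeriv I f)) r x * heatFlow (dirDeriv I h) r x =
    ∫ x, (heatFlow (dirDeriv 1 (crOp f)) r x - I * heatFlow (dirDeriv I (crOp f)) r x) *
      heatFlow (dirDeriv I h) r x := by
  have h2 := hf.dirDeriv I
  have hg := hf.crOp
  rw [integral_heatFlow_mul_dirDeriv (h2.dirDeriv 1) hh,
    integral_heatFlow_mul_dirDeriv (h2.dirDeriv I) hh, ← neg_add,
    ← integral_add (integrable_heatFlow_mul ((h2.dirDeriv 1).dirDeriv 1) hh r)
      (integrable_heatFlow_mul ((h2.dirDeriv I).dirDeriv I) hh r)]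
  simp_rw [← add_mul, heatFlow_laplacian_dirDeriv hf, sub_mul, mul_assoc]
  rw [integral_sub (integrable_heatFlow_mul ((hg.dirDeriv 1).dirDeriv I) hh r)
      ((integrable_heatFlow_mul ((hg.dirDeriv I).dirDeriv I) hh r).const_mul I),
    integral_sub (integrable_heatFlow_mul (hg.dirDeriv 1) (hh.dirDeriv I) r)
      ((integrable_heatFlow_mul (hg.dirDeriv I) (hh.dirDeriv I) r).const_mul I),
    integral_const_mul, integral_const_mul,
    integral_heatFlow_mul_dirDeriv (hg.dirDeriv 1) hh,
    integral_heatFlow_mul_dirDeriv (hg.dirDeriv I) hh]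
  ring

/-- The real-bilinear form `(a, b) ↦ Re (a b)` on `ℂ`. -/
def reMul : ℂ →L[ℝ] ℂ →L[ℝ] ℝ :=
  (ContinuousLinearMap.compL ℝ ℂ ℂ ℝ Complex.reCLM).comp (ContinuousLinearMap.mul ℝ ℂ)

lemma reMul_apply (a b : ℂ) : reMul a b = (a * b).re := rfl

/-- A Bellman function: its Hessian controls the product of the increments of its two arguments. -/
structure IsBellman (Q : ℂ × ℂ → ℝ) : Prop where
  smooth : ContDiff ℝ (⊤ : ℕ∞) Q
  zero : Q 0 = 0
  nonneg : ∀ w, 0 ≤ Q w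
  hess : ∀ w, ∃ m : ℝ, 0 < m ∧ ∀ e : ℂ × ℂ,
    m * ‖e.1‖ ^ 2 + m⁻¹ * ‖e.2‖ ^ 2 ≤ fderiv ℝ (fderiv ℝ Q) w e e

lemma heatFlow_prodMk {a b : ℂ → ℂ} (ha : IsTest a) (hb : IsTest b) (r : ℝ) (x : ℂ) :
    heatFlow (fun z => (a z, b z)) r x = (heatFlow a r x, heatFlow b r x) := by
  ext1
  · exact (heatFlow_clm (ha.prodMk hb) (ContinuousLinearMap.fst ℝ ℂ ℂ) r x).symm
  · exact (heatFlow_clm (ha.prodMk hb) (ContinuousLinearMap.snd ℝ ℂ ℂ) r x).symm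

lemma dirDeriv_prodMk {a b : ℂ → ℂ} (ha : IsTest a) (hb : IsTest b) (v : ℂ) :
    dirDeriv v (fun z => (a z, b z)) = fun z => (dirDeriv v a z, dirDeriv v b z) := by
  ext1 z
  exact congrArg (fun L : ℂ →L[ℝ] ℂ × ℂ => L v)
    ((ha.hasFDerivAt z).prodMk (hb.hasFDerivAt z)).fderiv

lemma hasDerivAt_re_integral_mul {a b : ℂ → ℂ} (ha : IsTest a) (hb : IsTest b) (r : ℝ) :
    HasDerivAt (fun r => (∫ x, heatFlow a r x * heatFlow b r x).re)
      (-(r * (2 * ((∫ x, heatFlow (dirDeriv 1 a) r x * heatFlow (dirDeriv 1 b) r x) +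
        ∫ x, heatFlow (dirDeriv I a) r x * heatFlow (dirDeriv I b) r x).re))) r := by
  have hre : ∀ φ : ℂ → ℂ, Integrable φ → (∫ x, φ x).re = ∫ x, (φ x).re :=
    fun φ hφ => (Complex.reCLM.integral_comp_comm hφ).symm
  have h := (hasDerivAt_integral_comp_heatFlow (E := ℂ × ℂ) (Ψ := fun p => reMul p.1 p.2)
    (Ψ' := fun p => reMul.deriv₂ p) (Ψ'' := fun _ => reMul.deriv₂)
    (fun p => reMul.isBoundedBilinearMap.hasFDerivAt p) (fun p => reMul.deriv₂.hasFDerivAt)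
    continuous_const (by simp) (ha.prodMk hb) r).2
  simp only [dirDeriv_prodMk ha hb, heatFlow_prodMk ha hb, heatFlow_prodMk (ha.dirDeriv _)
    (hb.dirDeriv _), ContinuousLinearMap.coe_deriv₂, reMul_apply] at h
  convert h using 1
  · ext s
    exact hre _ (integrable_heatFlow_mul ha hb s)
  · simp only [Complex.add_re]
    rw [hre _ (integrable_heatFlow_mul (ha.dirDeriv 1) (hb.dirDeriv 1) r),
      hre _ (integrable_heatFlow_mul (ha.dirDeriv I) (hb.dirDeriv I) r)]
    simp only [← two_mul, integral_const_mul]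
    ring

/-- The bilinear estimate for the Beurling transform in terms of a Bellman function. -/
lemma re_integral_dirDeriv_mul_le {f h : ℂ → ℂ} (hf : IsTest f) (hh : IsTest h)
    {Q : ℂ × ℂ → ℝ} (hQ : IsBellman Q) :
    (∫ x, dirDeriv I f x * h x).re ≤ 2 * ∫ x, Q (crOp f x, h x) := by
  have hF := hf.dirDeriv I
  have hg := hf.crOp
  have hw := hg.prodMk hh
  have hQ1 : ContDiff ℝ (⊤ : ℕ∞) (fderiv ℝ Q) := hQ.smooth.fderiv_right (by simp)
  have hQ2 : ContDiff ℝ (⊤ : ℕ∞) (fderiv ℝ (fderiv ℝ Q)) := hQ1.fderiv_right (by simp)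
  have hA := fun r => hasDerivAt_integral_comp_heatFlow (Ψ := Q) (Ψ' := fderiv ℝ Q)
    (Ψ'' := fderiv ℝ (fderiv ℝ Q))
    (fun p => (hQ.smooth.differentiable (by simp) p).hasFDerivAt)
    (fun p => (hQ1.differentiable (by simp) p).hasFDerivAt) hQ2.continuous hQ.zero hw r
  have hB := hasDerivAt_re_integral_mul hF hh
  set Φ : ℝ → ℝ := fun r => 2 * (∫ x, Q (heatFlow (fun z => (crOp f z, h z)) r x)) -
    (∫ x, heatFlow (dirDeriv I f) r x * heatFlow h r x).re with hΦ
  have hΦd : ∀ r, HasDerivAt Φ _ r := fun r => ((hA r).2.const_mul 2).sub (hB r)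
  have hanti : AntitoneOn Φ (Ici 0) := by
    refine antitoneOn_of_deriv_nonpos (convex_Ici 0)
      (fun r _ => (hΦd r).continuousAt.continuousWithinAt)
      (fun r _ => (hΦd r).differentiableAt.differentiableWithinAt) fun r hr => ?_
    rw [interior_Ici] at hr
    have hr : 0 < r := hr
    rw [(hΦd r).deriv, integral_heatFlow_dirDeriv_mul_dirDeriv hf hh]
    have hi1 := integrable_clm_clm_heatFlow hQ2.continuous hw 1 r
    have hi2 := integrable_clm_clm_heatFlow hQ2.continuous hw I r
    have hi3 : Integrable (fun x => (heatFlow (dirDeriv 1 (crOp f)) r x -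
        I * heatFlow (dirDeriv I (crOp f)) r x) * heatFlow (dirDeriv I h) r x) := by
      simp_rw [sub_mul, mul_assoc]
      exact (integrable_heatFlow_mul (hg.dirDeriv 1) (hh.dirDeriv I) r).sub
        ((integrable_heatFlow_mul (hg.dirDeriv I) (hh.dirDeriv I) r).const_mul I)
    rw [← integral_add hi1 hi2]
    have hle : (∫ x, (heatFlow (dirDeriv 1 (crOp f)) r x -
        I * heatFlow (dirDeriv I (crOp f)) r x) * heatFlow (dirDeriv I h) r x).re ≤
        ∫ x, (fderiv ℝ (fderiv ℝ Q) (heatFlow (fun z => (crOp f z, h z)) r x)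
          (heatFlow (dirDeriv 1 fun z => (crOp f z, h z)) r x)
          (heatFlow (dirDeriv 1 fun z => (crOp f z, h z)) r x) +
          fderiv ℝ (fderiv ℝ Q) (heatFlow (fun z => (crOp f z, h z)) r x)
          (heatFlow (dirDeriv I fun z => (crOp f z, h z)) r x)
          (heatFlow (dirDeriv I fun z => (crOp f z, h z)) r x)) := by
      refine (Complex.re_le_norm _).trans ((norm_integral_le_integral_norm _).trans ?_)
      refine integral_mono hi3.norm (hi1.add hi2) fun x => ?_
      obtain ⟨m, hm, hH⟩ := hQ.hess (heatFlow (fun z => (crOp f z, h z)) r x)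
      have q1 := hH (heatFlow (dirDeriv 1 fun z => (crOp f z, h z)) r x)
      have q2 := hH (heatFlow (dirDeriv I fun z => (crOp f z, h z)) r x)
      refine le_trans ?_ (add_le_add q1 q2)
      simp only [dirDeriv_prodMk hg hh, heatFlow_prodMk (hg.dirDeriv _) (hh.dirDeriv _)]
      rw [norm_mul]
      set A := ‖heatFlow (dirDeriv 1 (crOp f)) r x‖
      set B := ‖heatFlow (dirDeriv I (crOp f)) r x‖ with hB
      set K := ‖heatFlow (dirDeriv I h) r x‖
      have t1 : ‖heatFlow (dirDeriv 1 (crOp f)) r x - I * heatFlow (dirDeriv I (crOp f)) r x‖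
          ≤ A + B := by
        refine (norm_sub_le _ _).trans ?_
        rw [norm_mul, Complex.norm_I, one_mul]
      have young : ∀ a : ℝ, 2 * (a * K) ≤ m * a ^ 2 + m⁻¹ * K ^ 2 := by
        intro a
        have : 0 ≤ m⁻¹ * (m * a - K) ^ 2 := by positivity
        have e : m⁻¹ * (m * a - K) ^ 2 = m * a ^ 2 + m⁻¹ * K ^ 2 - 2 * (a * K) := by
          field_simp
          ring
        linarith
      have y1 := young A
      have y2 := young B
      have t2 := mul_le_mul_of_nonneg_right t1 (norm_nonneg (heatFlow (dirDeriv I h) r x))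
      have t3 : 0 ≤ m⁻¹ * ‖heatFlow (dirDeriv 1 h) r x‖ ^ 2 := by positivity
      have t4 : 0 ≤ m * A ^ 2 := by positivity
      have t5 : 0 ≤ m * B ^ 2 := by positivity
      have t6 : (A + B) * K = A * K + B * K := by ring
      linarith
    have := mul_le_mul_of_nonneg_left hle hr.le
    linarith
  have hlim : ∀ r, 0 < r → -((gaussMass⁻¹ * ∫ y, ‖dirDeriv I f y‖) * (r ^ 2)⁻¹ * ∫ y, ‖h y‖) ≤
      Φ r := by
    intro r hr
    have h1 : 0 ≤ ∫ x, Q (heatFlow (fun z => (crOp f z, h z)) r x) :=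
      integral_nonneg fun x => hQ.nonneg _
    have h2 : (∫ x, heatFlow (dirDeriv I f) r x * heatFlow h r x).re ≤
        (gaussMass⁻¹ * ∫ y, ‖dirDeriv I f y‖) * (r ^ 2)⁻¹ * ∫ y, ‖h y‖ := by
      refine (Complex.re_le_norm _).trans ?_
      refine (norm_integral_le_of_norm_le ((hh.integrable_heatFlow r).norm.const_mul
        ((gaussMass⁻¹ * ∫ y, ‖dirDeriv I f y‖) * (r ^ 2)⁻¹))
        (Filter.Eventually.of_forall fun x => ?_)).trans ?_
      · rw [norm_mul]
        exact mul_le_mul_of_nonneg_right (hF.norm_heatFlow_le_integral hr x) (norm_nonneg _)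
      · rw [integral_const_mul]
        refine mul_le_mul_of_nonneg_left (hh.integral_norm_heatFlow_le r) ?_
        have := gaussMass_pos
        have : 0 ≤ ∫ y, ‖dirDeriv I f y‖ := integral_nonneg fun y => norm_nonneg _
        positivity
    simp only [hΦ]
    linarith
  have hΦ0 : 0 ≤ Φ 0 := by
    have ht : Filter.Tendsto (fun r : ℝ =>
        -((gaussMass⁻¹ * ∫ y, ‖dirDeriv I f y‖) * (r ^ 2)⁻¹ * ∫ y, ‖h y‖)) Filter.atTop (𝓝 0) := by
      have := ((tendsto_inv_atTop_zero.comp (Filter.tendsto_pow_atTop (α := ℝ)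
        two_ne_zero)).const_mul (gaussMass⁻¹ * ∫ y, ‖dirDeriv I f y‖)).mul_const (∫ y, ‖h y‖)
      simpa using this.neg
    refine le_of_tendsto ht ?_
    filter_upwards [Filter.eventually_gt_atTop 0] with r hr
    exact (hlim r hr).trans (hanti (mem_Ici.2 le_rfl) (mem_Ici.2 hr.le) hr.le)
  simp only [hΦ, heatFlow_zero] at hΦ0
  linarith

lemma bellman_hessian_algebra {p q K H L a b a₁ b₁ A B Z X' X'' Y' Y'' M : ℝ} (hp : 2 ≤ p)
    (hq1 : 1 < q) (hq2 : q ≤ 2) (hpq : q = p * (q - 1)) {α : ℝ} (hα0 : 0 ≤ α) (hα1 : α ≤ 1)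
    (ha : 0 < a) (hb : 0 < b) (hH : 0 ≤ H) (hL : 0 ≤ L) (hA : 0 < A) (hB : 0 < B) (hZ : 0 < Z)
    (ha₁ : a₁ ^ 2 ≤ 4 * a * H) (hb₁ : b₁ ^ 2 ≤ 4 * b * L)
    (hX' : X' = p / 2 * (a * A) * a₁)
    (hX'' : X'' = p / 2 * (a * A * (2 * H) + (p / 2 - 1) * A * a₁ ^ 2))
    (hY' : Y' = q / 2 * (b * B) * b₁)
    (hY'' : Y'' = q / 2 * (b * B * (2 * L) + (q / 2 - 1) * B * b₁ ^ 2))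
    (hM : M = a ^ 2 * A + b ^ 2 * B)
    (h1 : a * (M * Z) ≤ 1) (h2 : 1 ≤ b * B * (M ^ 2 * Z))
    (hK : K = 5 * p + (q * (q - 1))⁻¹) :
    M ^ 2 * Z * H + (M ^ 2 * Z)⁻¹ * L ≤
      2 * H * (M ^ 2 * Z) + 2 * (α * a₁ * (M * Z) * (X' + Y')) +
      a * (α * ((α - 1) * Z * (X' + Y') ^ 2 + M * Z * (X'' + Y''))) + K * (X'' + Y'') := by
  have hM0 : 0 < M := by rw [hM]; positivity
  have hX : p * a * A * H ≤ X'' := by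
    have : 0 ≤ p / 2 * ((p / 2 - 1) * A * a₁ ^ 2) := by
      have : 0 ≤ p / 2 - 1 := by linarith
      positivity
    rw [hX'']; linarith
  have hX0 : 0 ≤ X'' := le_trans (by positivity) hX
  have hX2 : X' ^ 2 ≤ p * (a ^ 2 * A) * X'' := by
    calc X' ^ 2 = (p / 2 * (a * A)) ^ 2 * a₁ ^ 2 := by rw [hX']; ring
      _ ≤ (p / 2 * (a * A)) ^ 2 * (4 * a * H) := by gcongr
      _ = p * (a ^ 2 * A) * (p * a * A * H) := by ring
      _ ≤ _ := by gcongr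
  have hY : q * (q - 1) * (b * B) * L ≤ Y'' := by
    have h : 0 ≤ q / 2 * B * (1 - q / 2) := by
      have : 0 ≤ 1 - q / 2 := by linarith
      positivity
    have := mul_le_mul_of_nonneg_left hb₁ h
    rw [hY'']; linarith
  have hq0 : 0 < q * (q - 1) := mul_pos (by linarith) (by linarith)
  have hY0 : 0 ≤ Y'' := le_trans (by positivity) hY
  have hY2 : Y' ^ 2 ≤ p * (b ^ 2 * B) * Y'' := by
    calc Y' ^ 2 = (q / 2 * (b * B)) ^ 2 * b₁ ^ 2 := by rw [hY']; ring
      _ ≤ (q / 2 * (b * B)) ^ 2 * (4 * b * L) := by gcongr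
      _ = q * (b ^ 2 * B) * (q * (b * B) * L) := by ring
      _ = p * (b ^ 2 * B) * (q * (q - 1) * (b * B) * L) := by
        linear_combination (b ^ 2 * B) * (q * (b * B) * L) * hpq
      _ ≤ _ := by gcongr
  have hM2 : (X' + Y') ^ 2 ≤ p * M * (X'' + Y'') := by
    set x := a ^ 2 * A with hx
    set y := b ^ 2 * B with hy
    have hx0 : 0 < x := by positivity
    have hy0 : 0 < y := by positivity
    have hc : 2 * (X' * Y') ≤ p * (x * Y'' + y * X'') := by
      refine (le_abs_self _).trans (abs_le_of_sq_le_sq ?_ (by positivity))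
      calc (2 * (X' * Y')) ^ 2 = 4 * (X' ^ 2 * Y' ^ 2) := by ring
        _ ≤ 4 * ((p * x * X'') * (p * y * Y'')) := by gcongr
        _ ≤ _ := by linarith [sq_nonneg (p * (x * Y'' - y * X''))]
    rw [hM]; linarith
  have hS0 : 0 ≤ X'' + Y'' := by positivity
  have hYT : q * (q - 1) * (b * B) * L ≤ X'' + Y'' := hY.trans (le_add_of_nonneg_left hX0)
  generalize X' + Y' = S at *
  generalize X'' + Y'' = T at *
  have hi : -(H * M ^ 2 + 4 * a * S ^ 2) ≤ 2 * (α * a₁ * M * S) := by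
    refine neg_le_of_abs_le (abs_le_of_sq_le_sq ?_ (by positivity))
    calc (2 * (α * a₁ * M * S)) ^ 2 = 4 * α ^ 2 * a₁ ^ 2 * (M ^ 2 * S ^ 2) := by ring
      _ ≤ 4 * 1 ^ 2 * (4 * a * H) * (M ^ 2 * S ^ 2) := by gcongr
      _ ≤ _ := by linarith [sq_nonneg (H * M ^ 2 - 4 * a * S ^ 2)]
  have hi' := mul_le_mul_of_nonneg_right hi hZ.le
  have hii : a * Z * S ^ 2 ≤ p * T := by
    calc a * Z * S ^ 2 ≤ a * Z * (p * M * T) := by gcongr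
      _ = p * T * (a * (M * Z)) := by ring
      _ ≤ p * T * 1 := by gcongr
      _ = p * T := mul_one _
  have hiii : -(a * Z * S ^ 2) ≤ a * (α * ((α - 1) * Z * S ^ 2)) := by
    have : 0 ≤ (1 - α * (1 - α)) * (a * Z * S ^ 2) := by
      have : 0 ≤ 1 - α * (1 - α) := by nlinarith
      positivity
    linarith
  have hiv : 0 ≤ a * (α * (M * Z * T)) := by positivity
  have hv : (M ^ 2 * Z)⁻¹ * L ≤ (q * (q - 1))⁻¹ * T := by
    have e1 : (M ^ 2 * Z)⁻¹ ≤ b * B := by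
      rw [inv_le_iff_one_le_mul₀ (by positivity)]; exact h2
    calc (M ^ 2 * Z)⁻¹ * L ≤ b * B * L := by gcongr
      _ = (q * (q - 1))⁻¹ * (q * (q - 1) * (b * B) * L) := by
        rw [mul_assoc (q * (q - 1)), inv_mul_cancel_left₀ hq0.ne']
      _ ≤ _ := by gcongr
  rw [hK]
  linarith

/-- The (unnormalised) regularised Bellman function, in terms of the squared moduli. -/
def bellmanAux (p q : ℝ) (a b : ℝ) : ℝ :=
  a * (a ^ (p / 2) + b ^ (q / 2)) ^ (1 - 2 / p) +
    (5 * p + (q * (q - 1))⁻¹) * (a ^ (p / 2) + b ^ (q / 2))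

/-- The regularised Bellman function. -/
def bellman (p q ε : ℝ) (w : ℂ × ℂ) : ℝ :=
  bellmanAux p q (ε + ‖w.1‖ ^ 2) (ε + ‖w.2‖ ^ 2) - bellmanAux p q ε ε

lemma bellmanAux_mono {p q : ℝ} (hp : 2 ≤ p) (hq1 : 1 < q) {a b a' b' : ℝ} (ha : 0 ≤ a)
    (hb : 0 ≤ b) (haa : a ≤ a') (hbb : b ≤ b') : bellmanAux p q a b ≤ bellmanAux p q a' b' := by
  have hα : 0 ≤ 1 - 2 / p := by
    rw [sub_nonneg, div_le_one (by linarith)]; exact hp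
  have hq0 : 0 < q * (q - 1) := mul_pos (by linarith) (by linarith)
  have hM : a ^ (p / 2) + b ^ (q / 2) ≤ a' ^ (p / 2) + b' ^ (q / 2) := by gcongr
  have h0 : 0 ≤ a ^ (p / 2) + b ^ (q / 2) := by positivity
  unfold bellmanAux
  have : 0 ≤ a' := ha.trans haa
  gcongr

lemma fderiv_fderiv_apply_of_hasDerivAt {E : Type*} [NormedAddCommGroup E] [NormedSpace ℝ E]
    {Q : E → ℝ} (hQ : ContDiff ℝ (⊤ : ℕ∞) Q) {w e : E} {φ : ℝ → ℝ} {d : ℝ}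
    (h1 : ∀ s, HasDerivAt (fun s : ℝ => Q (w + s • e)) (φ s) s) (h2 : HasDerivAt φ d 0) :
    fderiv ℝ (fderiv ℝ Q) w e e = d := by
  have hQ1 : ContDiff ℝ (⊤ : ℕ∞) (fderiv ℝ Q) := hQ.fderiv_right (by simp)
  have hl : ∀ s : ℝ, HasDerivAt (fun s : ℝ => w + s • e) e s := fun s => by
    simpa using ((hasDerivAt_id s).smul_const e).const_add w
  have hφ : φ = fun s => fderiv ℝ Q (w + s • e) e := by
    ext s
    exact (h1 s).unique (((hQ.differentiable (by simp) _).hasFDerivAt).comp_hasDerivAt s (hl s))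
  have h3 : HasDerivAt (fun s : ℝ => fderiv ℝ Q (w + s • e)) (fderiv ℝ (fderiv ℝ Q) w e) 0 := by
    have := ((hQ1.differentiable (by simp) (w + (0 : ℝ) • e)).hasFDerivAt).comp_hasDerivAt 0 (hl 0)
    rwa [zero_smul, add_zero] at this
  have h4 := h3.clm_apply (hasDerivAt_const (0 : ℝ) e)
  rw [hφ] at h2
  have := h2.unique h4
  simpa using this.symm

lemma contDiff_bellman {p q ε : ℝ} (hε : 0 < ε) : ContDiff ℝ (⊤ : ℕ∞) (bellman p q ε) := by
  have ha : ContDiff ℝ (⊤ : ℕ∞) (fun w : ℂ × ℂ => ε + ‖w.1‖ ^ 2) :=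
    contDiff_const.add (contDiff_fst.norm_sq ℝ)
  have hb : ContDiff ℝ (⊤ : ℕ∞) (fun w : ℂ × ℂ => ε + ‖w.2‖ ^ 2) :=
    contDiff_const.add (contDiff_snd.norm_sq ℝ)
  have ha0 : ∀ w : ℂ × ℂ, 0 < ε + ‖w.1‖ ^ 2 := fun w => by positivity
  have hb0 : ∀ w : ℂ × ℂ, 0 < ε + ‖w.2‖ ^ 2 := fun w => by positivity
  have hM := (ha.rpow_const_of_ne (p := p / 2) fun w => (ha0 w).ne').add
    (hb.rpow_const_of_ne (p := q / 2) fun w => (hb0 w).ne')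
  have hM0 : ∀ w : ℂ × ℂ, (ε + ‖w.1‖ ^ 2) ^ (p / 2) + (ε + ‖w.2‖ ^ 2) ^ (q / 2) ≠ 0 :=
    fun w => by have := ha0 w; have := hb0 w; positivity
  exact ((ha.mul (hM.rpow_const_of_ne (p := 1 - 2 / p) hM0)).add (contDiff_const.mul hM)).sub
    contDiff_const

lemma isBellman_bellman {p q ε : ℝ} (hp : 2 ≤ p) (hq1 : 1 < q) (hq2 : q ≤ 2)
    (hpq : q = p * (q - 1)) (hε : 0 < ε) : IsBellman (bellman p q ε) where
  smooth := contDiff_bellman hε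
  zero := by simp [bellman]
  nonneg w := by
    unfold bellman
    rw [sub_nonneg]
    exact bellmanAux_mono hp hq1 hε.le hε.le (by simp) (by simp)
  hess := by
    rintro ⟨u, v⟩
    have hp0 : 0 < p := by linarith
    set a₀ := ε + ‖u‖ ^ 2 with ha₀
    set b₀ := ε + ‖v‖ ^ 2 with hb₀
    have ha0 : 0 < a₀ := by positivity
    have hb0 : 0 < b₀ := by positivity
    set M₀ := a₀ ^ (p / 2) + b₀ ^ (q / 2) with hM₀
    have hM0 : 0 < M₀ := by positivity
    set α := 1 - 2 / p with hα
    have hα0 : 0 ≤ α := by rw [hα, sub_nonneg, div_le_one hp0]; exact hp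
    have hα1 : α ≤ 1 := by rw [hα]; linarith [show 0 ≤ 2 / p by positivity]
    refine ⟨M₀ ^ α, by positivity, ?_⟩
    rintro ⟨h, k⟩
    set a : ℝ → ℝ := fun s => ε + ‖u + s • h‖ ^ 2 with ha
    set b : ℝ → ℝ := fun s => ε + ‖v + s • k‖ ^ 2 with hb
    have ap : ∀ s, 0 < a s := fun s => by simp only [ha]; positivity
    have bp : ∀ s, 0 < b s := fun s => by simp only [hb]; positivity
    have hsq : ∀ (u h : ℂ) (s : ℝ), HasDerivAt (fun s : ℝ => ε + ‖u + s • h‖ ^ 2)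
        (2 * inner ℝ (u + s • h) h) s := by
      intro u h s
      have hl : HasDerivAt (fun s : ℝ => u + s • h) h s := by
        simpa using ((hasDerivAt_id s).smul_const h).const_add u
      exact hl.norm_sq.const_add ε
    have hin : ∀ (u h : ℂ), HasDerivAt (fun s : ℝ => 2 * inner ℝ (u + s • h) h)
        (2 * ‖h‖ ^ 2) 0 := by
      intro u h
      have hl : HasDerivAt (fun s : ℝ => u + s • h) h 0 := by
        simpa using ((hasDerivAt_id (0 : ℝ)).smul_const h).const_add u
      have := (hl.inner ℝ (hasDerivAt_const (0 : ℝ) h)).const_mul 2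
      simpa using this
    set a' : ℝ → ℝ := fun s => 2 * inner ℝ (u + s • h) h with ha'
    set b' : ℝ → ℝ := fun s => 2 * inner ℝ (v + s • k) k with hb'
    have da : ∀ s, HasDerivAt a (a' s) s := hsq u h
    have db : ∀ s, HasDerivAt b (b' s) s := hsq v k
    have da' : HasDerivAt a' (2 * ‖h‖ ^ 2) 0 := hin u h
    have db' : HasDerivAt b' (2 * ‖k‖ ^ 2) 0 := hin v k
    set M : ℝ → ℝ := fun s => a s ^ (p / 2) + b s ^ (q / 2) with hM
    have Mp : ∀ s, 0 < M s := fun s => by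
      have := ap s; have := bp s; simp only [hM]; positivity
    set M' : ℝ → ℝ := fun s => a' s * (p / 2) * a s ^ (p / 2 - 1) +
      b' s * (q / 2) * b s ^ (q / 2 - 1) with hM'
    have dM : ∀ s, HasDerivAt M (M' s) s := fun s =>
      ((da s).rpow_const (Or.inl (ap s).ne')).add ((db s).rpow_const (Or.inl (bp s).ne'))
    have dM' : HasDerivAt M' _ 0 :=
      ((da'.mul_const (p / 2)).mul ((da 0).rpow_const (Or.inl (ap 0).ne'))).add
        ((db'.mul_const (q / 2)).mul ((db 0).rpow_const (Or.inl (bp 0).ne')))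
    set K := 5 * p + (q * (q - 1))⁻¹ with hK
    have dQ : ∀ s, HasDerivAt (fun s : ℝ => bellman p q ε ((u, v) + s • (h, k)))
        (a' s * M s ^ α + a s * (M' s * α * M s ^ (α - 1)) + K * M' s) s := fun s =>
      (((da s).mul ((dM s).rpow_const (Or.inl (Mp s).ne'))).add ((dM s).const_mul K)).sub_const _
    have dQ' : HasDerivAt
        (fun s => a' s * M s ^ α + a s * (M' s * α * M s ^ (α - 1)) + K * M' s) _ 0 :=
      ((da'.mul ((dM 0).rpow_const (Or.inl (Mp 0).ne'))).add
        ((da 0).mul ((dM'.mul_const α).mul ((dM 0).rpow_const (Or.inl (Mp 0).ne'))))).add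
        (dM'.const_mul K)
    rw [fderiv_fderiv_apply_of_hasDerivAt (contDiff_bellman hε) dQ dQ']
    have ea : a 0 = a₀ := by simp [ha, ha₀]
    have eb : b 0 = b₀ := by simp [hb, hb₀]
    have eM : M 0 = M₀ := by simp only [hM, ea, eb, hM₀]
    simp only [Pi.mul_apply, ea, eb, eM]
    have hcs : ∀ u h : ℂ, (2 * inner ℝ (u + (0 : ℝ) • h) h) ^ 2 ≤
        4 * (ε + ‖u‖ ^ 2) * ‖h‖ ^ 2 := by
      intro u h
      have h1 := abs_real_inner_le_norm u h
      have h2 : (inner ℝ u h) ^ 2 ≤ (‖u‖ * ‖h‖) ^ 2 := sq_le_sq' (neg_le_of_abs_le h1)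
        (le_of_abs_le h1)
      rw [zero_smul, add_zero]
      nlinarith [mul_nonneg hε.le (sq_nonneg ‖h‖)]
    have r1 : ∀ x : ℝ, 0 < x → ∀ t : ℝ, x ^ (t - 1) = x * x ^ (t - 2) := by
      intro x hx t
      rw [show t - 1 = 1 + (t - 2) by ring, Real.rpow_add hx, Real.rpow_one]
    have r2 : ∀ x : ℝ, 0 < x → ∀ t : ℝ, x ^ t = x ^ 2 * x ^ (t - 2) := by
      intro x hx t
      conv_lhs => rw [show t = 2 + (t - 2) by ring, Real.rpow_add hx, Real.rpow_two]
    have r3 : ∀ t : ℝ, t - 1 - 1 = t - 2 := fun t => by ring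
    have key := bellman_hessian_algebra (K := K) (H := ‖h‖ ^ 2) (L := ‖k‖ ^ 2) (a := a₀) (b := b₀)
      (a₁ := a' 0) (b₁ := b' 0) (A := a₀ ^ (p / 2 - 2)) (B := b₀ ^ (q / 2 - 2))
      (Z := M₀ ^ (α - 2)) (M := M₀) (α := α) hp hq1 hq2 hpq hα0 hα1 ha0 hb0 (by positivity)
      (by positivity) (by positivity) (by positivity) (by positivity) (hcs u h) (hcs v k)
      rfl rfl rfl rfl (by rw [← r2 _ ha0, ← r2 _ hb0]) ?_ ?_ hK
    · rw [r2 _ hM0 α, r1 _ hM0 α, r1 _ ha0 (p / 2), r1 _ hb0 (q / 2), r3, r3, r3]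
      refine key.trans (le_of_eq ?_)
      simp only [hM', ea, eb, r1 _ ha0 (p / 2), r1 _ hb0 (q / 2)]
      ring
    · rw [← r1 _ hM0]
      have hle : a₀ ≤ M₀ ^ (2 / p) := by
        calc a₀ = (a₀ ^ (p / 2)) ^ (2 / p) := by
              rw [← Real.rpow_mul ha0.le]; field_simp; simp
          _ ≤ _ := by
              refine Real.rpow_le_rpow (by positivity) ?_ (by positivity)
              rw [hM₀]; linarith [Real.rpow_pos_of_pos hb0 (q / 2)]
      calc a₀ * M₀ ^ (α - 1) ≤ M₀ ^ (2 / p) * M₀ ^ (α - 1) := by gcongr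
        _ = 1 := by rw [← Real.rpow_add hM0, hα]; ring_nf; simp
    · rw [← r2 _ hM0, ← r1 _ hb0]
      have hq0 : 0 < q := by linarith
      have hαq : α = 2 / q - 1 := by
        have : 2 / p + 2 / q = 2 := by
          field_simp
          linarith
        rw [hα]; linarith
      have hle : b₀ ≤ M₀ ^ (2 / q) := by
        calc b₀ = (b₀ ^ (q / 2)) ^ (2 / q) := by
              rw [← Real.rpow_mul hb0.le]; field_simp; simp
          _ ≤ _ := by
              refine Real.rpow_le_rpow (by positivity) ?_ (by positivity)
              rw [hM₀]; linarith [Real.rpow_pos_of_pos ha0 (p / 2)]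
      calc 1 = (M₀ ^ (2 / q)) ^ (q / 2 - 1) * M₀ ^ α := by
            rw [← Real.rpow_mul hM0.le, ← Real.rpow_add hM0, hαq]
            have : 2 / q * (q / 2 - 1) + (2 / q - 1) = 0 := by field_simp; ring
            rw [this, Real.rpow_zero]
        _ ≤ b₀ ^ (q / 2 - 1) * M₀ ^ α := by
            have := Real.rpow_le_rpow_of_nonpos hb0 hle (show q / 2 - 1 ≤ 0 by linarith)
            gcongr

lemma IsBellman.swap {Q : ℂ × ℂ → ℝ} (hQ : IsBellman Q) :
    IsBellman (fun w => Q (w.2, w.1)) where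
  smooth := hQ.smooth.comp (contDiff_snd.prodMk contDiff_fst)
  zero := hQ.zero
  nonneg _ := hQ.nonneg _
  hess w := by
    obtain ⟨m, hm, h⟩ := hQ.hess (w.2, w.1)
    refine ⟨m⁻¹, inv_pos.2 hm, fun e => ?_⟩
    have hl : ∀ s : ℝ, HasDerivAt (fun s : ℝ => (w.2, w.1) + s • (e.2, e.1)) (e.2, e.1) s :=
      fun s => by simpa using ((hasDerivAt_id s).smul_const (e.2, e.1)).const_add (w.2, w.1)
    have h1 : ∀ s : ℝ, HasDerivAt (fun s : ℝ => Q ((w + s • e).2, (w + s • e).1))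
        (fderiv ℝ Q ((w.2, w.1) + s • (e.2, e.1)) (e.2, e.1)) s := fun s =>
      ((hQ.smooth.differentiable (by simp) _).hasFDerivAt).comp_hasDerivAt s (hl s)
    have h2 : HasDerivAt (fun s : ℝ => fderiv ℝ Q ((w.2, w.1) + s • (e.2, e.1)) (e.2, e.1))
        (fderiv ℝ (fderiv ℝ Q) (w.2, w.1) (e.2, e.1) (e.2, e.1)) 0 := by
      have hQ1 : ContDiff ℝ (⊤ : ℕ∞) (fderiv ℝ Q) := hQ.smooth.fderiv_right (by simp)
      have := ((hQ1.differentiable (by simp)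
        ((w.2, w.1) + (0 : ℝ) • (e.2, e.1))).hasFDerivAt).comp_hasDerivAt 0 (hl 0)
      rw [zero_smul, add_zero] at this
      simpa using this.clm_apply (hasDerivAt_const (0 : ℝ) (e.2, e.1))
    rw [fderiv_fderiv_apply_of_hasDerivAt (Q := fun w : ℂ × ℂ => Q (w.2, w.1))
      (hQ.smooth.comp (contDiff_snd.prodMk contDiff_fst)) h1 h2, inv_inv, add_comm]
    exact h (e.2, e.1)

lemma bellmanAux_zero {p q : ℝ} (hp : 2 ≤ p) (hq1 : 1 < q) : bellmanAux p q 0 0 = 0 := by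
  have h1 : p / 2 ≠ 0 := by positivity
  have h2 : q / 2 ≠ 0 := by positivity
  simp [bellmanAux, Real.zero_rpow h1, Real.zero_rpow h2]

lemma bellmanAux_sq_le {p q : ℝ} (hp : 2 ≤ p) {x y : ℝ} (hx : 0 ≤ x) (hy : 0 ≤ y) :
    bellmanAux p q (x ^ 2) (y ^ 2) ≤ (1 + (5 * p + (q * (q - 1))⁻¹)) * (x ^ p + y ^ q) := by
  have hp0 : 0 < p := by linarith
  have hα : 0 ≤ 1 - 2 / p := by rw [sub_nonneg, div_le_one hp0]; exact hp
  have e : ∀ z r : ℝ, 0 ≤ z → (z ^ 2) ^ (r / 2) = z ^ r := fun z r hz => by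
    rw [← Real.rpow_natCast_mul hz]; congr 1; push_cast; ring
  have hM : 0 ≤ x ^ p + y ^ q := by positivity
  unfold bellmanAux
  rw [e x p hx, e y q hy, add_mul 1, one_mul]
  gcongr
  have h1 : x ^ 2 ≤ (x ^ p + y ^ q) ^ (2 / p) := by
    calc x ^ 2 = (x ^ p) ^ (2 / p) := by
          rw [← Real.rpow_mul hx, mul_div_cancel₀ _ hp0.ne', Real.rpow_two]
      _ ≤ _ := by gcongr; linarith [Real.rpow_nonneg hy q]
  calc x ^ 2 * (x ^ p + y ^ q) ^ (1 - 2 / p)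
      ≤ (x ^ p + y ^ q) ^ (2 / p) * (x ^ p + y ^ q) ^ (1 - 2 / p) := by gcongr
    _ = x ^ p + y ^ q := by
        rw [← Real.rpow_add_of_nonneg hM (by positivity) hα]; simp

lemma IsTest.integrable_norm_rpow {a : ℂ → ℂ} (ha : IsTest a) {p : ℝ} (hp : 0 < p) :
    Integrable (fun x => ‖a x‖ ^ p) := by
  refine Continuous.integrable_of_hasCompactSupport
    (ha.continuous.norm.rpow_const fun _ => Or.inr hp.le) ?_
  exact ha.cpt.norm.comp_left (g := fun x : ℝ => x ^ p) (Real.zero_rpow hp.ne')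

lemma le_of_forall_le_integral_bellman {p q : ℝ} (hp : 2 ≤ p) (hq1 : 1 < q) {a b : ℂ → ℂ}
    (ha : IsTest a) (hb : IsTest b) {c : ℝ}
    (h : ∀ ε > 0, c ≤ 2 * ∫ x, bellman p q ε (a x, b x)) :
    c ≤ 2 * ((1 + (5 * p + (q * (q - 1))⁻¹)) * ((∫ x, ‖a x‖ ^ p) + ∫ x, ‖b x‖ ^ q)) := by
  have hp0 : 0 < p := by linarith
  have hα : 0 ≤ 1 - 2 / p := by rw [sub_nonneg, div_le_one hp0]; exact hp
  have hcont : Continuous fun w : ℝ × ℝ => bellmanAux p q w.1 w.2 := by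
    unfold bellmanAux
    have h1 : Continuous fun w : ℝ × ℝ => w.1 ^ (p / 2) + w.2 ^ (q / 2) :=
      (continuous_fst.rpow_const fun _ => Or.inr (by positivity)).add
        (continuous_snd.rpow_const fun _ => Or.inr (by positivity))
    exact (continuous_fst.mul (h1.rpow_const fun _ => Or.inr hα)).add (continuous_const.mul h1)
  obtain ⟨A, -, hA⟩ := ha.exists_bound
  obtain ⟨B, -, hB⟩ := hb.exists_bound
  have hlim : Filter.Tendsto (fun ε => ∫ x, bellman p q ε (a x, b x)) (𝓝[>] 0)
      (𝓝 (∫ x, bellmanAux p q (‖a x‖ ^ 2) (‖b x‖ ^ 2))) := by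
    refine tendsto_integral_filter_of_dominated_convergence
      ((tsupport a ∪ tsupport b).indicator fun _ => bellmanAux p q (1 + A ^ 2) (1 + B ^ 2))
      ?_ ?_ ?_ ?_
    · filter_upwards [self_mem_nhdsWithin] with ε hε
      exact ((contDiff_bellman hε).continuous.comp
        (ha.continuous.prodMk hb.continuous)).aestronglyMeasurable
    · filter_upwards [Ioo_mem_nhdsGT (zero_lt_one' ℝ)] with ε hε
      refine Filter.Eventually.of_forall fun x => ?_
      have h0 : 0 ≤ bellmanAux p q ε ε := by
        rw [← bellmanAux_zero hp hq1]
        exact bellmanAux_mono hp hq1 le_rfl le_rfl hε.1.le hε.1.le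
      have hnn : 0 ≤ bellman p q ε (a x, b x) :=
        sub_nonneg.2 (bellmanAux_mono hp hq1 hε.1.le hε.1.le (by simp) (by simp))
      rw [Real.norm_of_nonneg hnn]
      by_cases hx : x ∈ tsupport a ∪ tsupport b
      · rw [indicator_of_mem hx]
        have hε0 := hε.1.le
        refine (sub_le_self _ h0).trans (bellmanAux_mono hp hq1 (by positivity) (by positivity) ?_ ?_)
        · have := hA x; have := hε.2.le; dsimp only; gcongr
        · have := hB x; have := hε.2.le; dsimp only; gcongr
      · rw [indicator_of_notMem hx]
        simp only [mem_union, not_or] at hx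
        rw [image_eq_zero_of_notMem_tsupport hx.1, image_eq_zero_of_notMem_tsupport hx.2]
        simp [bellman]
    · refine (integrable_indicator_iff ?_).2 ?_
      · exact ((isClosed_tsupport a).union (isClosed_tsupport b)).measurableSet
      · exact integrableOn_const (ha.cpt.union hb.cpt).measure_lt_top.ne
    · refine Filter.Eventually.of_forall fun x => ?_
      have hc : Continuous fun ε : ℝ => bellman p q ε (a x, b x) :=
        (hcont.comp ((continuous_id.add continuous_const).prodMk
          (continuous_id.add continuous_const))).sub
          (hcont.comp (continuous_id.prodMk continuous_id))
      have := (hc.tendsto 0).mono_left (nhdsWithin_le_nhds (s := Ioi 0))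
      simpa [bellman, bellmanAux_zero hp hq1] using this
  have h1 : c ≤ 2 * ∫ x, bellmanAux p q (‖a x‖ ^ 2) (‖b x‖ ^ 2) :=
    ge_of_tendsto (hlim.const_mul 2) (by filter_upwards [self_mem_nhdsWithin] with ε hε using h ε hε)
  refine h1.trans ?_
  have ia := ha.integrable_norm_rpow hp0
  have ib := hb.integrable_norm_rpow (p := q) (by linarith)
  rw [← integral_add ia ib, ← integral_const_mul (1 + (5 * p + (q * (q - 1))⁻¹))]
  refine mul_le_mul_of_nonneg_left ?_ zero_le_two
  refine integral_mono_of_nonneg (Filter.Eventually.of_forall fun x => ?_)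
    ((ia.add ib).const_mul _) (Filter.Eventually.of_forall fun x => ?_)
  · simp only [Pi.zero_apply]
    rw [← bellmanAux_zero hp hq1]
    exact bellmanAux_mono hp hq1 le_rfl le_rfl (by positivity) (by positivity)
  · exact bellmanAux_sq_le hp (norm_nonneg _) (norm_nonneg _)

lemma exists_re_integral_dirDeriv_mul_le {p q : ℝ} (hp : 1 < p) (hpq : q = p * (q - 1)) :
    ∃ C : ℝ, 0 < C ∧ ∀ f h : ℂ → ℂ, IsTest f → IsTest h →
      (∫ x, dirDeriv I f x * h x).re ≤ C * ((∫ x, ‖crOp f x‖ ^ p) + ∫ x, ‖h x‖ ^ q) := by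
  have hq : 1 < q := by nlinarith
  rcases le_total 2 p with h2 | h2
  · have : 0 < (q * (q - 1))⁻¹ := inv_pos.2 (mul_pos (by linarith) (by linarith))
    refine ⟨2 * (1 + (5 * p + (q * (q - 1))⁻¹)), by positivity, fun f h hf hh => ?_⟩
    rw [mul_assoc]
    exact le_of_forall_le_integral_bellman h2 hq hf.crOp hh fun ε hε =>
      re_integral_dirDeriv_mul_le hf hh (isBellman_bellman h2 hq (by nlinarith) hpq hε)
  · have : 0 < (p * (p - 1))⁻¹ := inv_pos.2 (mul_pos (by linarith) (by linarith))
    refine ⟨2 * (1 + (5 * q + (p * (p - 1))⁻¹)), by positivity, fun f h hf hh => ?_⟩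
    rw [mul_assoc, add_comm (∫ x, ‖crOp f x‖ ^ p)]
    have hq2 : 2 ≤ q := by nlinarith
    exact le_of_forall_le_integral_bellman hq2 hp hh hf.crOp fun ε hε =>
      re_integral_dirDeriv_mul_le hf hh
        (isBellman_bellman hq2 hp h2 (by linarith) hε).swap

lemma exists_re_integral_dirDeriv_mul_le_half {p q : ℝ} (hp : 1 < p) (hpq : q = p * (q - 1)) :
    ∃ C : ℝ, 0 < C ∧ ∀ f h : ℂ → ℂ, IsTest f → IsTest h →
      (∫ x, dirDeriv I f x * h x).re ≤ C * (∫ x, ‖crOp f x‖ ^ p) + 1 / 2 * ∫ x, ‖h x‖ ^ q := by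
  have hq : 1 < q := by nlinarith
  obtain ⟨C, hC, H⟩ := exists_re_integral_dirDeriv_mul_le hp hpq
  set t : ℝ := (2 * C) ^ (1 / q) with ht
  have ht0 : 0 < t := by positivity
  refine ⟨C * t ^ p, by positivity, fun f h hf hh => ?_⟩
  have key := H (fun z => (t : ℂ) * f z) (fun z => ((t⁻¹ : ℝ) : ℂ) * h z) (hf.const_mul t)
    (hh.const_mul _)
  have hcr : ∀ x, crOp (fun z => (t : ℂ) * f z) x = t * crOp f x := fun x => by
    simp only [crOp, dirDeriv_const_mul hf]; ring
  have hmul : ∀ x, dirDeriv I (fun z => (t : ℂ) * f z) x * (((t⁻¹ : ℝ) : ℂ) * h x) =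
      dirDeriv I f x * h x := fun x => by
    have : (t : ℂ) ≠ 0 := by exact_mod_cast ht0.ne'
    simp only [dirDeriv_const_mul hf]
    push_cast
    field_simp
  have hn : ∀ (s r : ℝ) (z : ℂ), 0 < s → ‖(s : ℂ) * z‖ ^ r = s ^ r * ‖z‖ ^ r := fun s r z hs => by
    rw [norm_mul, Complex.norm_real, Real.norm_of_nonneg hs.le,
      Real.mul_rpow hs.le (norm_nonneg _)]
  simp only [hmul, hcr, hn t p _ ht0, hn t⁻¹ q _ (inv_pos.2 ht0), integral_const_mul] at key
  have htq : t⁻¹ ^ q = (2 * C)⁻¹ := by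
    rw [Real.inv_rpow ht0.le, ht, ← Real.rpow_mul (by positivity),
      one_div_mul_cancel (by linarith), Real.rpow_one]
  rw [htq] at key
  refine key.trans (le_of_eq ?_)
  field_simp

lemma tendsto_integral_norm_rpow_mul {F : ℂ → ℂ} (hF : IsTest F) {a b p : ℝ} (ha : 0 < a)
    (hp : 0 < p) (hab : a + 2 * b = p) :
    Filter.Tendsto (fun δ : ℝ => ∫ x, ‖F x‖ ^ a * (δ + ‖F x‖ ^ 2) ^ b) (𝓝[>] 0)
      (𝓝 (∫ x, ‖F x‖ ^ p)) := by
  obtain ⟨M, -, hM⟩ := hF.exists_bound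
  refine tendsto_integral_filter_of_dominated_convergence
    ((tsupport F).indicator fun _ => (1 + M ^ 2) ^ (p / 2)) ?_ ?_ ?_ ?_
  · filter_upwards [self_mem_nhdsWithin] with δ hδ
    have hδ : 0 < δ := hδ
    exact ((hF.continuous.norm.rpow_const fun _ => Or.inr ha.le).mul
      ((continuous_const.add (hF.continuous.norm.pow 2)).rpow_const fun x =>
        Or.inl (add_pos_of_pos_of_nonneg hδ (sq_nonneg _)).ne')).aestronglyMeasurable
  · filter_upwards [Ioo_mem_nhdsGT (zero_lt_one' ℝ)] with δ hδ
    refine Filter.Eventually.of_forall fun x => ?_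
    have hδ0 := hδ.1
    rw [Real.norm_of_nonneg (by positivity)]
    by_cases hx : x ∈ tsupport F
    · rw [indicator_of_mem hx]
      calc ‖F x‖ ^ a * (δ + ‖F x‖ ^ 2) ^ b
          = (‖F x‖ ^ 2) ^ (a / 2) * (δ + ‖F x‖ ^ 2) ^ b := by
            rw [← Real.rpow_natCast_mul (norm_nonneg _)]; congr 2; push_cast; ring
        _ ≤ (δ + ‖F x‖ ^ 2) ^ (a / 2) * (δ + ‖F x‖ ^ 2) ^ b := by gcongr; linarith
        _ = (δ + ‖F x‖ ^ 2) ^ (p / 2) := by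
            rw [← Real.rpow_add (by positivity)]; congr 1; linarith
        _ ≤ _ := by
            have := hM x
            have := hδ.2.le
            gcongr
    · rw [indicator_of_notMem hx, image_eq_zero_of_notMem_tsupport hx]
      simp [Real.zero_rpow ha.ne']
  · exact (integrable_indicator_iff (isClosed_tsupport F).measurableSet).2
      (integrableOn_const hF.cpt.measure_lt_top.ne)
  · refine Filter.Eventually.of_forall fun x => ?_
    by_cases hx : F x = 0
    · simp [hx, Real.zero_rpow ha.ne', Real.zero_rpow hp.ne']
    · have hx0 : 0 < ‖F x‖ := norm_pos_iff.2 hx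
      have hc : ContinuousAt (fun δ : ℝ => ‖F x‖ ^ a * (δ + ‖F x‖ ^ 2) ^ b) 0 :=
        continuousAt_const.mul ((continuousAt_id.add continuousAt_const).rpow_const
          (Or.inl (by simp [hx])))
      have h0 : ‖F x‖ ^ a * ((0 : ℝ) + ‖F x‖ ^ 2) ^ b = ‖F x‖ ^ p := by
        rw [zero_add, ← Real.rpow_natCast_mul (norm_nonneg _), ← Real.rpow_add hx0]
        congr 1
      have := hc.tendsto.mono_left (nhdsWithin_le_nhds (s := Ioi 0))
      rwa [h0] at this

/-- The `L^p` estimate for the Cauchy–Riemann operator on test functions. -/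
lemma exists_integral_norm_dirDeriv_rpow_le {p : ℝ} (hp : 1 < p) :
    ∃ C : ℝ, 0 < C ∧ ∀ f : ℂ → ℂ, IsTest f →
      ∫ x, ‖dirDeriv I f x‖ ^ p ≤ C * ∫ x, ‖crOp f x‖ ^ p := by
  set q := p / (p - 1) with hq
  have hp1 : 0 < p - 1 := by linarith
  have hpq : q = p * (q - 1) := by rw [hq]; field_simp; ring
  have hq0 : 0 < q := by positivity
  obtain ⟨C, hC, H⟩ := exists_re_integral_dirDeriv_mul_le_half hp hpq
  refine ⟨2 * C, by positivity, fun f hf => ?_⟩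
  set F := dirDeriv I f with hFdef
  have hF : IsTest F := hf.dirDeriv I
  have h1 := tendsto_integral_norm_rpow_mul hF (a := 2) (b := (p - 2) / 2) (p := p) (by norm_num)
    (by linarith) (by ring)
  have h2 := tendsto_integral_norm_rpow_mul hF (a := q) (b := q * ((p - 2) / 2)) (p := p) hq0
    (by linarith) (by linarith)
  have h3 := le_of_tendsto_of_tendsto h1
    ((h2.const_mul (1 / 2)).const_add (C * ∫ x, ‖crOp f x‖ ^ p)) ?_
  · linarith
  filter_upwards [self_mem_nhdsWithin] with δ hδ
  have hδ : 0 < δ := hδ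
  set ρ : ℂ → ℝ := fun x => (δ + ‖F x‖ ^ 2) ^ ((p - 2) / 2) with hρ
  have hρ0 : ∀ x, 0 ≤ ρ x := fun x => by simp only [hρ]; positivity
  have hh : IsTest fun x => (starRingEnd ℂ) (F x) * (ρ x : ℂ) := by
    constructor
    · refine (Complex.conjCLE.contDiff.comp hF.smooth).mul (Complex.ofRealCLM.contDiff.comp ?_)
      exact (contDiff_const.add (hF.smooth.norm_sq ℝ)).rpow_const_of_ne fun x => by positivity
    · exact HasCompactSupport.mul_right (hF.cpt.comp_left (map_zero (starRingEnd ℂ)))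
  have key := H f _ hf hh
  have e1 : ∀ x, F x * ((starRingEnd ℂ) (F x) * (ρ x : ℂ)) = ((‖F x‖ ^ (2 : ℝ) * ρ x : ℝ) : ℂ) := by
    intro x
    rw [← mul_assoc, Complex.mul_conj, Complex.normSq_eq_norm_sq, Real.rpow_two]
    push_cast; ring
  have e2 : ∀ x, ‖(starRingEnd ℂ) (F x) * (ρ x : ℂ)‖ ^ q =
      ‖F x‖ ^ q * (δ + ‖F x‖ ^ 2) ^ (q * ((p - 2) / 2)) := by
    intro x
    rw [norm_mul, Complex.norm_real, Real.norm_of_nonneg (hρ0 x), RCLike.norm_conj,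
      Real.mul_rpow (norm_nonneg _) (hρ0 x), mul_comm q, Real.rpow_mul (by positivity)]
  simp only [← hFdef, e1, e2] at key
  rwa [integral_complex_ofReal, Complex.ofReal_re] at key

open scoped Convolution

/-- The mollification of `f` at scale `1 / (j + 1)`. -/
def mollify {E : Type*} [NormedAddCommGroup E] [NormedSpace ℝ E] (j : ℕ) (f : ℂ → E) : ℂ → E :=
  (ContDiffBump.mk (c := (0 : ℂ)) (1 / (j + 1) / 2) (1 / (j + 1)) (by positivity)
    (half_lt_self (by positivity))).normed volume ⋆[ContinuousLinearMap.lsmul ℝ ℝ, volume] f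

section mollify

variable {E : Type*} [NormedAddCommGroup E] [NormedSpace ℝ E]

lemma isTest_mollify {f : ℂ → E} (hf : Continuous f) (hc : HasCompactSupport f) (j : ℕ) :
    IsTest (mollify j f) :=
  ⟨(ContDiffBump.hasCompactSupport_normed _).contDiff_convolution_left _
    (ContDiffBump.contDiff_normed _) hf.locallyIntegrable,
  (ContDiffBump.hasCompactSupport_normed _).convolution _ hc⟩

lemma dirDeriv_mollify {f : ℂ → E} (hf : ContDiff ℝ 1 f) (hc : HasCompactSupport f) (j : ℕ)
    (v : ℂ) : dirDeriv v (mollify j f) = mollify j (dirDeriv v f) := by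
  ext x
  have hl : ∀ φ : ContDiffBump (0 : ℂ), LocallyIntegrable (φ.normed volume) := fun φ =>
    φ.continuous_normed.locallyIntegrable
  unfold dirDeriv mollify
  rw [(hc.hasFDerivAt_convolution_right _ (hl _) hf x).fderiv,
    convolution_precompR_apply _ (hl _) (hc.fderiv ℝ) (hf.continuous_fderiv one_ne_zero)]

variable [CompleteSpace E]

lemma tendsto_mollify {f : ℂ → E} (hf : Continuous f) (x : ℂ) :
    Filter.Tendsto (fun j => mollify j f x) Filter.atTop (𝓝 (f x)) :=
  ContDiffBump.convolution_tendsto_right_of_continuous tendsto_one_div_add_atTop_nhds_zero_nat hf x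

lemma norm_mollify_le {f : ℂ → E} (hf : Continuous f) {M : ℝ} (hM : ∀ x, ‖f x‖ ≤ M) (j : ℕ)
    (x : ℂ) : ‖mollify j f x‖ ≤ 3 * M := by
  have h : dist (mollify j f x) (f x) ≤ 2 * M :=
    ContDiffBump.dist_normed_convolution_le hf.aestronglyMeasurable fun y _ => by
      rw [dist_eq_norm]
      exact (norm_sub_le _ _).trans (by linarith [hM y, hM x])
  rw [dist_eq_norm] at h
  linarith [norm_le_norm_add_norm_sub (f x) (mollify j f x), hM x,
    norm_sub_rev (f x) (mollify j f x)]

lemma mollify_eq_zero {f : ℂ → E} (hf : Continuous f) (j : ℕ) {x : ℂ}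
    (hx : x ∉ cthickening 1 (tsupport f)) : mollify j f x = 0 := by
  have h0 : ∀ y ∈ ball x 1, f y = 0 := fun y hy => by
    by_contra h
    exact hx (mem_cthickening_of_dist_le x y 1 _ (subset_tsupport f h)
      (by rw [dist_comm]; exact (mem_ball.1 hy).le))
  have h : dist (mollify j f x) (f x) ≤ 0 :=
    ContDiffBump.dist_normed_convolution_le hf.aestronglyMeasurable fun y hy => by
      have h1 : (1 : ℝ) / (j + 1) ≤ 1 := by
        rw [div_le_one (by positivity)]; linarith [j.cast_nonneg (α := ℝ)]
      rw [h0 y (ball_subset_ball h1 hy), h0 x (mem_ball_self one_pos), dist_self]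
  rw [dist_le_zero.1 h, h0 x (mem_ball_self one_pos)]

end mollify

lemma tendsto_integral_norm_rpow {E : Type*} [NormedAddCommGroup E] {k : ℕ → ℂ → E}
    {k₀ : ℂ → E} {p M : ℝ} {K : Set ℂ} (hp : 0 < p)
    (hK : IsCompact K) (hk : ∀ j, Continuous (k j)) (hM : ∀ j x, ‖k j x‖ ≤ M)
    (h0 : ∀ j, ∀ x ∉ K, k j x = 0)
    (hlim : ∀ x, Filter.Tendsto (fun j => k j x) Filter.atTop (𝓝 (k₀ x))) :
    Filter.Tendsto (fun j => ∫ x, ‖k j x‖ ^ p) Filter.atTop (𝓝 (∫ x, ‖k₀ x‖ ^ p)) := by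
  refine tendsto_integral_of_dominated_convergence (K.indicator fun _ => M ^ p) ?_ ?_ ?_ ?_
  · exact fun j => ((hk j).norm.rpow_const fun _ => Or.inr hp.le).aestronglyMeasurable
  · exact (integrable_indicator_iff hK.isClosed.measurableSet).2
      (integrableOn_const hK.measure_lt_top.ne)
  · refine fun j => Filter.Eventually.of_forall fun x => ?_
    rw [Real.norm_of_nonneg (by positivity)]
    by_cases hx : x ∈ K
    · rw [indicator_of_mem hx]
      have := hM j x
      gcongr
    · rw [indicator_of_notMem hx, h0 j x hx, norm_zero, Real.zero_rpow hp.ne']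
  · exact Filter.Eventually.of_forall fun x => (hlim x).norm.rpow_const (Or.inr hp.le)

/-- The `L^p` estimate for the Cauchy–Riemann operator on compactly supported `C¹` functions. -/
lemma exists_integral_norm_dirDeriv_rpow_le_of_contDiff {p : ℝ} (hp : 1 < p) :
    ∃ C : ℝ, 0 < C ∧ ∀ f : ℂ → ℂ, ContDiff ℝ 1 f → HasCompactSupport f →
      ∫ x, ‖dirDeriv I f x‖ ^ p ≤ C * ∫ x, ‖crOp f x‖ ^ p := by
  obtain ⟨C, hC, H⟩ := exists_integral_norm_dirDeriv_rpow_le hp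
  refine ⟨C, hC, fun f hf hc => ?_⟩
  have hp0 : 0 < p := by linarith
  have dc : ∀ v, Continuous (dirDeriv v f) := fun v =>
    (hf.continuous_fderiv one_ne_zero).clm_apply continuous_const
  have ds : ∀ v, HasCompactSupport (dirDeriv v f) := fun v => hc.fderiv_apply ℝ v
  have hb : ∀ v, ∃ M, ∀ x, ‖dirDeriv v f x‖ ≤ M := fun v =>
    (ds v).exists_bound_of_continuous (dc v)
  choose M hM using hb
  set K : ℂ → Set ℂ := fun v => cthickening 1 (tsupport (dirDeriv v f))
  have hK : ∀ v, IsCompact (K v) := fun v => (ds v).cthickening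
  have e : ∀ j, crOp (mollify j f) =
      fun x => mollify j (dirDeriv 1 f) x + I * mollify j (dirDeriv I f) x := fun j => by
    ext x
    simp only [crOp, dirDeriv_mollify hf hc]
  have mc : ∀ j v, Continuous (mollify j (dirDeriv v f)) := fun j v =>
    (isTest_mollify (dc v) (ds v) j).continuous
  have l1 := tendsto_integral_norm_rpow (k := fun j => dirDeriv I (mollify j f)) hp0 (hK I)
    (fun j => by rw [dirDeriv_mollify hf hc]; exact mc j I)
    (fun j x => by rw [dirDeriv_mollify hf hc]; exact norm_mollify_le (dc I) (hM I) j x)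
    (fun j x hx => by rw [dirDeriv_mollify hf hc]; exact mollify_eq_zero (dc I) j hx)
    (fun x => by simp only [dirDeriv_mollify hf hc]; exact tendsto_mollify (dc I) x)
  have l2 := tendsto_integral_norm_rpow (k := fun j => crOp (mollify j f)) (k₀ := crOp f)
    (M := 3 * M 1 + 3 * M I) hp0 ((hK 1).union (hK I))
    (fun j => by rw [e]; exact (mc j 1).add (continuous_const.mul (mc j I)))
    (fun j x => by
      rw [e]
      refine (norm_add_le _ _).trans (add_le_add (norm_mollify_le (dc 1) (hM 1) j x) ?_)
      simpa using norm_mollify_le (dc I) (hM I) j x)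
    (fun j x hx => by
      simp only [mem_union, not_or] at hx
      rw [e]
      simp only [mollify_eq_zero (dc 1) j hx.1, mollify_eq_zero (dc I) j hx.2]
      simp)
    (fun x => by
      simp only [e]
      exact (tendsto_mollify (dc 1) x).add ((tendsto_mollify (dc I) x).const_mul I))
  exact le_of_tendsto_of_tendsto' l1 (l2.const_mul C) fun j =>
    H _ (isTest_mollify hf.continuous hc j)

lemma lintegral_enorm_rpow_eq_ofReal {E : Type*} [NormedAddCommGroup E] {f : ℂ → E}
    (hf : Continuous f) (hc : HasCompactSupport f) {p : ℝ} (hp : 0 < p) :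
    ∫⁻ x, ‖f x‖ₑ ^ p = ENNReal.ofReal (∫ x, ‖f x‖ ^ p) := by
  have hi : Integrable fun x => ‖f x‖ ^ p :=
    Continuous.integrable_of_hasCompactSupport (hf.norm.rpow_const fun _ => Or.inr hp.le)
      (hc.norm.comp_left (g := fun x : ℝ => x ^ p) (Real.zero_rpow hp.ne'))
  rw [ofReal_integral_eq_lintegral_ofReal hi (Filter.Eventually.of_forall fun x => by positivity)]
  refine lintegral_congr fun x => ?_
  rw [← ENNReal.ofReal_rpow_of_nonneg (norm_nonneg _) hp.le, ofReal_norm]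

lemma exists_lintegral_enorm_dirDeriv_rpow_le {p : ℝ} (hp : 1 < p) :
    ∃ C : ℝ≥0∞, C ≠ ⊤ ∧ ∀ f : ℂ → ℂ, ContDiff ℝ 1 f → HasCompactSupport f →
      ∫⁻ x, ‖dirDeriv I f x‖ₑ ^ p ≤ C * ∫⁻ x, ‖crOp f x‖ₑ ^ p := by
  obtain ⟨C, hC, H⟩ := exists_integral_norm_dirDeriv_rpow_le_of_contDiff hp
  refine ⟨ENNReal.ofReal C, ENNReal.ofReal_ne_top, fun f hf hc => ?_⟩
  have hp0 : 0 < p := by linarith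
  have dc : ∀ v, Continuous (dirDeriv v f) := fun v =>
    (hf.continuous_fderiv one_ne_zero).clm_apply continuous_const
  have ds : ∀ v, HasCompactSupport (dirDeriv v f) := fun v => hc.fderiv_apply ℝ v
  rw [lintegral_enorm_rpow_eq_ofReal (dc I) (ds I) hp0,
    lintegral_enorm_rpow_eq_ofReal (f := crOp f) ((dc 1).add (continuous_const.mul (dc I)))
      ((ds 1).add (ds I).mul_left) hp0, ← ENNReal.ofReal_mul hC.le]
  exact ENNReal.ofReal_le_ofReal (H f hf hc)

lemma enorm_rpow_le_sum {n : ℕ} (w : EV n) {p : ℝ} (hp : 1 ≤ p) :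
    ‖w‖ₑ ^ p ≤ (2 * n : ℕ) ^ (p - 1) * ∑ i, ‖w i‖ₑ ^ p := by
  have h : ‖w‖ₑ ≤ ∑ i, ‖w i‖ₑ := by
    have h1 := (EuclideanSpace.basisFun (Fin (2 * n)) ℝ).sum_repr w
    calc ‖w‖ₑ = ‖∑ i, (EuclideanSpace.basisFun (Fin (2 * n)) ℝ).repr w i •
          EuclideanSpace.basisFun (Fin (2 * n)) ℝ i‖ₑ := by rw [h1]
      _ ≤ ∑ i, ‖(EuclideanSpace.basisFun (Fin (2 * n)) ℝ).repr w i •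
          EuclideanSpace.basisFun (Fin (2 * n)) ℝ i‖ₑ := enorm_sum_le _ _
      _ = _ := by
          refine Finset.sum_congr rfl fun i _ => ?_
          rw [enorm_smul]
          simp [enorm_eq_nnnorm]
  calc ‖w‖ₑ ^ p ≤ (∑ i, ‖w i‖ₑ) ^ p := by gcongr
    _ ≤ _ := by
        simpa using ENNReal.rpow_sum_le_const_mul_sum_rpow Finset.univ (fun i => ‖w i‖ₑ) hp

/-- The `L^p` estimate for the Cauchy–Riemann operator of a constant complex structure. -/
lemma exists_lintegral_enorm_pdt_rpow_le (n : ℕ) {p : ℝ} (hp : 1 < p) (c₀ : ℝ) :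
    ∃ C : ℝ≥0∞, C ≠ ⊤ ∧ ∀ (J : EV n →L[ℝ] EV n) (v : ℂ → EV n), J * J = -1 → ‖J‖ ≤ c₀ →
      ContDiff ℝ 1 v → HasCompactSupport v →
      ∫⁻ x, ‖pdt v x‖ₑ ^ p ≤ C * ∫⁻ x, ‖pds v x + J (pdt v x)‖ₑ ^ p := by
  obtain ⟨C, hC, H⟩ := exists_lintegral_enorm_dirDeriv_rpow_le hp
  have hp0 : 0 < p := by linarith
  refine ⟨(2 * n : ℕ) ^ (p - 1) * ((2 * n : ℕ) * (C * ENNReal.ofReal (1 + c₀) ^ p)), ?_,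
    fun J v hJ hJc hv hc => ?_⟩
  · refine ENNReal.mul_ne_top (ENNReal.rpow_ne_top_of_nonneg (by linarith) (ENNReal.natCast_ne_top _))
      (ENNReal.mul_ne_top (ENNReal.natCast_ne_top _) (ENNReal.mul_ne_top hC
        (ENNReal.rpow_ne_top_of_nonneg hp0.le ENNReal.ofReal_ne_top)))
  have hJJ : ∀ w, J (J w) = -w := fun w => by
    have := congrArg (fun L : EV n →L[ℝ] EV n => L w) hJ
    simpa using this
  set Λ : Fin (2 * n) → EV n →L[ℝ] ℂ := fun i =>
    Complex.ofRealCLM.comp (EuclideanSpace.proj i) -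
      I • (Complex.ofRealCLM.comp ((EuclideanSpace.proj i).comp J)) with hΛ
  have hΛa : ∀ i w, Λ i w = (w i : ℂ) - I * (J w i : ℂ) := fun i w => by simp [hΛ]
  have hΛJ : ∀ i w, Λ i (J w) = I * Λ i w := fun i w => by
    rw [hΛa, hΛa, hJJ, mul_sub, ← mul_assoc, I_mul_I]
    simp
    ring
  have hlow : ∀ i w, ‖w i‖ₑ ≤ ‖Λ i w‖ₑ := fun i w => by
    rw [← ofReal_norm, ← ofReal_norm]
    refine ENNReal.ofReal_le_ofReal ?_
    have := Complex.abs_re_le_norm (Λ i w)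
    rw [hΛa] at this ⊢
    simpa using this
  have hup : ∀ i w, ‖Λ i w‖ₑ ≤ ENNReal.ofReal (1 + c₀) * ‖w‖ₑ := fun i w => by
    have h0 : 0 ≤ 1 + c₀ := by linarith [norm_nonneg J]
    rw [← ofReal_norm, ← ofReal_norm, ← ENNReal.ofReal_mul h0]
    refine ENNReal.ofReal_le_ofReal ?_
    rw [hΛa]
    have h1 : ‖w i‖ ≤ ‖w‖ := PiLp.norm_apply_le w i
    have h2 : ‖J w i‖ ≤ c₀ * ‖w‖ := (PiLp.norm_apply_le (J w) i).trans (J.le_of_opNorm_le hJc w)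
    refine (norm_sub_le _ _).trans ?_
    rw [norm_mul, Complex.norm_I, one_mul, Complex.norm_real, Complex.norm_real]
    linarith
  have hd : ∀ i e x, dirDeriv e (fun z => Λ i (v z)) x = Λ i (fderiv ℝ v x e) := fun i e x =>
    congrArg (fun L : ℂ →L[ℝ] ℂ => L e)
      ((Λ i).hasFDerivAt.comp x (hv.differentiable one_ne_zero x).hasFDerivAt).fderiv
  have key : ∀ i, ∫⁻ x, ‖pdt v x i‖ₑ ^ p ≤
      C * ENNReal.ofReal (1 + c₀) ^ p * ∫⁻ x, ‖pds v x + J (pdt v x)‖ₑ ^ p := fun i => by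
    have h := H (fun z => Λ i (v z)) ((Λ i).contDiff.comp hv)
      (hc.comp_left (g := Λ i) (map_zero _))
    calc ∫⁻ x, ‖pdt v x i‖ₑ ^ p ≤ ∫⁻ x, ‖dirDeriv I (fun z => Λ i (v z)) x‖ₑ ^ p := by
          refine lintegral_mono fun x => ?_
          rw [hd]
          exact ENNReal.rpow_le_rpow (hlow i _) hp0.le
      _ ≤ _ := h
      _ ≤ C * ∫⁻ x, ENNReal.ofReal (1 + c₀) ^ p * ‖pds v x + J (pdt v x)‖ₑ ^ p := by
          gcongr with x
          rw [← ENNReal.mul_rpow_of_nonneg _ _ hp0.le]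
          refine ENNReal.rpow_le_rpow ?_ hp0.le
          have : crOp (fun z => Λ i (v z)) x = Λ i (pds v x + J (pdt v x)) := by
            rw [crOp, hd, hd, map_add, hΛJ]; rfl
          rw [this]
          exact hup i _
      _ = _ := by
          rw [lintegral_const_mul' _ _
            (ENNReal.rpow_ne_top_of_nonneg hp0.le ENNReal.ofReal_ne_top), mul_assoc]
  have hm : ∀ i, Measurable fun x => ‖pdt v x i‖ₑ ^ p := fun i => by
    have : Continuous fun x => pdt v x i :=
      (EuclideanSpace.proj (𝕜 := ℝ) i).continuous.comp
        ((hv.continuous_fderiv one_ne_zero).clm_apply continuous_const)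
    exact this.measurable.enorm.pow_const p
  calc ∫⁻ x, ‖pdt v x‖ₑ ^ p ≤ ∫⁻ x, (2 * n : ℕ) ^ (p - 1) * ∑ i, ‖pdt v x i‖ₑ ^ p :=
        lintegral_mono fun x => enorm_rpow_le_sum _ hp.le
    _ = (2 * n : ℕ) ^ (p - 1) * ∑ i, ∫⁻ x, ‖pdt v x i‖ₑ ^ p := by
        rw [lintegral_const_mul' _ _ (ENNReal.rpow_ne_top_of_nonneg (by linarith) (ENNReal.natCast_ne_top _)),
          lintegral_finsetSum _ fun i _ => hm i]
    _ ≤ (2 * n : ℕ) ^ (p - 1) * ∑ _i : Fin (2 * n), C * ENNReal.ofReal (1 + c₀) ^ p *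
          ∫⁻ x, ‖pds v x + J (pdt v x)‖ₑ ^ p := by gcongr with i; exact key i
    _ = _ := by
        rw [Finset.sum_const, Finset.card_univ, Fintype.card_fin, nsmul_eq_mul]
        ring

lemma ENNReal.add_add_rpow_le {p : ℝ} (hp : 1 ≤ p) (x y z : ℝ≥0∞) :
    (x + y + z) ^ p ≤ 3 ^ (p - 1) * (x ^ p + y ^ p + z ^ p) := by
  simpa [Fin.sum_univ_three] using
    ENNReal.rpow_sum_le_const_mul_sum_rpow Finset.univ ![x, y, z] hp

lemma ENNReal.le_two_mul_of_le_add_half {X Y : ℝ≥0∞} (hX : X ≠ ⊤) (h : X ≤ Y + 2⁻¹ * X) :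
    X ≤ 2 * Y := by
  have h2 : (2 : ℝ≥0∞)⁻¹ * X + 2⁻¹ * X = X := by
    rw [← add_mul, ENNReal.inv_two_add_inv_two, one_mul]
  have h3 : (2 : ℝ≥0∞)⁻¹ * X ≤ Y :=
    (ENNReal.add_le_add_iff_right (ENNReal.mul_ne_top (by simp) hX)).1 (h2.le.trans h)
  calc X = 2⁻¹ * X + 2⁻¹ * X := h2.symm
    _ ≤ Y + Y := add_le_add h3 h3
    _ = 2 * Y := (two_mul Y).symm

section cutoff

variable {E : Type*} [NormedAddCommGroup E] [NormedSpace ℝ E] {U : Set ℂ} {u : ℂ → E} {z : ℂ}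

lemma ContDiffBump.eventually_eq_zero (χ : ContDiffBump z) {x : ℂ}
    (hx : x ∉ closedBall z χ.rOut) : ∀ᶠ y in 𝓝 x, χ y = 0 := by
  filter_upwards [isClosed_closedBall.isOpen_compl.mem_nhds hx] with y hy
  exact χ.zero_of_le_dist (not_le.1 fun h => hy (mem_closedBall.2 h)).le

lemma ContDiffBump.fderiv_smul_eq_zero (χ : ContDiffBump z) {x : ℂ}
    (hx : x ∉ closedBall z χ.rOut) : fderiv ℝ (fun y => χ y • u y) x = 0 := by
  have h : (fun y => χ y • u y) =ᶠ[𝓝 x] fun _ => 0 :=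
    (χ.eventually_eq_zero hx).mono fun y hy => by simp only [hy, zero_smul]
  rw [h.fderiv_eq, fderiv_fun_const]
  rfl

lemma ContDiffBump.contDiff_smul (χ : ContDiffBump z) (hU : IsOpen U) (hu : ContDiffOn ℝ 1 u U)
    (hχ : closedBall z χ.rOut ⊆ U) : ContDiff ℝ 1 fun y => χ y • u y := by
  refine contDiff_iff_contDiffAt.2 fun x => ?_
  by_cases hx : x ∈ closedBall z χ.rOut
  · exact χ.contDiffAt.smul (hu.contDiffAt (hU.mem_nhds (hχ hx)))
  · have h : (fun y => χ y • u y) =ᶠ[𝓝 x] fun _ => 0 :=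
      (χ.eventually_eq_zero hx).mono fun y hy => by simp only [hy, zero_smul]
    exact contDiffAt_const.congr_of_eventuallyEq h

lemma ContDiffBump.fderiv_smul_apply (χ : ContDiffBump z) (hU : IsOpen U)
    (hu : ContDiffOn ℝ 1 u U) {x : ℂ} (hx : x ∈ U) (e : ℂ) :
    fderiv ℝ (fun y => χ y • u y) x e = χ x • fderiv ℝ u x e + fderiv ℝ χ x e • u x := by
  have h1 := (hu.differentiableOn one_ne_zero).differentiableAt (hU.mem_nhds hx)
  have h2 : DifferentiableAt ℝ χ x := (χ.contDiffAt (n := 1)).differentiableAt one_ne_zero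
  exact congrArg (fun L : ℂ →L[ℝ] E => L e) (h2.hasFDerivAt.smul h1.hasFDerivAt).fderiv

lemma ContDiffBump.hasCompactSupport_smul (χ : ContDiffBump z) :
    HasCompactSupport fun y => χ y • u y :=
  HasCompactSupport.smul_right χ.hasCompactSupport

end cutoff

lemma enorm_cutoff_le {n : ℕ} {U : Set ℂ} (hU : IsOpen U) {u : ℂ → EV n}
    (hu : ContDiffOn ℝ 1 u U) {J : ℂ → EV n →L[ℝ] EV n} {c₀ : ℝ} (hc₀ : 0 < c₀)
    (hJ : ∀ x ∈ U, ‖J x‖ ≤ c₀) (hL : LipschitzOnWith (Real.toNNReal c₀) J U) {z : ℂ}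
    (χ : ContDiffBump z) (hχ : closedBall z χ.rOut ⊆ U) {B : ℝ} (hB : ∀ x, ‖fderiv ℝ χ x‖ ≤ B)
    {x : ℂ} (hx : x ∈ U) :
    ‖pds (fun y => χ y • u y) x + J z (pdt (fun y => χ y • u y) x)‖ₑ ≤
      ‖pds u x + J x (pdt u x)‖ₑ + ENNReal.ofReal (B * (1 + c₀)) * ‖u x‖ₑ +
        ENNReal.ofReal (c₀ * χ.rOut) * ‖pdt (fun y => χ y • u y) x‖ₑ := by
  have hz : z ∈ U := hχ (mem_closedBall_self χ.rOut_pos.le)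
  have hB0 : 0 ≤ B := (norm_nonneg _).trans (hB x)
  by_cases hxb : x ∈ closedBall z χ.rOut
  swap
  · simp [pds, pdt, χ.fderiv_smul_eq_zero hxb]
  have hr := χ.rOut_pos
  simp only [← ofReal_norm]
  rw [← ENNReal.ofReal_mul (by positivity), ← ENNReal.ofReal_mul (by positivity),
    ← ENNReal.ofReal_add (by positivity) (by positivity),
    ← ENNReal.ofReal_add (by positivity) (by positivity)]
  refine ENNReal.ofReal_le_ofReal ?_
  set w := pdt (fun y => χ y • u y) x with hw
  have hws : pds (fun y => χ y • u y) x = χ x • pds u x + fderiv ℝ χ x 1 • u x :=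
    χ.fderiv_smul_apply hU hu hx 1
  have hwt : w = χ x • pdt u x + fderiv ℝ χ x I • u x := χ.fderiv_smul_apply hU hu hx I
  have e : pds (fun y => χ y • u y) x + J z w = χ x • (pds u x + J x (pdt u x)) +
      (fderiv ℝ χ x 1 • u x + fderiv ℝ χ x I • J x (u x)) + (J z - J x) w := by
    have h1 : J x w = χ x • J x (pdt u x) + fderiv ℝ χ x I • J x (u x) := by
      rw [hwt, map_add, map_smul, map_smul]
    rw [_root_.sub_apply, h1, hws, smul_add]
    abel
  rw [e]
  have hd : ∀ v : ℂ, ‖v‖ = 1 → ‖fderiv ℝ χ x v‖ ≤ B := fun v hv => by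
    simpa [hv] using (fderiv ℝ χ x).le_of_opNorm_le (hB x) v
  have b1 : ‖χ x • (pds u x + J x (pdt u x))‖ ≤ ‖pds u x + J x (pdt u x)‖ := by
    rw [norm_smul, Real.norm_of_nonneg χ.nonneg]
    exact mul_le_of_le_one_left (norm_nonneg _) χ.le_one
  have b2 : ‖fderiv ℝ χ x 1 • u x + fderiv ℝ χ x I • J x (u x)‖ ≤ B * (1 + c₀) * ‖u x‖ := by
    have h3 : ‖J x (u x)‖ ≤ c₀ * ‖u x‖ := (J x).le_of_opNorm_le (hJ x hx) _
    calc _ ≤ ‖fderiv ℝ χ x 1 • u x‖ + ‖fderiv ℝ χ x I • J x (u x)‖ := norm_add_le _ _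
      _ = ‖fderiv ℝ χ x 1‖ * ‖u x‖ + ‖fderiv ℝ χ x I‖ * ‖J x (u x)‖ := by
          rw [norm_smul, norm_smul]
      _ ≤ B * ‖u x‖ + B * (c₀ * ‖u x‖) := by
          gcongr
          · exact hd 1 (by simp)
          · exact hd I (by simp)
      _ = _ := by ring
  have b3 : ‖(J z - J x) w‖ ≤ c₀ * χ.rOut * ‖w‖ := by
    refine ContinuousLinearMap.le_of_opNorm_le _ ?_ w
    have h4 := hL.dist_le_mul z hz x hx
    rw [Real.coe_toNNReal _ hc₀.le, dist_eq_norm, dist_comm] at h4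
    exact h4.trans (mul_le_mul_of_nonneg_left (mem_closedBall.1 hxb) hc₀.le)
  exact (norm_add₃_le).trans (by linarith)

/-- The interior estimate for `∂ₜ u` on a small disc. -/
lemma eventually_exists_setLIntegral_pdt_le (n : ℕ) {p : ℝ} (hp : 1 < p) {c₀ : ℝ} (hc₀ : 0 < c₀) :
    ∀ᶠ r in 𝓝[>] (0 : ℝ), ∀ z : ℂ, ∃ D : ℝ≥0∞, D ≠ ⊤ ∧ ∀ (U : Set ℂ)
      (J : ℂ → EV n →L[ℝ] EV n) (u : ℂ → EV n), IsOpen U → closedBall z r ⊆ U →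
      (∀ x ∈ U, J x * J x = -1) → (∀ x ∈ U, ‖J x‖ ≤ c₀) →
      LipschitzOnWith (Real.toNNReal c₀) J U → ContDiffOn ℝ 1 u U →
      ∫⁻ x in ball z (r / 2), ‖pdt u x‖ₑ ^ p ≤
        D * ((∫⁻ x in U, ‖pds u x + J x (pdt u x)‖ₑ ^ p) + ∫⁻ x in U, ‖u x‖ₑ ^ p) := by
  have hp0 : 0 < p := by linarith
  obtain ⟨C, hC, H⟩ := exists_lintegral_enorm_pdt_rpow_le n hp c₀
  set K : ℝ≥0∞ := C * 3 ^ (p - 1) with hK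
  have hKt : K ≠ ⊤ := ENNReal.mul_ne_top hC
    (ENNReal.rpow_ne_top_of_nonneg (by linarith) (by simp))
  have hcont : Continuous fun r : ℝ => K * ENNReal.ofReal (c₀ * r) ^ p :=
    (ENNReal.continuous_const_mul hKt).comp (ENNReal.continuous_rpow_const.comp
      (ENNReal.continuous_ofReal.comp (continuous_const.mul continuous_id)))
  have hsmall : ∀ᶠ r in 𝓝[>] (0 : ℝ), K * ENNReal.ofReal (c₀ * r) ^ p < 2⁻¹ := by
    refine ((hcont.tendsto 0).mono_left nhdsWithin_le_nhds).eventually_lt_const ?_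
    simp [ENNReal.zero_rpow_of_pos hp0]
  filter_upwards [hsmall, self_mem_nhdsWithin] with r hr hr0 z
  have hr0 : 0 < r := hr0
  set χ : ContDiffBump z := ⟨r / 2, r, half_pos hr0, half_lt_self hr0⟩ with hχdef
  obtain ⟨B, hB⟩ := (χ.hasCompactSupport.fderiv ℝ).exists_bound_of_continuous
    ((χ.contDiff (n := 1)).continuous_fderiv one_ne_zero)
  set β : ℝ≥0∞ := ENNReal.ofReal (B * (1 + c₀)) ^ p with hβ
  have hβt : β ≠ ⊤ := ENNReal.rpow_ne_top_of_nonneg hp0.le ENNReal.ofReal_ne_top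
  refine ⟨2 * (K * (1 + β)), ENNReal.mul_ne_top (by simp) (ENNReal.mul_ne_top hKt
    (ENNReal.add_ne_top.2 ⟨by simp, hβt⟩)), fun U J u hU hzU hJJ hJ hL hu => ?_⟩
  set v : ℂ → EV n := fun y => χ y • u y with hv
  have hvc : ContDiff ℝ 1 v := χ.contDiff_smul hU hu hzU
  have hvs : HasCompactSupport v := χ.hasCompactSupport_smul
  set X := ∫⁻ x, ‖pdt v x‖ₑ ^ p with hX
  set A := ∫⁻ x in U, ‖pds u x + J x (pdt u x)‖ₑ ^ p with hA
  set Y := ∫⁻ x in U, ‖u x‖ₑ ^ p with hY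
  have hXt : X ≠ ⊤ := by
    rw [hX, lintegral_enorm_rpow_eq_ofReal (f := pdt v)
      ((hvc.continuous_fderiv one_ne_zero).clm_apply continuous_const)
      (hvs.fderiv_apply ℝ I) hp0]
    exact ENNReal.ofReal_ne_top
  have hsupp : ∫⁻ x, ‖pds v x + J z (pdt v x)‖ₑ ^ p =
      ∫⁻ x in U, ‖pds v x + J z (pdt v x)‖ₑ ^ p := by
    rw [← lintegral_indicator hU.measurableSet]
    refine lintegral_congr fun x => ?_
    by_cases hx : x ∈ U
    · rw [indicator_of_mem hx]
    · have : fderiv ℝ v x = 0 := χ.fderiv_smul_eq_zero fun h => hx (hzU h)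
      rw [indicator_of_notMem hx]
      simp [pds, pdt, this, hp0]
  have hum : AEMeasurable (fun x => β * ‖u x‖ₑ ^ p) (volume.restrict U) :=
    ((hu.continuousOn.aemeasurable hU.measurableSet).enorm.pow_const p).const_mul β
  have hvm : Measurable fun x => ENNReal.ofReal (c₀ * r) ^ p * ‖pdt v x‖ₑ ^ p :=
    ((measurable_fderiv_apply_const ℝ v I).enorm.pow_const p).const_mul _
  have hmain : X ≤ K * (1 + β) * (A + Y) + 2⁻¹ * X := by
    calc X ≤ C * ∫⁻ x in U, ‖pds v x + J z (pdt v x)‖ₑ ^ p := by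
          rw [← hsupp]
          have hz : z ∈ U := hzU (mem_closedBall_self hr0.le)
          exact H (J z) v (hJJ z hz) (hJ z hz) hvc hvs
      _ ≤ C * ∫⁻ x in U, 3 ^ (p - 1) * (‖pds u x + J x (pdt u x)‖ₑ ^ p + β * ‖u x‖ₑ ^ p +
            ENNReal.ofReal (c₀ * r) ^ p * ‖pdt v x‖ₑ ^ p) := by
          gcongr 1
          refine setLIntegral_mono' hU.measurableSet fun x hx => ?_
          rw [hβ, ← ENNReal.mul_rpow_of_nonneg _ _ hp0.le, ← ENNReal.mul_rpow_of_nonneg _ _ hp0.le]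
          exact (ENNReal.rpow_le_rpow (enorm_cutoff_le hU hu hc₀ hJ hL χ hzU hB hx) hp0.le).trans
            (ENNReal.add_add_rpow_le hp.le _ _ _)
      _ = K * (A + β * Y + ENNReal.ofReal (c₀ * r) ^ p * ∫⁻ x in U, ‖pdt v x‖ₑ ^ p) := by
          rw [lintegral_const_mul' _ _ (ENNReal.rpow_ne_top_of_nonneg (by linarith) (by simp)),
            lintegral_add_right _ hvm, lintegral_add_right' _ hum, lintegral_const_mul' _ _ hβt,
            lintegral_const_mul' _ _ (ENNReal.rpow_ne_top_of_nonneg hp0.le ENNReal.ofReal_ne_top),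
            ← mul_assoc]
      _ ≤ K * (A + β * Y + ENNReal.ofReal (c₀ * r) ^ p * X) := by
          gcongr; exact setLIntegral_le_lintegral _ _
      _ = K * (A + β * Y) + K * ENNReal.ofReal (c₀ * r) ^ p * X := by ring
      _ ≤ K * ((1 + β) * A + (1 + β) * Y) + 2⁻¹ * X := by
          gcongr
          · exact le_mul_of_one_le_left zero_le le_self_add
          · exact le_add_self
      _ = _ := by ring
  have hfin := ENNReal.le_two_mul_of_le_add_half hXt hmain
  calc ∫⁻ x in ball z (r / 2), ‖pdt u x‖ₑ ^ p = ∫⁻ x in ball z (r / 2), ‖pdt v x‖ₑ ^ p := by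
        refine setLIntegral_congr_fun measurableSet_ball fun x hx => ?_
        have h1 : v =ᶠ[𝓝 x] u := by
          filter_upwards [isOpen_ball.mem_nhds hx] with y hy
          have : χ y = 1 := χ.one_of_mem_closedBall (ball_subset_closedBall hy)
          simp only [hv, this, one_smul]
        simp only [pdt, h1.fderiv_eq]
    _ ≤ X := setLIntegral_le_lintegral _ _
    _ ≤ _ := by rw [mul_assoc]; exact hfin

lemma setLIntegral_ofReal_norm_rpow {E : Type*} [NormedAddCommGroup E] (f : ℂ → E) (s : Set ℂ)
    {p : ℝ} (hp : 0 ≤ p) :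
    ∫⁻ x in s, ENNReal.ofReal (‖f x‖ ^ p) = ∫⁻ x in s, ‖f x‖ₑ ^ p :=
  lintegral_congr fun x => by
    rw [← ENNReal.ofReal_rpow_of_nonneg (norm_nonneg _) hp, ofReal_norm]

/-- The interior estimate for `∂ₜ u`. -/
lemma exists_setLIntegral_pdt_le (n : ℕ) {U' U : Set ℂ} (hU : IsOpen U)
    (hU'b : Bornology.IsBounded U') (hsub : closure U' ⊆ U) {p : ℝ} (hp : 1 < p) {c₀ : ℝ}
    (hc₀ : 0 < c₀) :
    ∃ S : ℝ≥0∞, S ≠ ⊤ ∧ ∀ (J : ℂ → EV n →L[ℝ] EV n) (u : ℂ → EV n),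
      (∀ x ∈ U, J x * J x = -1) → (∀ x ∈ U, ‖J x‖ ≤ c₀) →
      LipschitzOnWith (Real.toNNReal c₀) J U → ContDiffOn ℝ 1 u U →
      ∫⁻ x in U', ‖pdt u x‖ₑ ^ p ≤
        S * ((∫⁻ x in U, ‖pds u x + J x (pdt u x)‖ₑ ^ p) + ∫⁻ x in U, ‖u x‖ₑ ^ p) := by
  have hK : IsCompact (closure U') := hU'b.isCompact_closure
  obtain ⟨δ, hδ, hδU⟩ := hK.exists_cthickening_subset_open hU hsub
  obtain ⟨r, hr, hrpos, hrδ⟩ := ((eventually_exists_setLIntegral_pdt_le n hp hc₀).and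
    (Ioo_mem_nhdsGT hδ)).exists
  choose D hD H using hr
  obtain ⟨t, ht, htU⟩ := hK.elim_nhds_subcover (fun z => ball z (r / 2))
    fun z _ => ball_mem_nhds z (half_pos hrpos)
  refine ⟨∑ z : t, D z, ENNReal.sum_ne_top.2 fun z _ => hD z, fun J u hJJ hJ hL hu => ?_⟩
  have hcov : U' ⊆ ⋃ z : t, ball (z : ℂ) (r / 2) := by
    rw [iUnion_subtype]
    exact subset_closure.trans htU
  calc ∫⁻ x in U', ‖pdt u x‖ₑ ^ p ≤ ∫⁻ x in ⋃ z : t, ball (z : ℂ) (r / 2), ‖pdt u x‖ₑ ^ p :=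
        lintegral_mono_set hcov
    _ ≤ ∑' z : t, ∫⁻ x in ball (z : ℂ) (r / 2), ‖pdt u x‖ₑ ^ p := lintegral_iUnion_le _ _
    _ = ∑ z : t, ∫⁻ x in ball (z : ℂ) (r / 2), ‖pdt u x‖ₑ ^ p := tsum_fintype _
    _ ≤ ∑ z : t, D z * ((∫⁻ x in U, ‖pds u x + J x (pdt u x)‖ₑ ^ p) + ∫⁻ x in U, ‖u x‖ₑ ^ p) := by
        refine Finset.sum_le_sum fun z _ => H z U J u hU ?_ hJJ hJ hL hu
        refine Subset.trans ?_ hδU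
        exact (closedBall_subset_closedBall hrδ.le).trans
          (closedBall_subset_cthickening (ht z z.2) δ)
    _ = _ := (Finset.sum_mul _ _ _).symm

lemma ofReal_norm_rpow_add_sqrt_rpow_le {n : ℕ} {c₀ p : ℝ} (hc₀ : 0 < c₀) (hp : 1 < p)
    {J : EV n →L[ℝ] EV n} (hJ : ‖J‖ ≤ c₀) (w a b : EV n) :
    ENNReal.ofReal (‖w‖ ^ p + Real.sqrt (‖a‖ ^ 2 + ‖b‖ ^ 2) ^ p) ≤
      2 ^ (p - 1) * (‖a + J b‖ₑ ^ p + ENNReal.ofReal (1 + c₀) ^ p * ‖b‖ₑ ^ p) + ‖w‖ₑ ^ p := by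
  have hp0 : 0 < p := by linarith
  rw [ENNReal.ofReal_add (by positivity) (by positivity), add_comm,
    ← ENNReal.ofReal_rpow_of_nonneg (norm_nonneg _) hp0.le, ofReal_norm,
    ← ENNReal.ofReal_rpow_of_nonneg (Real.sqrt_nonneg _) hp0.le,
    ← ENNReal.mul_rpow_of_nonneg _ _ hp0.le]
  gcongr
  refine le_trans (ENNReal.rpow_le_rpow ?_ hp0.le)
    (ENNReal.rpow_add_le_mul_rpow_add_rpow _ _ hp.le)
  rw [← ofReal_norm, ← ofReal_norm, ← ENNReal.ofReal_mul (by positivity),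
    ← ENNReal.ofReal_add (by positivity) (by positivity)]
  refine ENNReal.ofReal_le_ofReal ?_
  have h1 : Real.sqrt (‖a‖ ^ 2 + ‖b‖ ^ 2) ≤ ‖a‖ + ‖b‖ := by
    rw [Real.sqrt_le_left (by positivity)]
    nlinarith [norm_nonneg a, norm_nonneg b]
  have h2 : ‖J b‖ ≤ c₀ * ‖b‖ := J.le_of_opNorm_le hJ b
  have h3 : ‖a‖ ≤ ‖a + J b‖ + ‖J b‖ := by simpa using norm_sub_le (a + J b) (J b)
  linarith

/-- **Elliptic bootstrapping, weak form**: a `W^{1,p}(U')` estimate for the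
`J`-Cauchy–Riemann operator, for Lipschitz `J` with `J² = -Id` and
`‖J‖_{W^{1,∞}(U)} ≤ c₀`. -/
theorem elliptic_bootstrapping_weak (n : ℕ) (U' U : Set ℂ)
    (hU' : IsOpen U') (hU : IsOpen U)
    (hU'b : Bornology.IsBounded U') (hUb : Bornology.IsBounded U)
    (hsub : closure U' ⊆ U) (p : ℝ) (hp : 1 < p) :
    ∀ c₀ > (0 : ℝ), ∃ c > (0 : ℝ),
      ∀ (J : ℂ → (EV n →L[ℝ] EV n)) (u : ℂ → EV n),
        (∀ z ∈ U, J z * J z = -1) →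
        (∀ z ∈ U, ‖J z‖ ≤ c₀) →
        LipschitzOnWith (Real.toNNReal c₀) J U →
        ContDiffOn ℝ 1 u U →
        (∫⁻ z in U', ENNReal.ofReal
            (‖u z‖ ^ p + (Real.sqrt (‖pds u z‖ ^ 2 + ‖pdt u z‖ ^ 2)) ^ p)) ^ (1 / p)
          ≤ ENNReal.ofReal c *
            ((∫⁻ z in U, ENNReal.ofReal (‖pds u z + (J z) (pdt u z)‖ ^ p)) ^ (1 / p)
              + (∫⁻ z in U, ENNReal.ofReal (‖u z‖ ^ p)) ^ (1 / p)) := by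
  intro c₀ hc₀
  have hp0 : 0 < p := by linarith
  obtain ⟨S, hS, H⟩ := exists_setLIntegral_pdt_le n hU hU'b hsub hp hc₀
  set κ : ℝ≥0∞ := ENNReal.ofReal (1 + c₀) ^ p with hκ
  have hκt : κ ≠ ⊤ := ENNReal.rpow_ne_top_of_nonneg hp0.le ENNReal.ofReal_ne_top
  have h2t : (2 : ℝ≥0∞) ^ (p - 1) ≠ ⊤ := ENNReal.rpow_ne_top_of_nonneg (by linarith) (by simp)
  set W : ℝ≥0∞ := 2 ^ (p - 1) * (1 + κ * S) + 1 with hW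
  have hWt : W ^ (1 / p) ≠ ⊤ := by
    refine ENNReal.rpow_ne_top_of_nonneg (by positivity) (ENNReal.add_ne_top.2 ⟨?_, by simp⟩)
    exact ENNReal.mul_ne_top h2t (ENNReal.add_ne_top.2 ⟨by simp, ENNReal.mul_ne_top hκt hS⟩)
  refine ⟨(W ^ (1 / p)).toReal + 1, by positivity, fun J u hJJ hJ hL hu => ?_⟩
  have hU'U : U' ⊆ U := subset_closure.trans hsub
  rw [setLIntegral_ofReal_norm_rpow (fun z => pds u z + J z (pdt u z)) U hp0.le,
    setLIntegral_ofReal_norm_rpow u U hp0.le]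
  set A := ∫⁻ z in U, ‖pds u z + J z (pdt u z)‖ₑ ^ p
  set Y := ∫⁻ z in U, ‖u z‖ₑ ^ p
  have hum : AEMeasurable (fun z => ‖u z‖ₑ ^ p) (volume.restrict U') :=
    ((hu.continuousOn.mono hU'U).aemeasurable hU'.measurableSet).enorm.pow_const p
  have htm : Measurable fun z => κ * ‖pdt u z‖ₑ ^ p :=
    ((measurable_fderiv_apply_const ℝ u I).enorm.pow_const p).const_mul _
  have hmain : ∫⁻ z in U', ENNReal.ofReal
      (‖u z‖ ^ p + (Real.sqrt (‖pds u z‖ ^ 2 + ‖pdt u z‖ ^ 2)) ^ p) ≤ W * (A + Y) := by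
    calc _ ≤ ∫⁻ z in U', 2 ^ (p - 1) * (‖pds u z + J z (pdt u z)‖ₑ ^ p + κ * ‖pdt u z‖ₑ ^ p) +
          ‖u z‖ₑ ^ p := setLIntegral_mono' hU'.measurableSet fun z hz =>
            ofReal_norm_rpow_add_sqrt_rpow_le hc₀ hp (hJ z (hU'U hz)) _ _ _
      _ = 2 ^ (p - 1) * ((∫⁻ z in U', ‖pds u z + J z (pdt u z)‖ₑ ^ p) +
          κ * ∫⁻ z in U', ‖pdt u z‖ₑ ^ p) + ∫⁻ z in U', ‖u z‖ₑ ^ p := by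
          rw [lintegral_add_right' _ hum, lintegral_const_mul' _ _ h2t,
            lintegral_add_right _ htm, lintegral_const_mul' _ _ hκt]
      _ ≤ 2 ^ (p - 1) * ((A + Y) + κ * (S * (A + Y))) + (A + Y) := by
          gcongr
          · exact (lintegral_mono_set hU'U).trans le_self_add
          · exact H J u hJJ hJ hL hu
          · exact (lintegral_mono_set hU'U).trans le_add_self
      _ = W * (A + Y) := by rw [hW]; ring
  calc _ ≤ (W * (A + Y)) ^ (1 / p) := ENNReal.rpow_le_rpow hmain (by positivity)
    _ = W ^ (1 / p) * (A + Y) ^ (1 / p) := ENNReal.mul_rpow_of_nonneg _ _ (by positivity)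
    _ ≤ ENNReal.ofReal ((W ^ (1 / p)).toReal + 1) * (A ^ (1 / p) + Y ^ (1 / p)) := by
        gcongr
        · exact (ENNReal.ofReal_toReal hWt).symm.le.trans
            (ENNReal.ofReal_le_ofReal (by linarith))
        · exact ENNReal.rpow_add_le_add_rpow _ _ (by positivity)
            ((div_le_one hp0).2 hp.le)
end
end

section
/- Let (φ, ψ) be a local holomorphic supercurve on an open set U ⊆ ℂ such that ψ is of class C² and the matrix-valued maps J̃ := J∘φ and D̃ := D(φ)·∂_sφ are of class C¹ on U. Then on all of U one has the identity Δψ = (−∂_s D̃ + ∂_t(J̃·D̃))·ψ + (−D̃ + ∂_t J̃)·∂_sψ + (−∂_s J̃ + J̃·D̃)·∂_tψ, where Δ := ∂_s² + ∂_t² acts componentwise on ψ. -/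
open MeasureTheory Metric Complex Set
open scoped ENNReal Real Topology

noncomputable section

/-- A pair `(φ, ψ)` is a local holomorphic supercurve on `U`, with target chart `V ⊆ ℝ^{2n}`,
almost complex structure `J` (satisfying `J(x)² = -Id` on `V`) and a map `D` which is linear
in its second argument:  `∂_s φ + J(φ) ∂_t φ = 0` and
`∂_s ψ + J(φ) ∂_t ψ + (D(φ)·∂_s φ) ψ = 0` on `U`. -/
def IsLocalHolSupercurve {n : ℕ} (U : Set ℂ) (V : Set (EV n))
    (J : EV n → (EV n →L[ℝ] EV n)) (D : EV n → (EV n →L[ℝ] (EV n →L[ℝ] EV n)))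
    (φ ψ : ℂ → EV n) : Prop :=
  MapsTo φ U V ∧ (∀ x ∈ V, J x * J x = -1) ∧
    ∀ z ∈ U, pds φ z + J (φ z) (pdt φ z) = 0 ∧
      pds ψ z + J (φ z) (pdt ψ z) + ((D (φ z)) (pds φ z)) (ψ z) = 0

/-- `W^{1,∞}` bound on `S`: the sup over `S` of `|f|` and of its first derivatives
is bounded by `c`. -/
def W1Bound {F : Type*} [NormedAddCommGroup F] [NormedSpace ℝ F]
    (f : ℂ → F) (S : Set ℂ) (c : ℝ) : Prop :=
  ∀ z ∈ S, ‖f z‖ ≤ c ∧ ‖fderiv ℝ f z‖ ≤ c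

/-- `W^{2,∞}` bound on `S`: the sup over `S` of `|f|` and of its partial derivatives
up to second order is bounded by `c`. -/
def W2Bound {F : Type*} [NormedAddCommGroup F] [NormedSpace ℝ F]
    (f : ℂ → F) (S : Set ℂ) (c : ℝ) : Prop :=
  ∀ z ∈ S, ‖f z‖ ≤ c ∧ ‖fderiv ℝ f z‖ ≤ c ∧ ‖fderiv ℝ (fun w => fderiv ℝ f w) z‖ ≤ c

section PartialDerivatives

variable {E F : Type*} [NormedAddCommGroup E] [NormedSpace ℝ E]
  [NormedAddCommGroup F] [NormedSpace ℝ F]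

/-- Leibniz rule for the derivative of a family of continuous linear maps applied to a vector. -/
theorem fderiv_family_apply {A : ℂ → E →L[ℝ] F} {u : ℂ → E} {z : ℂ}
    (hA : DifferentiableAt ℝ A z) (hu : DifferentiableAt ℝ u z) (v : ℂ) :
    fderiv ℝ (fun w => A w (u w)) z v = fderiv ℝ A z v (u z) + A z (fderiv ℝ u z v) := by
  rw [fderiv_clm_apply hA hu]
  simp [add_comm]

/-- Mixed partial derivatives of a `C²` map commute. -/
theorem pds_pdt_comm {u : ℂ → E} {z : ℂ} (hu : ContDiffAt ℝ 2 u z) :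
    pds (fun w => pdt u w) z = pdt (fun w => pds u w) z := by
  have hd : DifferentiableAt ℝ (fderiv ℝ u) z :=
    (hu.fderiv_right (m := 1) (by norm_num)).differentiableAt (by norm_num)
  have hsymm := (hu.isSymmSndFDerivAt (by simp)).eq 1 Complex.I
  have key : ∀ v w : ℂ, fderiv ℝ (fun x => fderiv ℝ u x v) z w
      = fderiv ℝ (fderiv ℝ u) z w v := fun v w => by
    rw [fderiv_family_apply hd (differentiableAt_const v)]
    simp
  simp only [pds, pdt, key]
  exact hsymm

/-- The Laplacian of a `C²` solution of `∂_s u + A ∂_t u + B u = 0` with `A² = -1`. -/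
theorem laplacian_of_perturbed_cauchyRiemann {U : Set ℂ} (hU : IsOpen U)
    {A B : ℂ → E →L[ℝ] E} {u : ℂ → E}
    (hA : ContDiffOn ℝ 1 A U) (hB : ContDiffOn ℝ 1 B U) (hu : ContDiffOn ℝ 2 u U)
    (hsq : ∀ z ∈ U, A z * A z = -1)
    (heq : ∀ z ∈ U, pds u z + A z (pdt u z) + B z (u z) = 0) {z : ℂ} (hz : z ∈ U) :
    pds (fun w => pds u w) z + pdt (fun w => pdt u w) z
      = (-(pds B z) + pdt (fun w => A w * B w) z) (u z)
        + (-(B z) + pdt A z) (pds u z) + (-(pds A z) + A z * B z) (pdt u z) := by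
  have hUz : U ∈ 𝓝 z := hU.mem_nhds hz
  have hu2 : ContDiffAt ℝ 2 u z := hu.contDiffAt hUz
  have hAd : DifferentiableAt ℝ A z := (hA.contDiffAt hUz).differentiableAt (by norm_num)
  have hBd : DifferentiableAt ℝ B z := (hB.contDiffAt hUz).differentiableAt (by norm_num)
  have hud : DifferentiableAt ℝ u z := hu2.differentiableAt (by norm_num)
  have hABd : DifferentiableAt ℝ (fun w => A w * B w) z := hAd.clm_comp hBd
  have hd : DifferentiableAt ℝ (fderiv ℝ u) z :=
    (hu2.fderiv_right (m := 1) (by norm_num)).differentiableAt (by norm_num)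
  have hsd : DifferentiableAt ℝ (fun w => pds u w) z :=
    hd.clm_apply (differentiableAt_const _)
  have htd : DifferentiableAt ℝ (fun w => pdt u w) z :=
    hd.clm_apply (differentiableAt_const _)
  have hs : (fun w => pds u w) =ᶠ[𝓝 z] fun w => -(A w (pdt u w) + B w (u w)) := by
    filter_upwards [hUz] with w hw
    rw [eq_neg_iff_add_eq_zero, ← add_assoc]
    exact heq w hw
  have ht : (fun w => pdt u w) =ᶠ[𝓝 z] fun w => A w (pds u w) + (A w * B w) (u w) := by
    filter_upwards [hUz] with w hw
    have h1 := congrArg (A w) (heq w hw)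
    have h2 : A w (A w (pdt u w)) = -pdt u w := by
      simpa using DFunLike.congr_fun (hsq w hw) (pdt u w)
    rw [map_add, map_add, h2, map_zero] at h1
    rw [mul_apply_eq_comp, ← sub_eq_zero, ← neg_eq_zero, ← h1]
    abel
  have hss : pds (fun w => pds u w) z = -((pds A z (pdt u z) + A z (pds (fun w => pdt u w) z))
      + (pds B z (u z) + B z (pds u z))) := by
    rw [pds, hs.fderiv_eq, fderiv_fun_neg,
      fderiv_fun_add (hAd.clm_apply htd) (hBd.clm_apply hud), neg_apply, add_apply,
      fderiv_family_apply hAd htd, fderiv_family_apply hBd hud]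
    rfl
  have htt : pdt (fun w => pdt u w) z = (pdt A z (pds u z) + A z (pdt (fun w => pds u w) z))
      + (pdt (fun w => A w * B w) z (u z) + (A z * B z) (pdt u z)) := by
    rw [pdt, ht.fderiv_eq, fderiv_fun_add (hAd.clm_apply hsd) (hABd.clm_apply hud), add_apply,
      fderiv_family_apply hAd hsd, fderiv_family_apply hABd hud]
    rfl
  rw [hss, htt, pds_pdt_comm hu2]
  simp only [add_apply, neg_apply]
  abel

end PartialDerivatives

/-- For a local holomorphic supercurve `(φ, ψ)` with `ψ` of class `C²` and
`J̃ := J∘φ`, `D̃ := D(φ)·∂_s φ` of class `C¹` on `U`, the Laplacian of `ψ` satisfies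
`Δψ = (−∂_s D̃ + ∂_t(J̃ D̃)) ψ + (−D̃ + ∂_t J̃) ∂_s ψ + (−∂_s J̃ + J̃ D̃) ∂_t ψ` on `U`. -/
theorem laplacian_of_supercurve_section (n : ℕ) (U : Set ℂ) (hU : IsOpen U)
    (V : Set (EV n)) (hV : IsOpen V)
    (J : EV n → (EV n →L[ℝ] EV n)) (D : EV n → (EV n →L[ℝ] (EV n →L[ℝ] EV n)))
    (φ ψ : ℂ → EV n)
    (hsc : IsLocalHolSupercurve U V J D φ ψ)
    (hφ : ContDiffOn ℝ 1 φ U)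
    (hψ : ContDiffOn ℝ 2 ψ U)
    (hJt : ContDiffOn ℝ 1 (fun z => J (φ z)) U)
    (hDt : ContDiffOn ℝ 1 (fun z => (D (φ z)) (pds φ z)) U) :
    ∀ z ∈ U,
      pds (fun w => pds ψ w) z + pdt (fun w => pdt ψ w) z
        = (-(pds (fun w => (D (φ w)) (pds φ w)) z)
            + pdt (fun w => J (φ w) * ((D (φ w)) (pds φ w))) z) (ψ z)
          + (-((D (φ z)) (pds φ z)) + pdt (fun w => J (φ w)) z) (pds ψ z)
          + (-(pds (fun w => J (φ w)) z) + J (φ z) * ((D (φ z)) (pds φ z))) (pdt ψ z) := by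
  obtain ⟨hmaps, hsq, heq⟩ := hsc
  exact fun z hz => laplacian_of_perturbed_cauchyRiemann hU hJt hDt hψ
    (fun w hw => hsq _ (hmaps hw)) (fun w hw => (heq w hw).2) hz
end
end

section
/- Let 0 ∈ U ⊆ ℂ be an open set, let v : U∖{0} → ℝ^{2n} be of class C¹, and suppose there are constants r₀ > 0, 0 < B < ∞ and 0 < ν < 1 such that B_{r₀} ⊆ U and |dv(r·e^{iθ})|² ≤ B·r^{2ν−2} for all 0 < r < r₀ and all θ ∈ [0, 2π). Then v extends continuously over 0, and there is a constant C > 0 such that the extension satisfies |v(x) − v(y)| ≤ C·|x − y|^ν for all x, y ∈ B_{r₀} (i.e., it is Hölder continuous with exponent ν on B_{r₀}). -/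
open MeasureTheory Metric Complex Set
open scoped ENNReal Real Topology

noncomputable section

/-- Every complex number has a polar representation with angle in `[0, 2π)`. -/
theorem exists_polar_angle_Ico (z : ℂ) :
    ∃ θ ∈ Ico (0 : ℝ) (2 * Real.pi),
      ((‖z‖ : ℝ) : ℂ) * Complex.exp ((θ : ℂ) * Complex.I) = z := by
  have h1 := Complex.neg_pi_lt_arg z
  have h2 := Complex.arg_le_pi z
  have hpi := Real.pi_pos
  rcases le_or_gt 0 (Complex.arg z) with h | h
  · exact ⟨Complex.arg z, ⟨h, by linarith⟩, Complex.norm_mul_exp_arg_mul_I z⟩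
  · refine ⟨Complex.arg z + 2 * Real.pi, ⟨by linarith, by linarith⟩, ?_⟩
    have h3 : ((Complex.arg z + 2 * Real.pi : ℝ) : ℂ) * Complex.I
        = (Complex.arg z : ℂ) * Complex.I + 2 * Real.pi * Complex.I := by
      push_cast
      ring
    rw [h3, Complex.exp_add, Complex.exp_two_pi_mul_I, mul_one,
      Complex.norm_mul_exp_arg_mul_I]

/-- A real-linear map on `ℂ` that is bounded by `S` at `1` and `I` has norm at most `2 * S`. -/
theorem opNorm_le_two_mul_of_one_I {F : Type*} [NormedAddCommGroup F] [NormedSpace ℝ F]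
    (T : ℂ →L[ℝ] F) {S : ℝ} (hS : 0 ≤ S) (h1 : ‖T 1‖ ≤ S) (hI : ‖T Complex.I‖ ≤ S) :
    ‖T‖ ≤ 2 * S := by
  refine T.opNorm_le_bound (by positivity) fun h => ?_
  have hh : T h = h.re • T 1 + h.im • T Complex.I := by
    rw [← map_smul, ← map_smul, ← map_add]
    congr 1
    apply Complex.ext <;> simp
  calc ‖T h‖ ≤ ‖h.re • T 1‖ + ‖h.im • T Complex.I‖ := by rw [hh]; exact norm_add_le _ _
    _ = |h.re| * ‖T 1‖ + |h.im| * ‖T Complex.I‖ := by simp [norm_smul]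
    _ ≤ ‖h‖ * S + ‖h‖ * S := by
        gcongr
        · exact Complex.abs_re_le_norm h
        · exact Complex.abs_im_le_norm h
    _ = 2 * S * ‖h‖ := by ring

section PuncturedDisc

variable {F : Type*} [NormedAddCommGroup F] [NormedSpace ℝ F] {v : ℂ → F} {r₀ M ν : ℝ}

/-- Radial estimate: the growth of `v` along a ray is controlled by integrating the bound on
its derivative. -/
theorem norm_sub_smul_le_of_fderiv_le (hν0 : 0 < ν) (hM : 0 ≤ M)
    (hd : ∀ z : ℂ, z ≠ 0 → ‖z‖ < r₀ → DifferentiableAt ℝ v z)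
    (hb : ∀ z : ℂ, z ≠ 0 → ‖z‖ < r₀ → ‖fderiv ℝ v z‖ ≤ M * ‖z‖ ^ (ν - 1))
    {x : ℂ} (hx0 : x ≠ 0) (hx : ‖x‖ < r₀) {s : ℝ} (hs : 0 < s) (hs1 : s ≤ 1) :
    ‖v x - v (s • x)‖ ≤ M / ν * ‖x‖ ^ ν := by
  have hxn : 0 < ‖x‖ := norm_pos_iff.mpr hx0
  have hne : ∀ t ∈ Icc s 1, t • x ≠ 0 := fun t ht =>
    smul_ne_zero (hs.trans_le ht.1).ne' hx0
  have hnorm : ∀ t ∈ Icc s 1, ‖t • x‖ = t * ‖x‖ := fun t ht => by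
    rw [norm_smul, Real.norm_of_nonneg (hs.trans_le ht.1).le]
  have hlt : ∀ t ∈ Icc s 1, ‖t • x‖ < r₀ := fun t ht => by
    rw [hnorm t ht]
    nlinarith [ht.2]
  have hderiv : ∀ t ∈ Icc s 1,
      HasDerivAt (fun t : ℝ => v (t • x) - v (s • x)) (fderiv ℝ v (t • x) x) t := fun t ht => by
    have h1 : HasDerivAt (fun t : ℝ => t • x) x t := by
      simpa using (hasDerivAt_id t).smul_const x
    exact ((hd _ (hne t ht) (hlt t ht)).hasFDerivAt.comp_hasDerivAt t h1).sub_const _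
  have hbound : ∀ t ∈ Icc s 1,
      HasDerivAt (fun t : ℝ => M / ν * ‖x‖ ^ ν * (t ^ ν - s ^ ν))
        (M * ‖x‖ ^ ν * t ^ (ν - 1)) t := fun t ht => by
    have h1 := ((Real.hasDerivAt_rpow_const (x := t) (p := ν)
      (Or.inl (hs.trans_le ht.1).ne')).sub_const (s ^ ν)).const_mul (M / ν * ‖x‖ ^ ν)
    exact h1.congr_deriv (by field_simp)
  have key := image_norm_le_of_norm_deriv_right_le_deriv_boundary'
    (f := fun t : ℝ => v (t • x) - v (s • x)) (f' := fun t => fderiv ℝ v (t • x) x)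
    (a := s) (b := 1) (B := fun t : ℝ => M / ν * ‖x‖ ^ ν * (t ^ ν - s ^ ν))
    (B' := fun t => M * ‖x‖ ^ ν * t ^ (ν - 1))
    (fun t ht => (hderiv t ht).continuousAt.continuousWithinAt)
    (fun t ht => (hderiv t (Ico_subset_Icc_self ht)).hasDerivWithinAt)
    (by simp)
    (fun t ht => (hbound t ht).continuousAt.continuousWithinAt)
    (fun t ht => (hbound t (Ico_subset_Icc_self ht)).hasDerivWithinAt)
    (fun t ht' => by
      have ht := Ico_subset_Icc_self ht'
      have ht0 : 0 < t := hs.trans_le ht.1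
      calc ‖fderiv ℝ v (t • x) x‖ ≤ ‖fderiv ℝ v (t • x)‖ * ‖x‖ :=
            ContinuousLinearMap.le_opNorm _ _
        _ ≤ M * (t * ‖x‖) ^ (ν - 1) * ‖x‖ := by
            rw [← hnorm t ht]
            gcongr
            exact hb _ (hne t ht) (hlt t ht)
        _ = M * ‖x‖ ^ ν * t ^ (ν - 1) := by
            rw [Real.mul_rpow ht0.le hxn.le, Real.rpow_sub_one hxn.ne']
            field_simp)
    (right_mem_Icc.mpr hs1)
  simp only [one_smul, Real.one_rpow] at key
  refine key.trans ?_
  have h3 : 0 ≤ s ^ ν := by positivity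
  have h4 : 0 ≤ M / ν * ‖x‖ ^ ν := by positivity
  nlinarith

/-- Angular estimate: the oscillation of `v` on a circle centred at `0`. -/
theorem norm_sub_le_of_norm_eq_of_fderiv_le
    (hd : ∀ z : ℂ, z ≠ 0 → ‖z‖ < r₀ → DifferentiableAt ℝ v z)
    (hb : ∀ z : ℂ, z ≠ 0 → ‖z‖ < r₀ → ‖fderiv ℝ v z‖ ≤ M * ‖z‖ ^ (ν - 1)) (hM : 0 ≤ M)
    {x y : ℂ} (hx0 : x ≠ 0) (hx : ‖x‖ < r₀) (hxy : ‖y‖ = ‖x‖) :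
    ‖v x - v y‖ ≤ 2 * Real.pi * M * ‖x‖ ^ ν := by
  have hxn : 0 < ‖x‖ := norm_pos_iff.mpr hx0
  set c : ℝ → ℂ := fun θ => ((‖x‖ : ℝ) : ℂ) * Complex.exp ((θ : ℂ) * Complex.I) with hc
  have hcn : ∀ θ, ‖c θ‖ = ‖x‖ := fun θ => by
    simp [hc, Complex.norm_exp_ofReal_mul_I]
  have hc0 : ∀ θ, c θ ≠ 0 := fun θ => by
    rw [← norm_pos_iff, hcn]
    exact hxn
  have hcd : ∀ θ, HasDerivAt c (c θ * Complex.I) θ := fun θ => by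
    have h1 : HasDerivAt (fun θ : ℝ => (θ : ℂ) * Complex.I) Complex.I θ := by
      simpa using (Complex.ofRealCLM.hasDerivAt (x := θ)).mul_const Complex.I
    simpa [hc, mul_assoc] using h1.cexp.const_mul ((‖x‖ : ℝ) : ℂ)
  have hgd : ∀ θ, HasDerivAt (v ∘ c) (fderiv ℝ v (c θ) (c θ * Complex.I)) θ := fun θ =>
    (hd _ (hc0 θ) ((hcn θ).trans_lt hx)).hasFDerivAt.comp_hasDerivAt θ (hcd θ)
  obtain ⟨α, hα, hαx⟩ := exists_polar_angle_Ico x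
  obtain ⟨β, hβ, hβy⟩ := exists_polar_angle_Ico y
  rw [hxy] at hβy
  have key := (convex_univ : Convex ℝ (univ : Set ℝ)).norm_image_sub_le_of_norm_hasDerivWithin_le
    (f := v ∘ c) (C := M * ‖x‖ ^ ν) (x := β) (y := α)
    (fun θ _ => (hgd θ).hasDerivWithinAt)
    (fun θ _ => by
      calc ‖fderiv ℝ v (c θ) (c θ * Complex.I)‖
          ≤ ‖fderiv ℝ v (c θ)‖ * ‖c θ * Complex.I‖ := ContinuousLinearMap.le_opNorm _ _
        _ ≤ M * ‖x‖ ^ (ν - 1) * ‖x‖ := by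
            have h := hb _ (hc0 θ) ((hcn θ).trans_lt hx)
            rw [hcn] at h
            rw [norm_mul, hcn, Complex.norm_I, mul_one]
            gcongr
        _ = M * ‖x‖ ^ ν := by
            rw [Real.rpow_sub_one hxn.ne']
            field_simp)
    (mem_univ _) (mem_univ _)
  have e1 : (v ∘ c) α = v x := congrArg v hαx
  have e2 : (v ∘ c) β = v y := congrArg v hβy
  rw [e1, e2] at key
  have habs : ‖α - β‖ ≤ 2 * Real.pi := by
    rw [Real.norm_eq_abs, abs_le]
    constructor <;> linarith [hα.1, hα.2, hβ.1, hβ.2]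
  calc ‖v x - v y‖ ≤ M * ‖x‖ ^ ν * ‖α - β‖ := key
    _ ≤ M * ‖x‖ ^ ν * (2 * Real.pi) := by gcongr
    _ = 2 * Real.pi * M * ‖x‖ ^ ν := by ring

/-- Oscillation of `v` on a punctured disc. -/
theorem norm_sub_le_of_norm_le_of_fderiv_le (hν0 : 0 < ν) (hM : 0 ≤ M)
    (hd : ∀ z : ℂ, z ≠ 0 → ‖z‖ < r₀ → DifferentiableAt ℝ v z)
    (hb : ∀ z : ℂ, z ≠ 0 → ‖z‖ < r₀ → ‖fderiv ℝ v z‖ ≤ M * ‖z‖ ^ (ν - 1))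
    {x y : ℂ} (hy0 : y ≠ 0) (hx : ‖x‖ < r₀) (hyx : ‖y‖ ≤ ‖x‖) :
    ‖v x - v y‖ ≤ (M / ν + 2 * Real.pi * M) * ‖x‖ ^ ν := by
  have hyn : 0 < ‖y‖ := norm_pos_iff.mpr hy0
  have hxn : 0 < ‖x‖ := hyn.trans_le hyx
  have hx0 : x ≠ 0 := norm_pos_iff.mp hxn
  have hs : 0 < ‖y‖ / ‖x‖ := by positivity
  have hn : ‖(‖y‖ / ‖x‖) • x‖ = ‖y‖ := by
    rw [norm_smul, Real.norm_of_nonneg hs.le]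
    field_simp
  have h1 := norm_sub_smul_le_of_fderiv_le hν0 hM hd hb hx0 hx hs ((div_le_one hxn).mpr hyx)
  have h2 := norm_sub_le_of_norm_eq_of_fderiv_le hd hb hM hy0 (hyx.trans_lt hx) hn
  rw [norm_sub_rev] at h2
  have h3 : ‖y‖ ^ ν ≤ ‖x‖ ^ ν := by gcongr
  have h4 : 2 * Real.pi * M * ‖y‖ ^ ν ≤ 2 * Real.pi * M * ‖x‖ ^ ν := by gcongr
  have h5 := norm_sub_le_norm_sub_add_norm_sub (v x) (v ((‖y‖ / ‖x‖) • x)) (v y)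
  linarith

/-- Hölder estimate for two points whose distance is small compared with the distance to `0`. -/
theorem norm_sub_le_rpow_of_two_mul_le (hν1 : ν < 1) (hM : 0 ≤ M)
    (hd : ∀ z : ℂ, z ≠ 0 → ‖z‖ < r₀ → DifferentiableAt ℝ v z)
    (hb : ∀ z : ℂ, z ≠ 0 → ‖z‖ < r₀ → ‖fderiv ℝ v z‖ ≤ M * ‖z‖ ^ (ν - 1))
    {x y : ℂ} (hx : ‖x‖ < r₀) (hy : ‖y‖ < r₀) (hne : x ≠ y) (hxy : 2 * ‖x - y‖ ≤ ‖x‖) :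
    ‖v x - v y‖ ≤ M * ‖x - y‖ ^ ν := by
  have hdpos : 0 < ‖x - y‖ := norm_pos_iff.mpr (sub_ne_zero.mpr hne)
  have hseg : ∀ z ∈ segment ℝ y x, ‖z‖ < r₀ ∧ ‖x - y‖ ≤ ‖z‖ := fun z hz => by
    constructor
    · have h := (convex_ball (0 : ℂ) r₀).segment_subset (by simpa using hy) (by simpa using hx) hz
      simpa using h
    · have h := (convex_closedBall x ‖x - y‖).segment_subset
        (by simp [dist_eq_norm, norm_sub_rev y x]) (by simp) hz
      rw [mem_closedBall, dist_eq_norm, norm_sub_rev] at h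
      have h2 := norm_sub_norm_le x z
      linarith
  have hz0 : ∀ z ∈ segment ℝ y x, z ≠ 0 := fun z hz =>
    norm_pos_iff.mp (hdpos.trans_le (hseg z hz).2)
  have key := (convex_segment (𝕜 := ℝ) y x).norm_image_sub_le_of_norm_fderiv_le
    (f := v) (C := M * ‖x - y‖ ^ (ν - 1))
    (fun z hz => hd z (hz0 z hz) (hseg z hz).1)
    (fun z hz => (hb z (hz0 z hz) (hseg z hz).1).trans
      (mul_le_mul_of_nonneg_left
        (Real.rpow_le_rpow_of_nonpos hdpos (hseg z hz).2 (by linarith)) hM))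
    (left_mem_segment ℝ y x) (right_mem_segment ℝ y x)
  refine key.trans_eq ?_
  rw [Real.rpow_sub_one hdpos.ne']
  field_simp

/-- A function on a punctured disc whose derivative is `O(|z| ^ (ν - 1))` has a limit at the
puncture, which it approaches at rate `|z| ^ ν`. -/
theorem exists_tendsto_punctured_of_fderiv_le [CompleteSpace F] (hr₀ : 0 < r₀) (hν0 : 0 < ν)
    (hM : 0 ≤ M)
    (hd : ∀ z : ℂ, z ≠ 0 → ‖z‖ < r₀ → DifferentiableAt ℝ v z)
    (hb : ∀ z : ℂ, z ≠ 0 → ‖z‖ < r₀ → ‖fderiv ℝ v z‖ ≤ M * ‖z‖ ^ (ν - 1)) :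
    ∃ l : F, Filter.Tendsto v (𝓝[≠] 0) (𝓝 l) ∧
      ∀ x : ℂ, x ≠ 0 → ‖x‖ < r₀ → ‖v x - l‖ ≤ (M / ν + 2 * Real.pi * M) * ‖x‖ ^ ν := by
  set K := M / ν + 2 * Real.pi * M with hK
  have hosc : ∀ x : ℂ, x ≠ 0 → ‖x‖ < r₀ → ∀ᶠ y in 𝓝[≠] (0 : ℂ), ‖v x - v y‖ ≤ K * ‖x‖ ^ ν := by
    intro x hx0 hx
    have h1 : ∀ᶠ y in 𝓝[≠] (0 : ℂ), ‖y‖ < ‖x‖ := by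
      have h := ball_mem_nhds (0 : ℂ) (norm_pos_iff.mpr hx0)
      filter_upwards [mem_nhdsWithin_of_mem_nhds h] with y hy
      simpa using hy
    filter_upwards [h1, self_mem_nhdsWithin] with y hy hy0
    exact norm_sub_le_of_norm_le_of_fderiv_le hν0 hM hd hb hy0 hx hy.le
  have hsmall : Filter.Tendsto (fun x : ℂ => K * ‖x‖ ^ ν) (𝓝[≠] 0) (𝓝 0) := by
    have h : ContinuousAt (fun x : ℂ => K * ‖x‖ ^ ν) 0 :=
      continuousAt_const.mul (continuousAt_id.norm.rpow_const (Or.inr hν0.le))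
    have h2 := h.tendsto
    simp only [norm_zero, Real.zero_rpow hν0.ne', mul_zero] at h2
    exact h2.mono_left nhdsWithin_le_nhds
  have hcauchy : Cauchy (Filter.map v (𝓝[≠] 0)) := by
    rw [Metric.cauchy_iff]
    refine ⟨inferInstance, fun ε hε => ?_⟩
    have hlt : ∀ᶠ x in 𝓝[≠] (0 : ℂ), ‖x‖ < r₀ := by
      filter_upwards [mem_nhdsWithin_of_mem_nhds (ball_mem_nhds (0 : ℂ) hr₀)] with y hy
      simpa using hy
    obtain ⟨x, ⟨hx1, hx2⟩, hx0⟩ :=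
      ((hsmall.eventually (gt_mem_nhds (half_pos hε))).and hlt |>.and self_mem_nhdsWithin).exists
    refine ⟨ball (v x) (ε / 2), ?_, fun a ha b hb' => ?_⟩
    · rw [Filter.mem_map]
      filter_upwards [hosc x hx0 hx2] with y hy
      rw [mem_preimage, mem_ball, dist_eq_norm, norm_sub_rev]
      exact hy.trans_lt hx1
    · have h1 := dist_triangle_right a b (v x)
      rw [mem_ball] at ha hb'
      linarith
  obtain ⟨l, hl⟩ := CompleteSpace.complete hcauchy
  exact ⟨l, hl, fun x hx0 hx =>
    le_of_tendsto (tendsto_const_nhds.sub (show Filter.Tendsto v _ _ from hl)).norm (hosc x hx0 hx)⟩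

/-- The extension of `v` over the puncture by its limit is `ν`-Hölder on the disc. -/
theorem norm_update_sub_le_of_fderiv_le (hν0 : 0 < ν) (hν1 : ν < 1) (hM : 0 ≤ M)
    (hd : ∀ z : ℂ, z ≠ 0 → ‖z‖ < r₀ → DifferentiableAt ℝ v z)
    (hb : ∀ z : ℂ, z ≠ 0 → ‖z‖ < r₀ → ‖fderiv ℝ v z‖ ≤ M * ‖z‖ ^ (ν - 1))
    {l : F} {K : ℝ} (hMK : M ≤ K)
    (hl : ∀ x : ℂ, x ≠ 0 → ‖x‖ < r₀ → ‖v x - l‖ ≤ K * ‖x‖ ^ ν)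
    {x y : ℂ} (hx : ‖x‖ < r₀) (hy : ‖y‖ < r₀) :
    ‖Function.update v 0 l x - Function.update v 0 l y‖ ≤ 4 * K * ‖x - y‖ ^ ν := by
  have hK : 0 ≤ K := hM.trans hMK
  have hnear : ∀ a b : ℂ, ‖a‖ < r₀ → ‖b‖ < r₀ → a ≠ b → 2 * ‖a - b‖ ≤ ‖a‖ →
      ‖Function.update v 0 l a - Function.update v 0 l b‖ ≤ 4 * K * ‖a - b‖ ^ ν := by
    intro a b ha hb' hab hle
    have hpos : 0 < ‖a - b‖ := norm_pos_iff.mpr (sub_ne_zero.mpr hab)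
    have ha0 : a ≠ 0 := norm_pos_iff.mp (by linarith)
    have hb0 : b ≠ 0 := by
      rintro rfl
      rw [sub_zero] at hle hpos
      linarith
    rw [Function.update_of_ne ha0, Function.update_of_ne hb0]
    refine (norm_sub_le_rpow_of_two_mul_le hν1 hM hd hb ha hb' hab hle).trans ?_
    gcongr
    linarith
  rcases eq_or_ne x y with rfl | hxy
  · simp only [sub_self, norm_zero]
    positivity
  rcases le_or_gt (2 * ‖x - y‖) ‖x‖ with h1 | h1
  · exact hnear x y hx hy hxy h1
  rcases le_or_gt (2 * ‖x - y‖) ‖y‖ with h2 | h2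
  · rw [norm_sub_rev, norm_sub_rev x y]
    rw [norm_sub_rev] at h2
    exact hnear y x hy hx hxy.symm h2
  have hfar : ∀ a : ℂ, ‖a‖ < r₀ → ‖a‖ < 2 * ‖x - y‖ →
      ‖Function.update v 0 l a - l‖ ≤ 2 * K * ‖x - y‖ ^ ν := by
    intro a ha hlt
    rcases eq_or_ne a 0 with rfl | ha0
    · simp only [Function.update_self, sub_self, norm_zero]
      positivity
    rw [Function.update_of_ne ha0]
    have h2ν : (2 : ℝ) ^ ν ≤ 2 := by
      simpa using Real.rpow_le_rpow_of_exponent_le one_le_two hν1.le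
    calc ‖v a - l‖ ≤ K * ‖a‖ ^ ν := hl a ha0 ha
      _ ≤ K * (2 * ‖x - y‖) ^ ν := by gcongr
      _ = K * (2 ^ ν * ‖x - y‖ ^ ν) := by rw [Real.mul_rpow two_pos.le (norm_nonneg _)]
      _ ≤ K * (2 * ‖x - y‖ ^ ν) := by gcongr
      _ = 2 * K * ‖x - y‖ ^ ν := by ring
  have h3 := hfar x hx h1
  have h4 := hfar y hy h2
  rw [norm_sub_rev] at h4
  have h5 := norm_sub_le_norm_sub_add_norm_sub (Function.update v 0 l x) l
    (Function.update v 0 l y)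
  linarith

end PuncturedDisc

/-- A `C¹` map `v` on `U ∖ {0}` whose derivative satisfies `|dv(r e^{iθ})|² ≤ B r^{2ν-2}`
near `0` extends continuously over `0`, and the extension is `ν`-Hölder continuous on
`B_{r₀}`. -/
theorem holder_continuous_extension (n : ℕ) (U : Set ℂ) (hU : IsOpen U) (h0 : (0 : ℂ) ∈ U)
    (v : ℂ → EV n) (hv : ContDiffOn ℝ 1 v (U \ {0}))
    (r₀ B ν : ℝ) (hr₀ : 0 < r₀) (hB : 0 < B) (hν0 : 0 < ν) (hν1 : ν < 1)
    (hball : ball (0 : ℂ) r₀ ⊆ U)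
    (hdecay : ∀ r : ℝ, 0 < r → r < r₀ → ∀ θ ∈ Ico (0 : ℝ) (2 * Real.pi),
      ‖pds v ((r : ℂ) * Complex.exp ((θ : ℂ) * Complex.I))‖ ^ 2
          + ‖pdt v ((r : ℂ) * Complex.exp ((θ : ℂ) * Complex.I))‖ ^ 2
        ≤ B * r ^ (2 * ν - 2)) :
    ∃ vbar : ℂ → EV n, EqOn vbar v (U \ {0}) ∧ ContinuousOn vbar U ∧
      ∃ C > (0 : ℝ), ∀ x ∈ ball (0 : ℂ) r₀, ∀ y ∈ ball (0 : ℂ) r₀,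
        ‖vbar x - vbar y‖ ≤ C * ‖x - y‖ ^ ν := by
  have hopen : IsOpen (U \ {0}) := hU.sdiff isClosed_singleton
  set M := 2 * √B with hMdef
  have hM : 0 < M := by positivity
  have hd : ∀ z : ℂ, z ≠ 0 → ‖z‖ < r₀ → DifferentiableAt ℝ v z := fun z hz0 hz =>
    (hv.differentiableOn one_ne_zero).differentiableAt
      (hopen.mem_nhds ⟨hball (by simpa using hz), hz0⟩)
  have hb : ∀ z : ℂ, z ≠ 0 → ‖z‖ < r₀ → ‖fderiv ℝ v z‖ ≤ M * ‖z‖ ^ (ν - 1) := by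
    intro z hz0 hz
    have hzn : 0 < ‖z‖ := norm_pos_iff.mpr hz0
    obtain ⟨θ, hθ, hzθ⟩ := exists_polar_angle_Ico z
    have h := hdecay ‖z‖ hzn hz θ hθ
    rw [hzθ] at h
    have hsq : B * ‖z‖ ^ (2 * ν - 2) = (√B * ‖z‖ ^ (ν - 1)) ^ 2 := by
      rw [mul_pow, Real.sq_sqrt hB.le, ← Real.rpow_mul_natCast hzn.le]
      congr 2
      push_cast
      ring
    rw [hsq] at h
    have hS : 0 ≤ √B * ‖z‖ ^ (ν - 1) := by positivity
    rw [hMdef, mul_assoc]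
    exact opNorm_le_two_mul_of_one_I _ hS
      (abs_le_of_sq_le_sq' (by unfold pds at h; linarith [sq_nonneg ‖pdt v z‖]) hS).2
      (abs_le_of_sq_le_sq' (by unfold pdt at h; linarith [sq_nonneg ‖pds v z‖]) hS).2
  obtain ⟨l, hl, hlK⟩ := exists_tendsto_punctured_of_fderiv_le hr₀ hν0 hM.le hd hb
  have hMK : M ≤ M / ν + 2 * Real.pi * M := by
    have h1 : M ≤ M / ν := by
      rw [le_div_iff₀ hν0]
      nlinarith
    have h2 : 0 ≤ 2 * Real.pi * M := by positivity
    linarith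
  refine ⟨Function.update v 0 l, fun z hz => Function.update_of_ne hz.2 _ _, fun z hz => ?_,
    4 * (M / ν + 2 * Real.pi * M), by positivity, fun x hx y hy => ?_⟩
  · refine ContinuousAt.continuousWithinAt ?_
    rcases eq_or_ne z 0 with rfl | hz0
    · exact continuousAt_update_same.mpr hl
    · rw [continuousAt_update_of_ne hz0]
      exact hv.continuousOn.continuousAt (hopen.mem_nhds ⟨hz, hz0⟩)
  · exact norm_update_sub_le_of_fderiv_le hν0 hν1 hM.le hd hb hMK hlK
      (by simpa using hx) (by simpa using hy)
end
end
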